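/- arXiv:2001.05754 — 2 statements merged into one kernel-verified Lean document; each statement's English description precedes it below -/
import Mathlib

section
/- (Kato–Ponce commutator estimate) Let s > 0 and let D^s = (1-∂²ₓₓ)^{s/2} on the torus. There is C_s > 0 such that for all f ∈ H^s ∩ W^{1,∞} and g ∈ H^{s-1} ∩ L^∞: ‖[D^s, f] g‖_{L²} ≤ C_s (‖D^s f‖_{L²} ‖g‖_{L^∞} + ‖∂ₓ f‖_{L^∞} ‖D^{s-1} g‖_{L²}). -/
open Real Complex

lemma twoPiPos : (0:ℝ) < 2 * π := by positivity

/-- The `H^σ` norm of a sequence of Fourier coefficients (for `σ = 0` this is the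
`L²` norm, up to the fixed Parseval constant). -/
noncomputable def seqHs (σ : ℝ) (a : ℤ → ℂ) : ℝ :=
  Real.sqrt (∑' k : ℤ, ((1:ℝ) + (k:ℝ)^2) ^ σ * ‖a k‖^2)

/-- The `m`-th Fourier coefficient of the commutator `[D^s, f] g = D^s(fg) - f D^s g`,
where `D^s` is the Fourier multiplier with symbol `(1+m²)^{s/2}`. -/
noncomputable def commCoeff (s : ℝ) (f g : ℝ → ℂ) (m : ℤ) : ℂ :=
  (((1:ℝ) + (m:ℝ)^2) ^ (s/2) : ℝ) * fourierCoeffOn twoPiPos (fun x => f x * g x) m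
  - ∑' j : ℤ, fourierCoeffOn twoPiPos f (m - j) *
      ((((1:ℝ) + (j:ℝ)^2) ^ (s/2) : ℝ) : ℂ) * fourierCoeffOn twoPiPos g j

namespace KP

/-- finite `ℓ²` norm -/
noncomputable def nrm (S : Finset ℤ) (G : ℤ → ℂ) : ℝ := Real.sqrt (∑ j ∈ S, ‖G j‖ ^ 2)

/-- bilinear form of a matrix -/
noncomputable def frm (S : Finset ℤ) (A : ℤ → ℤ → ℂ) (G h : ℤ → ℂ) : ℂ :=
  ∑ m ∈ S, ∑ j ∈ S, A m j * G j * h m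

/-- operator bound of a matrix -/
def OB (A : ℤ → ℤ → ℂ) (M : ℝ) : Prop :=
  ∀ S G h, ‖frm S A G h‖ ≤ M * nrm S G * nrm S h

/-- Schur multiplier bound -/
def Bd (K : ℤ → ℤ → ℂ) (c : ℝ) : Prop :=
  ∀ A M, OB A M → OB (fun m j => A m j * K m j) (c * M)

lemma nrm_nonneg (S : Finset ℤ) (G : ℤ → ℂ) : 0 ≤ nrm S G := Real.sqrt_nonneg _

lemma nrm_sq (S : Finset ℤ) (G : ℤ → ℂ) : nrm S G ^ 2 = ∑ j ∈ S, ‖G j‖ ^ 2 :=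
  Real.sq_sqrt (Finset.sum_nonneg fun _ _ => by positivity)

lemma nrm_le (S : Finset ℤ) (G G' : ℤ → ℂ) (c : ℝ) (hc : 0 ≤ c)
    (h : ∀ j ∈ S, ‖G j‖ ≤ c * ‖G' j‖) : nrm S G ≤ c * nrm S G' := by
  apply Real.sqrt_le_iff.mpr
  refine ⟨mul_nonneg hc (nrm_nonneg _ _), ?_⟩
  rw [mul_pow, nrm_sq, Finset.mul_sum]
  apply Finset.sum_le_sum
  intro j hj
  rw [← mul_pow]
  exact pow_le_pow_left₀ (norm_nonneg _) (h j hj) 2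

lemma OB.nonneg {A : ℤ → ℤ → ℂ} {M : ℝ} (h : OB A M) : 0 ≤ M := by
  have := h {0} (fun _ => 1) (fun _ => 1)
  simp [nrm] at this
  exact (norm_nonneg _).trans this

lemma OB.mono {A : ℤ → ℤ → ℂ} {M M' : ℝ} (h : OB A M) (hM : M ≤ M') : OB A M' := by
  intro S G h'
  refine (h S G h').trans ?_
  gcongr
  · exact nrm_nonneg _ _
  · exact nrm_nonneg _ _

lemma OB.mulLR {A : ℤ → ℤ → ℂ} {M : ℝ} (hA : OB A M) (a b : ℤ → ℂ) (α β : ℝ)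
    (hα : 0 ≤ α) (hβ : 0 ≤ β)
    (ha : ∀ m, ‖a m‖ ≤ α) (hb : ∀ j, ‖b j‖ ≤ β) :
    OB (fun m j => A m j * (a m * b j)) (α * β * M) := by
  intro S G h
  have e : frm S (fun m j => A m j * (a m * b j)) G h
      = frm S A (fun j => b j * G j) (fun m => a m * h m) := by
    unfold frm
    refine Finset.sum_congr rfl fun m _ => Finset.sum_congr rfl fun j _ => ?_
    ring
  rw [e]
  refine (hA S _ _).trans ?_
  have h1 : nrm S (fun j => b j * G j) ≤ β * nrm S G :=
    nrm_le _ _ _ _ hβ fun j _ => by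
      rw [norm_mul]; gcongr; exact hb j
  have h2 : nrm S (fun j => a j * h j) ≤ α * nrm S h :=
    nrm_le _ _ _ _ hα fun j _ => by
      rw [norm_mul]; gcongr; exact ha j
  have hM := hA.nonneg
  calc M * nrm S (fun j => b j * G j) * nrm S (fun j => a j * h j)
      ≤ M * (β * nrm S G) * (α * nrm S h) := by
        gcongr
        · exact nrm_nonneg _ _
        · exact mul_nonneg hM (mul_nonneg hβ (nrm_nonneg _ _))
    _ = _ := by ring

lemma OB.add {A B : ℤ → ℤ → ℂ} {M N : ℝ} (hA : OB A M) (hB : OB B N) :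
    OB (fun m j => A m j + B m j) (M + N) := by
  intro S G h
  have e : frm S (fun m j => A m j + B m j) G h = frm S A G h + frm S B G h := by
    unfold frm
    rw [← Finset.sum_add_distrib]
    refine Finset.sum_congr rfl fun m _ => ?_
    rw [← Finset.sum_add_distrib]
    refine Finset.sum_congr rfl fun j _ => ?_
    ring
  rw [e]
  refine (norm_add_le _ _).trans ?_
  have := hA S G h
  have := hB S G h
  linarith

lemma OB.zero : OB (fun _ _ => 0) 0 := by
  intro S G h
  simp [frm]

lemma OB.sum {ι : Type*} (s : Finset ι) (A : ι → ℤ → ℤ → ℂ) (M : ι → ℝ)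
    (hA : ∀ i ∈ s, OB (A i) (M i)) :
    OB (fun m j => ∑ i ∈ s, A i m j) (∑ i ∈ s, M i) := by
  classical
  induction s using Finset.induction_on with
  | empty => simpa using OB.zero
  | insert a s ha ih =>
    simp only [Finset.sum_insert ha]
    exact (hA a (by simp)).add (ih fun i hi => hA i (by simp [hi]))

lemma Bd.nonneg {K c} (h : Bd K c) : 0 ≤ c := by
  have : OB (fun m j => if m = 0 ∧ j = 0 then 1 else 0) 1 := by
    intro S G h
    have e : ‖frm S (fun m j => if m = 0 ∧ j = 0 then 1 else 0) G h‖ ≤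
        if (0:ℤ) ∈ S then ‖G 0‖ * ‖h 0‖ else 0 := by
      unfold frm
      simp only [ite_and, ite_mul, one_mul, zero_mul]
      by_cases h0 : (0:ℤ) ∈ S <;> simp [h0, Finset.sum_ite_eq']
    refine e.trans ?_
    split_ifs with h0
    · have k : ∀ G : ℤ → ℂ, ‖G 0‖ ≤ nrm S G := by
        intro G
        apply Real.le_sqrt_of_sq_le
        exact Finset.single_le_sum (f := fun j => ‖G j‖ ^ 2) (fun _ _ => by positivity) h0
      rw [one_mul]
      exact mul_le_mul (k G) (k h) (norm_nonneg _) (nrm_nonneg _ _)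
    · rw [one_mul]; exact mul_nonneg (nrm_nonneg _ _) (nrm_nonneg _ _)
  simpa using (h _ _ this).nonneg

lemma Bd.mono {K c c'} (h : Bd K c) (hc : c ≤ c') : Bd K c' := fun A M hA =>
  (h A M hA).mono (mul_le_mul_of_nonneg_right hc hA.nonneg)

lemma Bd.add {K K' c c'} (h : Bd K c) (h' : Bd K' c') :
    Bd (fun m j => K m j + K' m j) (c + c') := by
  intro A M hA
  have := (h A M hA).add (h' A M hA)
  simpa only [mul_add, add_mul] using this

lemma Bd.sep (a b : ℤ → ℂ) (α β : ℝ) (hα : 0 ≤ α) (hβ : 0 ≤ β)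
    (ha : ∀ m, ‖a m‖ ≤ α) (hb : ∀ j, ‖b j‖ ≤ β) :
    Bd (fun m j => a m * b j) (α * β) := fun _ _ hA => hA.mulLR a b α β hα hβ ha hb

lemma Bd.zero : Bd (fun _ _ => 0) 0 := by
  intro A M _
  simpa using OB.zero

lemma Bd.mul {K K' c c'} (h : Bd K c) (h' : Bd K' c') :
    Bd (fun m j => K m j * K' m j) (c * c') := by
  intro A M hA
  have := h' _ _ (h A M hA)
  simpa only [mul_assoc, mul_left_comm c' c] using this

lemma Bd.sum {ι : Type*} (s : Finset ι) (K : ι → ℤ → ℤ → ℂ) (c : ι → ℝ)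
    (hA : ∀ i ∈ s, Bd (K i) (c i)) :
    Bd (fun m j => ∑ i ∈ s, K i m j) (∑ i ∈ s, c i) := by
  intro A M h
  have := OB.sum s (fun i m j => A m j * K i m j) (fun i => c i * M) (fun i hi => hA i hi A M h)
  simpa only [Finset.mul_sum, Finset.sum_mul] using this

lemma Bd.neg {K c} (h : Bd K c) : Bd (fun m j => - K m j) c := by
  have := h.mul (Bd.sep (fun _ => -1) (fun _ => 1) 1 1 (by norm_num) (by norm_num) (by simp) (by simp))
  simpa using this

/-- Abel summation Schur bound -/
lemma Bd.abel (P : ℤ → Prop) [DecidablePred P] (κ : ℤ → ℕ → ℂ) (a b : ℕ) (c0 c1 : ℝ)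
    (hc0 : 0 ≤ c0) (hc1 : 0 ≤ c1)
    (h0 : ∀ m, P m → a < b → ‖κ m a‖ ≤ c0)
    (h1 : ∀ m, P m → ∀ i, a ≤ i → i + 1 < b → ‖κ m (i+1) - κ m i‖ ≤ c1) :
    Bd (fun m j => if P m ∧ a ≤ j.natAbs ∧ j.natAbs < b then κ m j.natAbs else 0)
      (c0 + (b - a : ℕ) * c1) := by
  have A0 : Bd (fun m j => (if P m ∧ a < b then κ m a else 0) *
      (if a ≤ j.natAbs ∧ j.natAbs < b then 1 else 0)) (c0 * 1) := by
    apply Bd.sep _ _ _ _ hc0 (by norm_num)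
    · intro m; split_ifs with h
      · exact h0 m h.1 h.2
      · simpa
    · intro j; split_ifs <;> simp
  have A1 : Bd (fun m j => ∑ i ∈ Finset.Ico a b, (if P m ∧ i + 1 < b then κ m (i+1) - κ m i else 0) *
      (if (a ≤ j.natAbs ∧ j.natAbs < b) ∧ i < j.natAbs then 1 else 0)) (∑ i ∈ Finset.Ico a b, c1 * 1) := by
    apply Bd.sum
    intro i hi
    rw [Finset.mem_Ico] at hi
    apply Bd.sep _ _ _ _ hc1 (by norm_num)
    · intro m; split_ifs with h
      · exact h1 m h.1 i hi.1 h.2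
      · simpa
    · intro j; split_ifs <;> simp
  have := A0.add A1
  simp only [mul_one, Finset.sum_const, Nat.card_Ico, nsmul_eq_mul] at this
  convert this using 3 with m j
  by_cases hP : P m
  · by_cases hj : a ≤ j.natAbs ∧ j.natAbs < b
    · obtain ⟨h1, h2⟩ := hj
      have hab : a < b := lt_of_le_of_lt h1 h2
      simp only [hP, h1, h2, hab, true_and, if_true, and_self]
      have : ∑ i ∈ Finset.Ico a b, (if i + 1 < b then κ m (i+1) - κ m i else 0) *
          (if i < j.natAbs then 1 else 0) = ∑ i ∈ Finset.Ico a j.natAbs, (κ m (i+1) - κ m i) := by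
        rw [← Finset.sum_subset (Finset.Ico_subset_Ico_right h2.le)]
        · apply Finset.sum_congr rfl
          intro i hi
          rw [Finset.mem_Ico] at hi
          rw [if_pos (by omega), if_pos (by omega), mul_one]
        · intro i hi hi'
          rw [Finset.mem_Ico] at hi hi'
          rw [if_neg (c := i < j.natAbs) (by omega), mul_zero]
      rw [this, Finset.sum_Ico_sub _ h1, mul_one]
      ring
    · simp [hj]
  · simp [hP]

/-- dyadic block index -/
def bl (k : ℤ) : ℕ := Nat.size k.natAbs

lemma bl_eq_iff (k : ℤ) (l : ℕ) : bl k = l ↔ (2^l / 2 ≤ k.natAbs ∧ k.natAbs < 2^l) := by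
  unfold bl
  constructor
  · rintro rfl
    refine ⟨?_, Nat.lt_size_self _⟩
    rcases Nat.eq_zero_or_pos k.natAbs with h | h
    · simp [h]
    · have h2 : 0 < Nat.size k.natAbs := Nat.size_pos.mpr h
      obtain ⟨n, hn⟩ := Nat.exists_eq_succ_of_ne_zero h2.ne'
      rw [hn, Nat.succ_eq_add_one, pow_succ, Nat.mul_div_cancel _ (by norm_num)]
      exact Nat.lt_size.mp (by omega)
  · rintro ⟨h1, h2⟩
    apply le_antisymm (Nat.size_le.mpr h2)
    rcases l with _ | l
    · simp
    · rw [pow_succ, Nat.mul_div_cancel _ (by norm_num)] at h1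
      exact Nat.lt_size.mpr h1

lemma bl_lt (k : ℤ) : k.natAbs < 2 ^ bl k := ((bl_eq_iff k _).1 rfl).2
lemma le_bl (k : ℤ) : 2 ^ bl k / 2 ≤ k.natAbs := ((bl_eq_iff k _).1 rfl).1

lemma abs_lt_bl (k : ℤ) : |(k:ℝ)| < 2 ^ bl k := by
  have := bl_lt k
  have h : ((k.natAbs : ℕ) : ℝ) < ((2 ^ bl k : ℕ) : ℝ) := by exact_mod_cast this
  rw [Nat.cast_natAbs] at h
  push_cast at h
  exact h

lemma le_abs_bl (k : ℤ) (hk : 1 ≤ bl k) : 2 ^ bl k / 2 ≤ |(k:ℝ)| := by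
  have := le_bl k
  obtain ⟨n, hn⟩ := Nat.exists_eq_add_of_le' hk
  rw [hn, pow_succ, Nat.mul_div_cancel _ (by norm_num)] at this
  have h : ((2 ^ n : ℕ) : ℝ) ≤ ((k.natAbs : ℕ) : ℝ) := by exact_mod_cast this
  rw [Nat.cast_natAbs] at h
  push_cast at h
  rw [hn, pow_succ]
  linarith

lemma one_add_sq_le (k : ℤ) : 1 + (k:ℝ)^2 ≤ 4 ^ bl k := by
  have h := bl_lt k
  have h' : |(k:ℝ)| + 1 ≤ 2 ^ bl k := by
    have h : ((k.natAbs + 1 : ℕ) : ℝ) ≤ ((2 ^ bl k : ℕ) : ℝ) := by exact_mod_cast h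
    push_cast at h
    rwa [Nat.cast_natAbs, Int.cast_abs] at h
  have e : (4:ℝ) ^ bl k = (2 ^ bl k)^2 := by rw [← pow_mul, mul_comm, pow_mul]; norm_num
  rw [e, ← sq_abs (k:ℝ)]
  nlinarith [abs_nonneg (k:ℝ)]

lemma le_one_add_sq (k : ℤ) : 4 ^ bl k / 4 ≤ 1 + (k:ℝ)^2 := by
  have e : (4:ℝ) ^ bl k = (2 ^ bl k)^2 := by rw [← pow_mul, mul_comm, pow_mul]; norm_num
  rcases Nat.eq_zero_or_pos (bl k) with h | h
  · rw [h]; norm_num; nlinarith [sq_nonneg (k:ℝ)]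
  · have := le_abs_bl k h
    rw [e, ← sq_abs (k:ℝ)]
    have : (0:ℝ) < 2 ^ bl k := by positivity
    nlinarith [abs_nonneg (k:ℝ)]

lemma rpow_bl_le (k : ℤ) (a : ℝ) : (1 + (k:ℝ)^2) ^ a ≤ 4 ^ |a| * ((4:ℝ) ^ bl k) ^ a := by
  have h1 := one_add_sq_le k
  have h2 := le_one_add_sq k
  have hp : (0:ℝ) < 1 + (k:ℝ)^2 := by positivity
  have h4 : (0:ℝ) < 4 ^ bl k := by positivity
  rcases le_total 0 a with ha | ha
  · calc (1 + (k:ℝ)^2) ^ a ≤ ((4:ℝ) ^ bl k) ^ a := Real.rpow_le_rpow hp.le h1 ha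
      _ ≤ _ := by
        apply le_mul_of_one_le_left (by positivity)
        exact Real.one_le_rpow (by norm_num) (abs_nonneg a)
  · calc (1 + (k:ℝ)^2) ^ a ≤ ((4:ℝ) ^ bl k / 4) ^ a :=
        Real.rpow_le_rpow_of_nonpos (by positivity) h2 ha
      _ = _ := by
        rw [Real.div_rpow h4.le (by norm_num), abs_of_nonpos ha, Real.rpow_neg (by norm_num)]
        field_simp

/-- restriction to a block -/
noncomputable def rs (k : ℕ) (G : ℤ → ℂ) : ℤ → ℂ := fun j => if bl j = k then G j else 0

lemma sum_rs (S : Finset ℤ) (G : ℤ → ℂ) (R : ℕ) : ∑ k ∈ Finset.range R, nrm S (rs k G) ^ 2 ≤ nrm S G ^ 2 := by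
  simp only [nrm_sq]
  rw [Finset.sum_comm]
  apply Finset.sum_le_sum
  intro j _
  by_cases h : bl j < R
  · rw [Finset.sum_eq_single (bl j)]
    · simp [rs]
    · intro b _ hb; simp [rs, hb.symm]
    · simp [h]
  · rw [Finset.sum_eq_zero]
    · positivity
    · intro k hk
      rw [Finset.mem_range] at hk
      rw [rs, if_neg (by omega)]; simp

lemma geom_dist (ρ : ℝ) (h0 : 0 ≤ ρ) (h1 : ρ < 1) (R k : ℕ) :
    ∑ l ∈ Finset.range R, ρ ^ (Nat.dist l k) ≤ 2 / (1 - ρ) := by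
  have g : ∀ n, ∑ i ∈ Finset.range n, ρ ^ i ≤ 1 / (1 - ρ) := by
    intro n
    rw [geom_sum_eq h1.ne, le_div_iff₀ (by linarith)]
    have : (ρ - 1) ≠ 0 := by linarith
    have e : (ρ ^ n - 1) / (ρ - 1) * (1 - ρ) = 1 - ρ ^ n := by field_simp; ring
    rw [e]
    have := pow_nonneg h0 n
    linarith
  have s : ∑ l ∈ Finset.range R, ρ ^ (Nat.dist l k) ≤ ∑ l ∈ Finset.range (k + R), ρ ^ (Nat.dist l k) := by
    apply Finset.sum_le_sum_of_subset_of_nonneg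
    · intro x; simp; omega
    · intros; positivity
  refine s.trans ?_
  rw [Finset.sum_range_add]
  have e1 : ∑ l ∈ Finset.range k, ρ ^ (Nat.dist l k) ≤ 1 / (1 - ρ) := by
    rw [← Finset.sum_range_reflect]
    refine le_trans ?_ (g k)
    apply Finset.sum_le_sum
    intro i hi
    rw [Finset.mem_range] at hi
    apply pow_le_pow_of_le_one h0 h1.le
    simp only [Nat.dist]; omega
  have e2 : ∑ l ∈ Finset.range R, ρ ^ (Nat.dist (k + l) k) ≤ 1 / (1 - ρ) := by
    refine le_trans (le_of_eq ?_) (g R)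
    apply Finset.sum_congr rfl
    intro i _
    congr 1
    simp only [Nat.dist]; omega
  calc _ ≤ 1 / (1 - ρ) + 1 / (1 - ρ) := add_le_add e1 e2
    _ = _ := by ring

lemma young (ρ : ℝ) (h0 : 0 ≤ ρ) (h1 : ρ < 1) (R : ℕ) (a b : ℕ → ℝ) :
    ∑ l ∈ Finset.range R, ∑ k ∈ Finset.range R, ρ ^ (Nat.dist l k) * (a k * b l)
      ≤ 2 / (1 - ρ) * (Real.sqrt (∑ k ∈ Finset.range R, a k ^ 2) *
        Real.sqrt (∑ k ∈ Finset.range R, b k ^ 2)) := by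
  have c0 : 0 ≤ 2 / (1 - ρ) := div_nonneg (by norm_num) (by linarith)
  rw [← Finset.sum_product']
  have cs := Real.sum_mul_le_sqrt_mul_sqrt (Finset.range R ×ˢ Finset.range R)
    (fun p => Real.sqrt (ρ ^ (Nat.dist p.1 p.2)) * a p.2)
    (fun p => Real.sqrt (ρ ^ (Nat.dist p.1 p.2)) * b p.1)
  have e : ∀ p : ℕ × ℕ, Real.sqrt (ρ ^ (Nat.dist p.1 p.2)) ^ 2 = ρ ^ (Nat.dist p.1 p.2) :=
    fun p => Real.sq_sqrt (by positivity)
  have e0 : ∀ p : ℕ × ℕ, Real.sqrt (ρ ^ (Nat.dist p.1 p.2)) * a p.2 *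
      (Real.sqrt (ρ ^ (Nat.dist p.1 p.2)) * b p.1) = ρ ^ (Nat.dist p.1 p.2) * (a p.2 * b p.1) := by
    intro p
    linear_combination (a p.2 * b p.1) * e p
  simp only [mul_pow, e, e0] at cs
  refine cs.trans ?_
  have s1 : ∑ p ∈ Finset.range R ×ˢ Finset.range R, ρ ^ (Nat.dist p.1 p.2) * a p.2 ^ 2
      ≤ 2 / (1 - ρ) * ∑ k ∈ Finset.range R, a k ^ 2 := by
    rw [Finset.sum_product_right, Finset.mul_sum]
    apply Finset.sum_le_sum
    intro k _
    simp only []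
    rw [← Finset.sum_mul]
    exact mul_le_mul_of_nonneg_right (geom_dist ρ h0 h1 R k) (by positivity)
  have s2 : ∑ p ∈ Finset.range R ×ˢ Finset.range R, ρ ^ (Nat.dist p.1 p.2) * b p.1 ^ 2
      ≤ 2 / (1 - ρ) * ∑ k ∈ Finset.range R, b k ^ 2 := by
    rw [Finset.sum_product, Finset.mul_sum]
    apply Finset.sum_le_sum
    intro k _
    simp only []
    rw [← Finset.sum_mul]
    simp only [Nat.dist_comm k]
    exact mul_le_mul_of_nonneg_right (geom_dist ρ h0 h1 R k) (by positivity)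
  calc _ ≤ Real.sqrt (2 / (1 - ρ) * ∑ k ∈ Finset.range R, a k ^ 2) *
        Real.sqrt (2 / (1 - ρ) * ∑ k ∈ Finset.range R, b k ^ 2) :=
        mul_le_mul (Real.sqrt_le_sqrt s1) (Real.sqrt_le_sqrt s2) (Real.sqrt_nonneg _)
          (Real.sqrt_nonneg _)
    _ = _ := by
        rw [Real.sqrt_mul c0, Real.sqrt_mul c0]
        have := Real.mul_self_sqrt c0
        linear_combination (Real.sqrt (∑ k ∈ Finset.range R, a k ^ 2) *
          Real.sqrt (∑ k ∈ Finset.range R, b k ^ 2)) * this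

lemma exists_range (S : Finset ℤ) : ∃ R : ℕ, ∀ j ∈ S, bl j < R :=
  ⟨S.sup bl + 1, fun j hj => Nat.lt_succ_of_le (Finset.le_sup (f := bl) hj)⟩

/-- decomposition of forms into blocks -/
lemma frm_blocks (S : Finset ℤ) (A : ℤ → ℤ → ℂ) (G h : ℤ → ℂ) (R : ℕ) (hR : ∀ j ∈ S, bl j < R) :
    frm S A G h = ∑ l ∈ Finset.range R, ∑ k ∈ Finset.range R, frm S A (rs k G) (rs l h) := by
  unfold frm
  have e : ∀ G : ℤ → ℂ, ∀ j ∈ S, G j = ∑ k ∈ Finset.range R, rs k G j := by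
    intro G j hj
    rw [Finset.sum_eq_single (bl j)]
    · simp [rs]
    · intro b _ hb; simp [rs, hb.symm]
    · simp [hR j hj]
  symm
  calc ∑ l ∈ Finset.range R, ∑ k ∈ Finset.range R, ∑ m ∈ S, ∑ j ∈ S, A m j * rs k G j * rs l h m
      = ∑ l ∈ Finset.range R, ∑ m ∈ S, ∑ j ∈ S, A m j * (∑ k ∈ Finset.range R, rs k G j) * rs l h m := by
        refine Finset.sum_congr rfl fun l _ => ?_
        rw [Finset.sum_comm]
        refine Finset.sum_congr rfl fun m _ => ?_
        rw [Finset.sum_comm]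
        refine Finset.sum_congr rfl fun j _ => ?_
        rw [Finset.mul_sum, Finset.sum_mul]
    _ = ∑ m ∈ S, ∑ j ∈ S, A m j * (∑ k ∈ Finset.range R, rs k G j) * (∑ l ∈ Finset.range R, rs l h m) := by
        rw [Finset.sum_comm]
        refine Finset.sum_congr rfl fun m _ => ?_
        rw [Finset.sum_comm]
        refine Finset.sum_congr rfl fun j _ => ?_
        rw [← Finset.mul_sum]
    _ = _ := by
        refine Finset.sum_congr rfl fun m hm => Finset.sum_congr rfl fun j hj => ?_
        rw [← e G j hj, ← e h m hm]

/-- block summation for Schur multipliers -/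
lemma Bd.blocks (K : ℤ → ℤ → ℂ) (c ρ : ℝ) (h0 : 0 ≤ ρ) (h1 : ρ < 1) (hc : 0 ≤ c)
    (hK : ∀ l k : ℕ, Bd (fun m j => if bl m = l ∧ bl j = k then K m j else 0)
      (c * ρ ^ (Nat.dist l k))) :
    Bd K (c * (2 / (1 - ρ))) := by
  intro A M hA S G h
  obtain ⟨R, hR⟩ := exists_range S
  have hM := hA.nonneg
  rw [frm_blocks S _ G h R hR]
  calc ‖∑ l ∈ Finset.range R, ∑ k ∈ Finset.range R, frm S (fun m j => A m j * K m j) (rs k G) (rs l h)‖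
      ≤ ∑ l ∈ Finset.range R, ∑ k ∈ Finset.range R,
        (c * M) * (ρ ^ (Nat.dist l k) * (nrm S (rs k G) * nrm S (rs l h))) := by
        refine (norm_sum_le _ _).trans (Finset.sum_le_sum fun l _ => ?_)
        refine (norm_sum_le _ _).trans (Finset.sum_le_sum fun k _ => ?_)
        have := hK l k A M hA S (rs k G) (rs l h)
        have e : frm S (fun m j => A m j * K m j) (rs k G) (rs l h) =
          frm S (fun m j => A m j * if bl m = l ∧ bl j = k then K m j else 0) (rs k G) (rs l h) := by
          unfold frm
          refine Finset.sum_congr rfl fun m hm => Finset.sum_congr rfl fun j hj => ?_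
          simp only [rs]
          by_cases h1 : bl m = l <;> by_cases h2 : bl j = k <;> simp [h1, h2]
        rw [e]
        refine this.trans (le_of_eq ?_)
        ring
    _ = (c * M) * ∑ l ∈ Finset.range R, ∑ k ∈ Finset.range R,
        (ρ ^ (Nat.dist l k) * (nrm S (rs k G) * nrm S (rs l h))) := by
        simp only [Finset.mul_sum]
    _ ≤ (c * M) * (2 / (1 - ρ) * (nrm S G * nrm S h)) := by
        gcongr
        refine (young ρ h0 h1 R (fun k => nrm S (rs k G)) (fun k => nrm S (rs k h))).trans ?_
        have q : 0 ≤ 2 / (1 - ρ) := div_nonneg (by norm_num) (by linarith)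
        refine mul_le_mul_of_nonneg_left ?_ q
        refine mul_le_mul ?_ ?_ (Real.sqrt_nonneg _) (nrm_nonneg _ _)
        · exact Real.sqrt_le_iff.mpr ⟨nrm_nonneg _ _, sum_rs S G R⟩
        · exact Real.sqrt_le_iff.mpr ⟨nrm_nonneg _ _, sum_rs S h R⟩
    _ = _ := by ring

end KP

namespace KP

/-- restriction of a symbol to a pair of blocks -/
noncomputable def blk (l k : ℕ) (K : ℤ → ℤ → ℝ) : ℤ → ℤ → ℂ :=
  fun m j => if bl m = l ∧ bl j = k then ((K m j : ℝ) : ℂ) else 0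

lemma Bd.blk_sep {l k : ℕ} {K : ℤ → ℤ → ℝ} {c : ℝ} (h : Bd (blk l k K) c) (a b : ℤ → ℝ) (α β : ℝ)
    (hα : 0 ≤ α) (hβ : 0 ≤ β) (ha : ∀ m, bl m = l → |a m| ≤ α) (hb : ∀ j, bl j = k → |b j| ≤ β) :
    Bd (blk l k (fun m j => a m * b j * K m j)) (α * β * c) := by
  have := (Bd.sep (fun m => if bl m = l then ((a m : ℝ) : ℂ) else 0)
    (fun j => if bl j = k then ((b j : ℝ) : ℂ) else 0) α β hα hβ
    (by intro m; split_ifs with h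
        · rw [Complex.norm_real]; exact ha m h
        · simpa)
    (by intro m; split_ifs with h
        · rw [Complex.norm_real]; exact hb m h
        · simpa)).mul h
  convert this using 3 with m j
  unfold blk
  by_cases h1 : bl m = l <;> by_cases h2 : bl j = k <;> simp [h1, h2]

lemma Bd.blk_congr {l k : ℕ} {K K' : ℤ → ℤ → ℝ} {c : ℝ} (h : Bd (blk l k K) c)
    (e : ∀ m j, bl m = l → bl j = k → K' m j = K m j) : Bd (blk l k K') c := by
  have : blk l k K' = blk l k K := by
    funext m j
    unfold blk
    split_ifs with hh
    · rw [e m j hh.1 hh.2]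
    · rfl
  rw [this]; exact h

lemma Bd.blk_add {l k : ℕ} {K K' : ℤ → ℤ → ℝ} {c c' : ℝ} (h : Bd (blk l k K) c)
    (h' : Bd (blk l k K') c') : Bd (blk l k (fun m j => K m j + K' m j)) (c + c') := by
  have := h.add h'
  convert this using 3 with m j
  unfold blk
  split_ifs <;> simp

lemma Bd.blk_abel (l k : ℕ) (κ : ℤ → ℕ → ℝ) (c0 c1 : ℝ)
    (hc0 : 0 ≤ c0) (hc1 : 0 ≤ c1)
    (h0 : ∀ m, bl m = l → ∀ i : ℕ, bl (i:ℤ) = k → |κ m i| ≤ c0)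
    (h1 : ∀ m, bl m = l → ∀ i : ℕ, bl (i:ℤ) = k → bl ((i + 1 : ℕ) : ℤ) = k →
      |κ m (i+1) - κ m i| ≤ c1) :
    Bd (blk l k (fun m j => κ m j.natAbs)) (c0 + 2 ^ k * c1) := by
  have hb : ∀ i : ℕ, bl (i:ℤ) = k ↔ (2^k/2 ≤ i ∧ i < 2^k) := by
    intro i; rw [bl_eq_iff]; simp
  have := Bd.abel (fun m => bl m = l) (fun m i => ((κ m i : ℝ) : ℂ)) (2^k/2) (2^k) c0 c1 hc0 hc1
    (by intro m hm _; rw [Complex.norm_real]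
        refine h0 m hm _ ((hb _).2 ⟨le_rfl, ?_⟩)
        exact Nat.div_lt_self (by positivity) (by norm_num))
    (by intro m hm i h h'; rw [← Complex.ofReal_sub, Complex.norm_real]
        exact h1 m hm i ((hb _).2 ⟨h, by omega⟩) ((hb _).2 ⟨by omega, h'⟩))
  have e : blk l k (fun m j => κ m j.natAbs) = (fun m j => if bl m = l ∧ 2^k/2 ≤ j.natAbs ∧ j.natAbs < 2^k then ((κ m j.natAbs : ℝ) : ℂ) else 0) := by
    funext m j
    unfold blk
    simp only [bl_eq_iff j]
  rw [e]
  refine this.mono ?_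
  gcongr
  have : (2^k - 2^k/2 : ℕ) ≤ 2^k := Nat.sub_le _ _
  exact_mod_cast this

lemma four_pow (n : ℕ) : (4:ℝ) ^ n = (2 ^ n) ^ 2 := by
  rw [← pow_mul, mul_comm, pow_mul]; norm_num

lemma sq_diff_lower (m i : ℤ) (h : 2 ≤ Nat.dist (bl m) (bl i)) :
    3 / 16 * 4 ^ (max (bl m) (bl i)) ≤ |(m:ℝ)^2 - (i:ℝ)^2| := by
  have key : ∀ m i : ℤ, bl m + 2 ≤ bl i → 3 / 16 * 4 ^ (bl i) ≤ (i:ℝ)^2 - (m:ℝ)^2 := by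
    intro m i h
    have h1 := abs_lt_bl m
    have h2 := le_abs_bl i (by omega)
    have h3 : (2:ℝ) ^ bl m * 4 ≤ 2 ^ bl i := by
      have : (2:ℝ) ^ (bl m + 2) ≤ 2 ^ bl i := pow_le_pow_right₀ (by norm_num) h
      rw [pow_add] at this; norm_num at this; exact this
    have h4 : (0:ℝ) < 2 ^ bl m := by positivity
    rw [four_pow, ← sq_abs (i:ℝ), ← sq_abs (m:ℝ)]
    have := abs_nonneg (m:ℝ)
    nlinarith
  rcases le_total (bl m) (bl i) with h' | h'
  · have : bl m + 2 ≤ bl i := by simp only [Nat.dist] at h; omega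
    rw [max_eq_right h', abs_sub_comm]
    exact (key m i this).trans (le_abs_self _)
  · have : bl i + 2 ≤ bl m := by simp only [Nat.dist] at h; omega
    rw [max_eq_left h']
    exact (key i m this).trans (le_abs_self _)

lemma Bd.far (l k : ℕ) (h : 2 ≤ Nat.dist l k) :
    Bd (blk l k (fun m j => 1 / ((m:ℝ) - j))) (126 / 2 ^ (max l k)) := by
  set N : ℝ := 2 ^ (max l k) with hN
  have hN0 : 0 < N := by positivity
  have h4 : (4:ℝ) ^ (max l k) = N ^ 2 := four_pow _
  have hk : (2:ℝ) ^ k ≤ N := pow_le_pow_right₀ (by norm_num) (le_max_right _ _)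
  have hl : (2:ℝ) ^ l ≤ N := pow_le_pow_right₀ (by norm_num) (le_max_left _ _)
  have low : ∀ m i : ℤ, bl m = l → bl i = k → 3 / 16 * N ^ 2 ≤ |(m:ℝ)^2 - (i:ℝ)^2| := by
    intro m i hm hi
    have := sq_diff_lower m i (by rw [hm, hi]; exact h)
    rwa [hm, hi, h4] at this
  have B := Bd.blk_abel l k (fun m i => 1 / ((m:ℝ)^2 - (i:ℝ)^2)) (16/3 / N^2) (2 * N * (16/3)^2 / N^4)
    (by positivity) (by positivity)
    (by
      intro m hm i hi
      have := low m i hm hi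
      rw [Int.cast_natCast] at this
      rw [abs_div, abs_one, div_le_div_iff₀ (lt_of_lt_of_le (by positivity) this) (by positivity)]
      linarith)
    (by
      intro m hm i hi hi'
      have q1 := low m i hm hi
      have q2 := low m _ hm hi'
      have q3 := abs_lt_bl ((i+1:ℕ):ℤ)
      rw [hi'] at q3
      rw [Int.cast_natCast] at q1 q2 q3
      have p1 := lt_of_lt_of_le (show (0:ℝ) < 3 / 16 * N ^ 2 by positivity) q1
      have p2 := lt_of_lt_of_le (show (0:ℝ) < 3 / 16 * N ^ 2 by positivity) q2
      have e : 1 / ((m:ℝ)^2 - ((i+1:ℕ):ℝ)^2) - 1 / ((m:ℝ)^2 - (i:ℝ)^2) =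
          (2 * i + 1) / (((m:ℝ)^2 - ((i+1:ℕ):ℝ)^2) * ((m:ℝ)^2 - (i:ℝ)^2)) := by
        have := abs_pos.1 p1
        have := abs_pos.1 p2
        field_simp
        push_cast; ring
      rw [e, abs_div, abs_mul]
      have i0 : (0:ℝ) ≤ i := by positivity
      rw [abs_of_nonneg (by positivity : (0:ℝ) ≤ ((i+1:ℕ):ℝ))] at q3
      push_cast at q3
      have i1 : |2 * (i:ℝ) + 1| ≤ 2 * N := by
        rw [abs_of_nonneg (by positivity)]
        linarith
      calc |2 * (i:ℝ) + 1| / (|(m:ℝ)^2 - ((i+1:ℕ):ℝ)^2| * |(m:ℝ)^2 - (i:ℝ)^2|)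
          ≤ (2 * N) / ((3 / 16 * N ^ 2) * (3 / 16 * N ^ 2)) := by gcongr
        _ = _ := by field_simp)
  have B1 := B.blk_sep (fun m => (m:ℝ)) (fun _ => 1) N 1 hN0.le (by norm_num)
    (by intro m hm; have := abs_lt_bl m; rw [hm] at this; exact this.le.trans hl) (by simp)
  have B2 := B.blk_sep (fun _ => 1) (fun j => (j:ℝ)) 1 N (by norm_num) hN0.le (by simp)
    (by intro m hm; have := abs_lt_bl m; rw [hm] at this; exact this.le.trans hk)
  have B3 := (B1.blk_add B2).blk_congr (K' := fun m j => 1 / ((m:ℝ) - j)) (by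
    intro m j hm hj
    have q := low m j hm hj
    have q' := abs_pos.1 (lt_of_lt_of_le (show (0:ℝ) < 3 / 16 * N ^ 2 by positivity) q)
    have e : ((j.natAbs : ℕ) : ℝ)^2 = (j:ℝ)^2 := by
      rw [Nat.cast_natAbs, Int.cast_abs, sq_abs]
    have f : (m:ℝ)^2 - (j:ℝ)^2 = (m - j) * (m + j) := by ring
    simp only [e]
    have n1 : (m:ℝ) - j ≠ 0 := by intro h0; rw [f, h0, zero_mul] at q'; exact q' rfl
    have n2 : (m:ℝ) + j ≠ 0 := by intro h0; rw [f, h0, mul_zero] at q'; exact q' rfl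
    rw [f]
    field_simp)
  refine B3.mono ?_
  have e1 : 2 ^ k * (2 * N * (16/3)^2 / N^4) ≤ 2 * (16/3)^2 / N^2 := by
    calc 2 ^ k * (2 * N * (16/3)^2 / N^4) ≤ N * (2 * N * (16/3)^2 / N^4) := by gcongr
      _ = _ := by field_simp
  calc _ = 2 * N * (16/3 / N^2 + 2 ^ k * (2 * N * (16/3)^2 / N^4)) := by ring
    _ ≤ 2 * N * (16/3 / N^2 + 2 * (16/3)^2 / N^2) := by gcongr
    _ = (2 * (16/3 + 2 * (16/3)^2)) / N := by field_simp
    _ ≤ 126 / N := by gcongr; norm_num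

/-- divided difference of `x ^ θ` -/
noncomputable def dd (θ x y : ℝ) : ℝ := ∫ t in (0:ℝ)..1, θ * (y + t * (x - y)) ^ (θ - 1)

lemma seg_mem {a b x y t : ℝ} (hx : x ∈ Set.Icc a b) (hy : y ∈ Set.Icc a b) (ht : t ∈ Set.Icc (0:ℝ) 1) :
    y + t * (x - y) ∈ Set.Icc a b := by
  obtain ⟨h1, h2⟩ := hx
  obtain ⟨h3, h4⟩ := hy
  obtain ⟨h5, h6⟩ := ht
  constructor <;> nlinarith

lemma dd_cont (θ x y : ℝ) (hx : 0 < x) (hy : 0 < y) :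
    ContinuousOn (fun t : ℝ => θ * (y + t * (x - y)) ^ (θ - 1)) (Set.uIcc 0 1) := by
  apply ContinuousOn.mul continuousOn_const
  apply ContinuousOn.rpow_const (by fun_prop)
  intro t ht
  rw [Set.uIcc_of_le zero_le_one] at ht
  left
  have := (seg_mem (a := min x y) (b := max x y) ⟨min_le_left _ _, le_max_left _ _⟩
    ⟨min_le_right _ _, le_max_right _ _⟩ ht).1
  exact ((lt_min hx hy).trans_le this).ne'

lemma dd_mul (θ x y : ℝ) (hx : 0 < x) (hy : 0 < y) : (x - y) * dd θ x y = x ^ θ - y ^ θ := by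
  unfold dd
  rw [← intervalIntegral.integral_const_mul]
  have := intervalIntegral.integral_eq_sub_of_hasDerivAt (a := 0) (b := 1)
    (f := fun t => (y + t * (x - y)) ^ θ) (f' := fun t => (x - y) * (θ * (y + t * (x - y)) ^ (θ - 1)))
    (by
      intro t ht
      rw [Set.uIcc_of_le zero_le_one] at ht
      have h := (seg_mem (a := min x y) (b := max x y) ⟨min_le_left _ _, le_max_left _ _⟩
        ⟨min_le_right _ _, le_max_right _ _⟩ ht).1
      have hd : HasDerivAt (fun t : ℝ => y + t * (x - y)) (x - y) t := by
        simpa using ((hasDerivAt_id t).mul_const (x - y)).const_add y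
      have := hd.rpow_const (p := θ) (Or.inl ((lt_min hx hy).trans_le h).ne')
      rw [mul_assoc] at this; exact this)
    ((continuousOn_const.mul (dd_cont θ x y hx hy)).intervalIntegrable)
  rw [this]
  simp

lemma rpow_range (X p a : ℝ) (hX : 0 < X) (h1 : X / 16 ≤ p) (h2 : p ≤ 4 * X) :
    p ^ a ≤ 16 ^ |a| * X ^ a := by
  have hp : 0 < p := by linarith [div_pos hX (by norm_num : (0:ℝ) < 16)]
  rcases le_total 0 a with ha | ha
  · rw [abs_of_nonneg ha, ← Real.mul_rpow (by norm_num) hX.le]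
    exact Real.rpow_le_rpow hp.le (by linarith) ha
  · calc p ^ a ≤ (X / 16) ^ a := Real.rpow_le_rpow_of_nonpos (by positivity) h1 ha
      _ = _ := by
        rw [Real.div_rpow hX.le (by norm_num), abs_of_nonpos ha, Real.rpow_neg (by norm_num)]
        field_simp

lemma dd_bound (θ X x y : ℝ) (hX : 0 < X) (hx : x ∈ Set.Icc (X/16) (4*X)) (hy : y ∈ Set.Icc (X/16) (4*X)) :
    |dd θ x y| ≤ |θ| * 16 ^ |θ - 1| * X ^ (θ - 1) := by
  have := intervalIntegral.norm_integral_le_of_norm_le_const (a := 0) (b := 1)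
    (f := fun t => θ * (y + t * (x - y)) ^ (θ - 1)) (C := |θ| * 16 ^ |θ - 1| * X ^ (θ - 1))
    (by
      intro t ht
      rw [Set.uIoc_of_le zero_le_one] at ht
      have h := seg_mem hx hy ⟨ht.1.le, ht.2⟩
      have hp : 0 < y + t * (x - y) := lt_of_lt_of_le (by positivity) h.1
      rw [Real.norm_eq_abs, abs_mul, abs_of_pos (Real.rpow_pos_of_pos hp _), mul_assoc]
      exact mul_le_mul_of_nonneg_left (rpow_range _ _ _ hX h.1 h.2) (abs_nonneg _))
  simpa [dd] using this

lemma rpow_lip (a X p q : ℝ) (hX : 0 < X) (hp : p ∈ Set.Icc (X/16) (4*X)) (hq : q ∈ Set.Icc (X/16) (4*X)) :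
    |p ^ a - q ^ a| ≤ |a| * 16 ^ |a - 1| * X ^ (a - 1) * |p - q| := by
  have := (convex_Icc (X/16) (4*X)).norm_image_sub_le_of_norm_hasDerivWithin_le
    (f := fun p : ℝ => p ^ a) (f' := fun p => a * p ^ (a - 1)) (C := |a| * 16 ^ |a - 1| * X ^ (a - 1))
    (by
      intro z hz
      have : z ≠ 0 := (lt_of_lt_of_le (by positivity : 0 < X / 16) hz.1).ne'
      exact (Real.hasDerivAt_rpow_const (Or.inl this)).hasDerivWithinAt)
    (by
      intro z hz
      have : 0 < z := (lt_of_lt_of_le (by positivity : 0 < X / 16) hz.1)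
      rw [Real.norm_eq_abs, abs_mul, abs_of_pos (Real.rpow_pos_of_pos this _), mul_assoc]
      exact mul_le_mul_of_nonneg_left (rpow_range _ _ _ hX hz.1 hz.2) (abs_nonneg _))
    hq hp
  simpa using this

lemma dd_lip (θ X x y y' : ℝ) (hX : 0 < X) (hx : x ∈ Set.Icc (X/16) (4*X)) (hy : y ∈ Set.Icc (X/16) (4*X))
    (hy' : y' ∈ Set.Icc (X/16) (4*X)) :
    |dd θ x y - dd θ x y'| ≤ |θ| * (|θ - 1| * 16 ^ |θ - 2| * X ^ (θ - 2) * |y - y'|) := by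
  have x0 : 0 < x := lt_of_lt_of_le (by positivity) hx.1
  have y0 : 0 < y := lt_of_lt_of_le (by positivity) hy.1
  have y0' : 0 < y' := lt_of_lt_of_le (by positivity) hy'.1
  unfold dd
  rw [← intervalIntegral.integral_sub (dd_cont θ x y x0 y0).intervalIntegrable
    (dd_cont θ x y' x0 y0').intervalIntegrable]
  have := intervalIntegral.norm_integral_le_of_norm_le_const (a := 0) (b := 1)
    (f := fun t => θ * (y + t * (x - y)) ^ (θ - 1) - θ * (y' + t * (x - y')) ^ (θ - 1))
    (C := |θ| * (|θ - 1| * 16 ^ |θ - 2| * X ^ (θ - 2) * |y - y'|))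
    (by
      intro t ht
      rw [Set.uIoc_of_le zero_le_one] at ht
      have h := seg_mem hx hy ⟨ht.1.le, ht.2⟩
      have h' := seg_mem hx hy' ⟨ht.1.le, ht.2⟩
      rw [← mul_sub, Real.norm_eq_abs, abs_mul]
      refine mul_le_mul_of_nonneg_left ?_ (abs_nonneg _)
      refine (rpow_lip _ X _ _ hX h h').trans ?_
      have e : θ - 1 - 1 = θ - 2 := by ring
      rw [e]
      refine mul_le_mul_of_nonneg_left ?_ (by positivity)
      have e2 : y + t * (x - y) - (y' + t * (x - y')) = (1 - t) * (y - y') := by ring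
      rw [e2, abs_mul, abs_of_nonneg (by linarith [ht.2])]
      exact mul_le_of_le_one_left (abs_nonneg _) (by linarith [ht.1]))
  simpa using this

lemma near_mem (l k : ℕ) (h : Nat.dist l k ≤ 1) (m : ℤ) (hm : bl m = l) :
    1 + (m:ℝ)^2 ∈ Set.Icc ((4:ℝ)^k/16) (4*4^k) := by
  have h1 := one_add_sq_le m
  have h2 := le_one_add_sq m
  rw [hm] at h1 h2
  have a1 : (4:ℝ)^l ≤ 4 ^ (k+1) := pow_le_pow_right₀ (by norm_num) (by simp only [Nat.dist] at h; omega)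
  have a2 : (4:ℝ)^k ≤ 4 ^ (l+1) := pow_le_pow_right₀ (by norm_num) (by simp only [Nat.dist] at h; omega)
  rw [pow_succ] at a1 a2
  constructor <;> linarith

lemma Bd.near (θ : ℝ) : ∃ C, 0 ≤ C ∧ ∀ (l k : ℕ), Nat.dist l k ≤ 1 →
    Bd (blk l k (fun m j => ((m:ℝ) + j) * dd θ (1 + (m:ℝ)^2) (1 + (j:ℝ)^2)))
      (C * 2 ^ k * ((4:ℝ) ^ k) ^ (θ - 1)) := by
  set C1 := |θ| * 16 ^ |θ - 1|
  set C2 := |θ| * (|θ - 1| * 16 ^ |θ - 2|)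
  have hC1 : 0 ≤ C1 := by positivity
  have hC2 : 0 ≤ C2 := by positivity
  refine ⟨3 * (C1 + 2 * C2), by positivity, ?_⟩
  intro l k h
  set X : ℝ := (4:ℝ)^k with hXd
  have hX : 0 < X := by positivity
  have hXk : X = 2^k * 2^k := by rw [hXd, four_pow, sq]
  have B := Bd.blk_abel l k (fun m i => dd θ (1 + (m:ℝ)^2) (1 + (i:ℝ)^2))
    (C1 * X ^ (θ - 1)) (C2 * X ^ (θ - 2) * (2 * 2 ^ k)) (by positivity) (by positivity)
    (by
      intro m hm i hi
      have := near_mem k k (by simp [Nat.dist]) (i:ℤ) hi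
      rw [Int.cast_natCast] at this
      exact dd_bound θ X _ _ hX (near_mem l k h m hm) this)
    (by
      intro m hm i hi hi'
      have a1 := near_mem k k (by simp [Nat.dist]) (i:ℤ) hi
      have a2 := near_mem k k (by simp [Nat.dist]) _ hi'
      have q3 := abs_lt_bl ((i+1:ℕ):ℤ)
      rw [hi'] at q3
      rw [Int.cast_natCast] at a1 a2 q3
      rw [abs_of_nonneg (by positivity : (0:ℝ) ≤ ((i+1:ℕ):ℝ))] at q3
      refine (dd_lip θ X _ _ _ hX (near_mem l k h m hm) a2 a1).trans ?_
      have : |1 + ((i+1:ℕ):ℝ)^2 - (1 + (i:ℝ)^2)| ≤ 2 * 2 ^ k := by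
        have i0 : (0:ℝ) ≤ i := by positivity
        push_cast at q3 ⊢
        rw [abs_le]; constructor <;> nlinarith
      calc _ ≤ |θ| * (|θ - 1| * 16 ^ |θ - 2| * X ^ (θ - 2) * (2 * 2 ^ k)) := by gcongr
        _ = _ := by ring)
  have hl : (2:ℝ) ^ l ≤ 2 * 2 ^ k := by
    rw [← pow_succ']
    exact pow_le_pow_right₀ (by norm_num) (by simp only [Nat.dist] at h; omega)
  have B1 := B.blk_sep (fun m => (m:ℝ)) (fun _ => 1) (2 * 2 ^ k) 1 (by positivity) (by norm_num)
    (by intro m hm; have := abs_lt_bl m; rw [hm] at this; exact this.le.trans hl) (by simp)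
  have B2 := B.blk_sep (fun _ => 1) (fun j => (j:ℝ)) 1 (2 ^ k) (by norm_num) (by positivity) (by simp)
    (by intro m hm; have := abs_lt_bl m; rw [hm] at this; exact this.le)
  have B3 := (B1.blk_add B2).blk_congr
    (K' := fun m j => ((m:ℝ) + j) * dd θ (1 + (m:ℝ)^2) (1 + (j:ℝ)^2)) (by
    intro m j hm hj
    have e : ((j.natAbs : ℕ) : ℝ)^2 = (j:ℝ)^2 := by
      rw [Nat.cast_natAbs, Int.cast_abs, sq_abs]
    simp only [e]
    ring)
  refine B3.mono (le_of_eq ?_)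
  have e : X ^ (θ - 1) = X ^ (θ - 2) * X := by
    rw [← Real.rpow_add_one hX.ne']; congr 1; ring
  rw [e]
  have e' : (2:ℝ)^k * (C2 * X ^ (θ - 2) * (2 * 2 ^ k)) = 2 * C2 * X ^ (θ - 2) * X := by
    rw [hXk]; ring
  rw [e']; ring

end KP

namespace KP

/-- Fejér multiplier -/
noncomputable def fej (N : ℕ) (j : ℤ) : ℝ := max 0 (1 - |(j:ℝ)| / N)

/-- de la Vallée-Poussin multiplier adapted to block `l` -/
noncomputable def vv (l : ℕ) (j : ℤ) : ℝ :=
  if l < 5 then 0 else 2 * fej (2 ^ (l - 4)) j - fej (2 ^ (l - 5)) j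

lemma fej_nonneg (N : ℕ) (j : ℤ) : 0 ≤ fej N j := le_max_left _ _
lemma fej_le (N : ℕ) (j : ℤ) : fej N j ≤ 1 := by
  apply max_le (by norm_num)
  have : 0 ≤ |(j:ℝ)| / N := by positivity
  linarith

lemma vv_abs (l : ℕ) (j : ℤ) : |vv l j| ≤ 3 := by
  unfold vv
  split_ifs
  · simp
  · have := fej_nonneg (2 ^ (l - 4)) j
    have := fej_nonneg (2 ^ (l - 5)) j
    have := fej_le (2 ^ (l - 4)) j
    have := fej_le (2 ^ (l - 5)) j
    rw [abs_le]; constructor <;> linarith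

lemma vv_one (l : ℕ) (j : ℤ) (h : bl j + 5 ≤ l) : vv l j = 1 := by
  obtain ⟨n, rfl⟩ := Nat.exists_eq_add_of_le' (show 5 ≤ l by omega)
  have h1 := abs_lt_bl j
  have h2 : (2:ℝ) ^ bl j ≤ 2 ^ n := pow_le_pow_right₀ (by norm_num) (by omega)
  have h3 : |(j:ℝ)| / 2 ^ n ≤ 1 := by
    rw [div_le_one (by positivity)]; linarith
  have h4 : |(j:ℝ)| / 2 ^ (n + 1) = |(j:ℝ)| / 2 ^ n / 2 := by rw [pow_succ]; field_simp
  have e1 : n + 5 - 4 = n + 1 := by omega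
  have e2 : n + 5 - 5 = n := by omega
  unfold vv fej
  rw [if_neg (by omega), e1, e2]
  push_cast
  rw [h4, max_eq_right, max_eq_right]
  · ring
  · linarith
  · have : 0 ≤ |(j:ℝ)| / 2 ^ n := by positivity
    linarith

lemma vv_zero (l : ℕ) (j : ℤ) (h : l ≤ bl j + 3) : vv l j = 0 := by
  unfold vv
  split_ifs with h5
  · rfl
  obtain ⟨n, rfl⟩ := Nat.exists_eq_add_of_le' (show 5 ≤ l by omega)
  have h1 := le_abs_bl j (by omega)
  have h2 : (2:ℝ) ^ (n+2) ≤ 2 ^ bl j := pow_le_pow_right₀ (by norm_num) (by omega)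
  have h4 : |(j:ℝ)| / 2 ^ (n + 1) = |(j:ℝ)| / 2 ^ n / 2 := by rw [pow_succ]; field_simp
  have h3 : 2 ≤ |(j:ℝ)| / 2 ^ n := by
    rw [le_div_iff₀ (by positivity)]
    rw [pow_add] at h2
    linarith
  have e1 : n + 5 - 4 = n + 1 := by omega
  have e2 : n + 5 - 5 = n := by omega
  unfold fej
  rw [e1, e2]
  push_cast
  rw [h4, max_eq_left, max_eq_left]
  · ring
  · linarith
  · linarith

lemma four_rpow (l : ℕ) (a : ℝ) : ((4:ℝ) ^ l) ^ a = (2:ℝ) ^ (2 * a * l) := by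
  rw [show (4:ℝ) = (2:ℝ) ^ (2:ℝ) by norm_num, ← Real.rpow_natCast, ← Real.rpow_mul (by norm_num),
    ← Real.rpow_mul (by norm_num)]
  congr 1; ring

/-- Japanese bracket power -/
noncomputable def jb (a : ℝ) (j : ℤ) : ℝ := (1 + (j:ℝ)^2) ^ (a / 2)

lemma jb_pos (a : ℝ) (j : ℤ) : 0 < jb a j := Real.rpow_pos_of_pos (by positivity) _

lemma jb_le (a : ℝ) (j : ℤ) (k : ℕ) (h : bl j = k) : |jb a j| ≤ 2 ^ |a| * 2 ^ (a * k) := by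
  rw [abs_of_pos (jb_pos a j)]
  have := rpow_bl_le j (a/2)
  rw [h, four_rpow] at this
  unfold jb
  refine this.trans (le_of_eq ?_)
  congr 1
  · rw [abs_div, show (4:ℝ) = (2:ℝ) ^ (2:ℝ) by norm_num, ← Real.rpow_mul (by norm_num)]
    congr 1
    rw [abs_of_pos (by norm_num : (0:ℝ) < 2)]; ring
  · congr 1; ring

lemma jb_add (a b : ℝ) (j : ℤ) : jb a j * jb b j = jb (a + b) j := by
  unfold jb
  rw [← Real.rpow_add (by positivity)]; congr 1; ring

/-- the good part of the symbol -/
noncomputable def Ksym (s : ℝ) (m j : ℤ) : ℝ :=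
  if bl m + 2 ≤ bl j then
    jb 1 j * (m / (j * (j - m))) - jb s m * jb (1 - s) j / (j - m)
  else if bl j + 2 ≤ bl m then
    (1 - vv (bl m) j) * (jb s m * jb (1 - s) j) / (m - j) - jb 1 j / (m - j)
  else jb (1 - s) j * ((m + j) * dd (s/2) (1 + (m:ℝ)^2) (1 + (j:ℝ)^2))

/-- the paraproduct symbol -/
noncomputable def Psym (m j : ℤ) : ℝ := if bl m + 2 ≤ bl j then jb 1 j / j else 0

lemma bl_lt_ne (m j : ℤ) (h : bl m + 2 ≤ bl j) : (m:ℝ) ≠ j ∧ (j:ℝ) ≠ 0 := by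
  constructor
  · intro e
    have : m = j := by exact_mod_cast e
    rw [this] at h; omega
  · intro e
    have : j = 0 := by exact_mod_cast e
    rw [this] at h
    simp [bl] at h

lemma sym_identity (s : ℝ) (m j : ℤ) :
    (m - j) * (Ksym s m j + Psym m j) = jb (1 - s) j * ((1 - vv (bl m) j) * jb s m - jb s j) := by
  have e : jb (1 - s) j * jb s j = jb 1 j := by rw [jb_add]; congr 1; ring
  unfold Ksym Psym
  split_ifs with h1 h2
  · obtain ⟨n1, n2⟩ := bl_lt_ne m j h1
    have n3 : (j:ℝ) - m ≠ 0 := sub_ne_zero.2 n1.symm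
    rw [vv_zero _ _ (by omega)]
    have : (m - j) * (jb 1 j * (m / (j * (j - m))) - jb s m * jb (1 - s) j / (j - m) + jb 1 j / j)
      = jb (1-s) j * jb s m - jb 1 j := by
      field_simp; ring
    rw [this, ← e]; ring
  · obtain ⟨n1, n2⟩ := bl_lt_ne j m h2
    have n3 : (m:ℝ) - j ≠ 0 := sub_ne_zero.2 n1.symm
    rw [mul_sub, ← e]
    field_simp
    ring
  · rw [vv_zero _ _ (by omega)]
    have := dd_mul (s/2) (1 + (m:ℝ)^2) (1 + (j:ℝ)^2) (by positivity) (by positivity)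
    have e2 : jb s m - jb s j = (1 + (m:ℝ)^2 - (1 + (j:ℝ)^2)) * dd (s/2) (1 + (m:ℝ)^2) (1 + (j:ℝ)^2) := by
      rw [this]; rfl
    have e3 : jb (1 - s) j * ((1 - 0) * jb s m - jb s j) = jb (1 - s) j * (jb s m - jb s j) := by ring
    rw [e3, e2]; ring

lemma Bd_Ksym (s : ℝ) (hs : 0 < s) : ∃ C, 0 ≤ C ∧ Bd (fun m j => ((Ksym s m j : ℝ) : ℂ)) C := by
  obtain ⟨C0, hC0, near⟩ := Bd.near (s/2)
  set q : ℝ := min 1 s with hq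
  have q0 : 0 < q := lt_min one_pos hs
  set ρ : ℝ := (2:ℝ) ^ (-q) with hρ
  have ρ0 : 0 < ρ := by positivity
  have ρ1 : ρ < 1 := Real.rpow_lt_one_of_one_lt_of_neg (by norm_num) (by linarith)
  set W : ℝ := 2 ^ |s| * 2 ^ |1 - s| with hW
  have W0 : 0 < W := by positivity
  have hρn : ∀ n : ℕ, ρ ^ n = (2:ℝ) ^ (-q * n) := by
    intro n; rw [hρ, ← Real.rpow_natCast, ← Real.rpow_mul (by norm_num)]
  have hpn : ∀ n : ℕ, (2:ℝ) ^ n = (2:ℝ) ^ (n:ℝ) := fun n => (Real.rpow_natCast _ _).symm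
  have two1 : ∀ a b : ℝ, a ≤ b → (2:ℝ) ^ a ≤ 2 ^ b := fun a b h =>
    Real.rpow_le_rpow_of_exponent_le (by norm_num) h
  set Ca : ℝ := 252 * 2 + 126 * W
  set Cb : ℝ := 4 * (126 * W) * 2 ^ (4 * |1 - s| + 4) + 252
  set Cc : ℝ := 2 ^ |1 - s| * C0 * 2
  have hCa : 0 ≤ Ca := by positivity
  have hCb : 0 ≤ Cb := by positivity
  have hCc : 0 ≤ Cc := by positivity
  refine ⟨(Ca + Cb + Cc) * (2 / (1 - ρ)), ?_, ?_⟩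
  · apply mul_nonneg (by positivity)
    exact div_nonneg (by norm_num) (by linarith)
  apply Bd.blocks _ _ _ ρ0.le ρ1 (by positivity)
  intro l k
  change Bd (blk l k (Ksym s)) _
  by_cases h1 : l + 2 ≤ k
  · have F := Bd.far l k (by simp only [Nat.dist]; omega)
    rw [max_eq_right (by omega)] at F
    have dist : Nat.dist l k = k - l := by simp only [Nat.dist]; omega
    have B1 := F.blk_sep (fun m => (m:ℝ)) (fun j => - (jb 1 j / j)) (2 ^ l) 4 (by positivity) (by norm_num)
      (fun m hm => by have := abs_lt_bl m; rw [hm] at this; exact this.le)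
      (fun j hj => by
        have a1 := jb_le 1 j k hj
        have a2 := le_abs_bl j (by omega)
        rw [hj] at a2
        have a3 : (0:ℝ) < 2 ^ k := by positivity
        rw [abs_neg, abs_div, div_le_iff₀ (by linarith)]
        rw [one_mul, ← hpn, abs_one, Real.rpow_one] at a1
        linarith)
    have B2 := F.blk_sep (fun m => jb s m) (fun j => jb (1 - s) j) (2 ^ |s| * 2 ^ (s * l))
      (2 ^ |1 - s| * 2 ^ ((1 - s) * k)) (by positivity) (by positivity)
      (fun m hm => jb_le s m l hm) (fun j hj => jb_le (1-s) j k hj)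
    refine ((B1.blk_add B2).blk_congr (K' := Ksym s) ?_).mono ?_
    · intro m j hm hj
      have hh : bl m + 2 ≤ bl j := by rw [hm, hj]; exact h1
      obtain ⟨n1, n2⟩ := bl_lt_ne m j hh
      have n3 : (j:ℝ) - m ≠ 0 := sub_ne_zero.2 n1.symm
      have n4 : (m:ℝ) - j ≠ 0 := sub_ne_zero.2 n1
      unfold Ksym
      rw [if_pos hh]
      have e : 1 / ((m:ℝ) - j) = - (1 / ((j:ℝ) - m)) := by
        rw [← neg_sub (j:ℝ) m, one_div_neg_eq_neg_one_div]
      rw [e]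
      field_simp
      ring
    · have e1 : (2:ℝ) ^ l * 4 * (126 / 2 ^ k) ≤ 252 * 2 * ρ ^ (Nat.dist l k) := by
        rw [dist, hρn, Nat.cast_sub (by omega)]
        have : (2:ℝ)^l / 2 ^ k ≤ (2:ℝ) ^ (-q * (k - l)) := by
          rw [hpn, hpn, ← Real.rpow_sub (by norm_num)]
          apply two1
          have : (l:ℝ) ≤ k := by exact_mod_cast (show l ≤ k by omega)
          have : q ≤ 1 := min_le_left _ _
          nlinarith
        calc (2:ℝ) ^ l * 4 * (126 / 2 ^ k) = 504 * (2^l/2^k) := by ring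
          _ ≤ 504 * (2:ℝ) ^ (-q * (k - l)) := by gcongr
          _ = _ := by ring
      have e2 : (2:ℝ) ^ |s| * 2 ^ (s * l) * (2 ^ |1 - s| * 2 ^ ((1 - s) * k)) * (126 / 2 ^ k)
          ≤ 126 * W * ρ ^ (Nat.dist l k) := by
        rw [dist, hρn, Nat.cast_sub (by omega)]
        have : (2:ℝ) ^ (s * l) * 2 ^ ((1 - s) * k) / 2 ^ k ≤ (2:ℝ) ^ (-q * (k - l)) := by
          rw [hpn k, ← Real.rpow_add (by norm_num), ← Real.rpow_sub (by norm_num)]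
          apply two1
          have : (l:ℝ) ≤ k := by exact_mod_cast (show l ≤ k by omega)
          have : q ≤ s := min_le_right _ _
          nlinarith
        calc _ = 126 * W * ((2:ℝ) ^ (s * l) * 2 ^ ((1 - s) * k) / 2 ^ k) := by rw [hW]; ring
          _ ≤ _ := by gcongr
      have e3 : 0 ≤ ρ ^ (Nat.dist l k) := by positivity
      nlinarith
  by_cases h2 : k + 2 ≤ l
  · have F := Bd.far l k (by simp only [Nat.dist]; omega)
    rw [max_eq_left (by omega)] at F
    have dist : Nat.dist l k = l - k := by simp only [Nat.dist]; omega
    have B1 := F.blk_sep (fun m => -1) (fun j => jb 1 j) 1 (2 * 2 ^ k) (by norm_num) (by positivity)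
      (fun m hm => by simp)
      (fun j hj => by
        have a1 := jb_le 1 j k hj
        rwa [one_mul, ← hpn, abs_one, Real.rpow_one] at a1)
    set T : ℝ := if k + 5 ≤ l then 0 else 4 with hT
    have T0 : 0 ≤ T := by rw [hT]; split_ifs <;> norm_num
    have B2 := F.blk_sep (fun m => jb s m) (fun j => (1 - vv l j) * jb (1 - s) j) (2 ^ |s| * 2 ^ (s * l))
      (T * (2 ^ |1 - s| * 2 ^ ((1 - s) * k))) (by positivity) (by positivity)
      (fun m hm => jb_le s m l hm) (fun j hj => by
        rw [abs_mul]
        refine mul_le_mul ?_ (jb_le (1-s) j k hj) (abs_nonneg _) T0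
        rw [hT]
        split_ifs with h5
        · rw [vv_one l j (by rw [hj]; exact h5)]; simp
        · have := vv_abs l j
          rw [abs_le] at this ⊢
          constructor <;> linarith)
    refine ((B1.blk_add B2).blk_congr (K' := Ksym s) ?_).mono ?_
    · intro m j hm hj
      have hh : bl j + 2 ≤ bl m := by rw [hm, hj]; exact h2
      have hh' : ¬ (bl m + 2 ≤ bl j) := by omega
      unfold Ksym
      rw [if_neg hh', if_pos hh, hm]
      ring
    · have e1 : 1 * (2 * (2:ℝ) ^ k) * (126 / 2 ^ l) ≤ 252 * ρ ^ (Nat.dist l k) := by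
        rw [dist, hρn, Nat.cast_sub (by omega)]
        have : (2:ℝ)^k / 2 ^ l ≤ (2:ℝ) ^ (-q * (l - k)) := by
          rw [hpn, hpn, ← Real.rpow_sub (by norm_num)]
          apply two1
          have : (k:ℝ) ≤ l := by exact_mod_cast (show k ≤ l by omega)
          have : q ≤ 1 := min_le_left _ _
          nlinarith
        calc _ = 252 * ((2:ℝ)^k/2^l) := by ring
          _ ≤ _ := by gcongr
      have e2 : (2:ℝ) ^ |s| * 2 ^ (s * l) * (T * (2 ^ |1 - s| * 2 ^ ((1 - s) * k))) * (126 / 2 ^ l)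
          ≤ 4 * (126 * W) * 2 ^ (4 * |1 - s| + 4) * ρ ^ (Nat.dist l k) := by
        rw [hT]
        split_ifs with h5
        · rw [zero_mul, mul_zero, zero_mul]; positivity
        rw [dist, hρn, Nat.cast_sub (by omega)]
        have : (2:ℝ) ^ (s * l) * 2 ^ ((1 - s) * k) / 2 ^ l ≤ 2 ^ (4 * |1 - s| + 4) * (2:ℝ) ^ (-q * (l - k)) := by
          rw [hpn l, ← Real.rpow_add (by norm_num), ← Real.rpow_sub (by norm_num), ← Real.rpow_add (by norm_num)]
          apply two1
          have a1 : (k:ℝ) ≤ l := by exact_mod_cast (show k ≤ l by omega)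
          have a2 : (l:ℝ) ≤ k + 4 := by exact_mod_cast (show l ≤ k + 4 by omega)
          have a3 : q ≤ 1 := min_le_left _ _
          have a4 : -(1 - s) ≤ |1 - s| := neg_le_abs _
          have a5 := abs_nonneg (1 - s)
          have b1 : -(1 - s) * ((l:ℝ) - k) ≤ |1 - s| * 4 :=
            mul_le_mul a4 (by linarith) (by linarith) a5
          have b2 : q * ((l:ℝ) - k) ≤ 1 * 4 := mul_le_mul a3 (by linarith) (by linarith) (by norm_num)
          nlinarith
        calc _ = 4 * (126 * W) * ((2:ℝ) ^ (s * l) * 2 ^ ((1 - s) * k) / 2 ^ l) := by rw [hW]; ring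
          _ ≤ 4 * (126 * W) * (2 ^ (4 * |1 - s| + 4) * (2:ℝ) ^ (-q * (l - k))) := by gcongr
          _ = _ := by ring
      have e3 : 0 ≤ ρ ^ (Nat.dist l k) := by positivity
      nlinarith
  · have hd : Nat.dist l k ≤ 1 := by simp only [Nat.dist]; omega
    have B := (near l k hd).blk_sep (fun _ => 1) (fun j => jb (1 - s) j) 1 (2 ^ |1 - s| * 2 ^ ((1 - s) * k))
      (by norm_num) (by positivity) (by simp) (fun j hj => jb_le (1-s) j k hj)
    refine (B.blk_congr (K' := Ksym s) ?_).mono ?_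
    · intro m j hm hj
      unfold Ksym
      rw [if_neg (by omega), if_neg (by omega)]
      ring
    · have e : (2:ℝ) ^ ((1 - s) * k) * (2 ^ k * ((4:ℝ)^k) ^ (s/2 - 1)) = 1 := by
        rw [four_rpow, hpn, ← Real.rpow_add (by norm_num), ← Real.rpow_add (by norm_num)]
        rw [← Real.rpow_zero 2]
        congr 1; ring
      have e3 : 1 ≤ 2 * ρ ^ (Nat.dist l k) := by
        have a1 : ρ ^ 1 ≤ ρ ^ (Nat.dist l k) := pow_le_pow_of_le_one ρ0.le ρ1.le hd
        have a2 : (1/2:ℝ) ≤ ρ := by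
          have := two1 (-1) (-q) (by linarith [min_le_left 1 s])
          rw [Real.rpow_neg_one] at this
          linarith
        linarith
      calc _ = 2 ^ |1 - s| * C0 * ((2:ℝ) ^ ((1 - s) * k) * (2 ^ k * ((4:ℝ)^k) ^ (s/2 - 1))) := by ring
        _ = 2 ^ |1 - s| * C0 * 1 := by rw [e]
        _ ≤ 2 ^ |1 - s| * C0 * (2 * ρ ^ (Nat.dist l k)) := by gcongr
        _ = Cc * ρ ^ (Nat.dist l k) := by ring
        _ ≤ _ := by gcongr; linarith

end KP

namespace KP

lemma win_card (N : ℕ) (m j : ℤ) : (((Finset.Ioc (m - N) m) ∩ Finset.Ioc (j - N) j).card : ℝ)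
    = N * fej N (m - j) := by
  have e : (Finset.Ioc (m - N) m) ∩ Finset.Ioc (j - N) j = Finset.Ioc (max (m-N) (j-N)) (min m j) := by
    ext x; simp; omega
  rw [e, Int.card_Ioc]
  rcases Nat.eq_zero_or_pos N with h | h
  · subst h
    have : (min m j - max (m - (0:ℕ)) (j-(0:ℕ))).toNat = 0 := by omega
    rw [this]; simp
  unfold fej
  have hN : (0:ℝ) < N := by exact_mod_cast h
  rw [mul_max_of_nonneg _ _ hN.le, mul_sub, mul_div_cancel₀ _ hN.ne', mul_zero, mul_one]
  have e2 : ((min m j - max (m - (N:ℤ)) (j-(N:ℤ))).toNat : ℤ) = max 0 ((N:ℤ) - |m - j|) := by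
    rw [Int.toNat_eq_max]
    rcases le_total m j with h | h
    · rw [abs_of_nonpos (by omega)]; omega
    · rw [abs_of_nonneg (by omega)]; omega
  have e3 := congrArg (fun z : ℤ => (z:ℝ)) e2
  push_cast at e3
  rw [e3]
  push_cast
  rfl

/-- window restriction -/
noncomputable def win (N : ℕ) (i : ℤ) (G : ℤ → ℂ) : ℤ → ℂ := fun j => if i ∈ Finset.Ioc (j - N) j then G j else 0

lemma Bd_fej (N : ℕ) (hN : 1 ≤ N) : Bd (fun m j => (fej N (m - j) : ℂ)) 1 := by
  intro A M hA S G h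
  have hN' : (0:ℝ) < N := by exact_mod_cast hN
  obtain ⟨I, hI⟩ : ∃ I : Finset ℤ, ∀ j ∈ S, Finset.Ioc (j - N) j ⊆ I :=
    ⟨S.biUnion fun j => Finset.Ioc (j - N) j, fun j hj => Finset.subset_biUnion_of_mem (fun j => Finset.Ioc (j - (N:ℤ)) j) hj⟩
  have hM := hA.nonneg
  have key : frm S (fun m j => A m j * (fej N (m - j) : ℂ)) G h
      = (N:ℂ)⁻¹ * ∑ i ∈ I, frm S A (win N i G) (win N i h) := by
    unfold frm
    rw [Finset.sum_comm (s := I), Finset.mul_sum]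
    refine Finset.sum_congr rfl fun m hm => ?_
    rw [Finset.sum_comm (s := I), Finset.mul_sum]
    refine Finset.sum_congr rfl fun j hj => ?_
    have e : ∀ i, A m j * win N i G j * win N i h m =
        if i ∈ (Finset.Ioc (m - N) m) ∩ Finset.Ioc (j - N) j then A m j * G j * h m else 0 := by
      intro i
      unfold win
      simp only [Finset.mem_inter]
      split_ifs <;> simp_all
    rw [Finset.sum_congr rfl fun i _ => e i, Finset.sum_ite_mem,
      Finset.inter_eq_right.mpr (Finset.inter_subset_left.trans (hI m hm)), Finset.sum_const,
      nsmul_eq_mul]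
    have := congrArg (fun z : ℝ => (z:ℂ)) (win_card N m j)
    push_cast at this
    rw [this]
    have : (N:ℂ) ≠ 0 := by exact_mod_cast hN'.ne'
    field_simp
  have sq : ∀ G : ℤ → ℂ, ∑ i ∈ I, nrm S (win N i G) ^ 2 = N * nrm S G ^ 2 := by
    intro G
    simp only [nrm_sq]
    rw [Finset.sum_comm, Finset.mul_sum]
    refine Finset.sum_congr rfl fun j hj => ?_
    have e : ∀ i, ‖win N i G j‖ ^ 2 = if i ∈ Finset.Ioc (j - N) j then ‖G j‖ ^ 2 else 0 := by
      intro i; unfold win; split_ifs <;> simp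
    rw [Finset.sum_congr rfl fun i _ => e i, Finset.sum_ite_mem,
      Finset.inter_eq_right.mpr (hI j hj), Finset.sum_const, nsmul_eq_mul, Int.card_Ioc]
    congr 2
    omega
  rw [key, norm_mul, norm_inv, Complex.norm_natCast, one_mul]
  rw [inv_mul_le_iff₀ hN']
  have cs : ∑ i ∈ I, nrm S (win N i G) * nrm S (win N i h) ≤ N * (nrm S G * nrm S h) := by
    have := Real.sum_mul_le_sqrt_mul_sqrt I (fun i => nrm S (win N i G)) (fun i => nrm S (win N i h))
    rw [sq, sq, Real.sqrt_mul hN'.le, Real.sqrt_mul hN'.le, Real.sqrt_sq (nrm_nonneg _ _),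
      Real.sqrt_sq (nrm_nonneg _ _)] at this
    refine this.trans (le_of_eq ?_)
    linear_combination (nrm S G * nrm S h) * Real.mul_self_sqrt hN'.le
  calc ‖∑ i ∈ I, frm S A (win N i G) (win N i h)‖
      ≤ ∑ i ∈ I, M * nrm S (win N i G) * nrm S (win N i h) :=
        norm_sum_le_of_le _ fun i _ => hA S _ _
    _ = M * ∑ i ∈ I, nrm S (win N i G) * nrm S (win N i h) := by
        rw [Finset.mul_sum]; simp only [mul_assoc]
    _ ≤ M * (N * (nrm S G * nrm S h)) := by gcongr
    _ = _ := by ring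

lemma Bd_vv (l : ℕ) : Bd (fun m j => (vv l (m - j) : ℂ)) 3 := by
  unfold vv
  split_ifs with h
  · simpa using Bd.zero.mono (by norm_num : (0:ℝ) ≤ 3)
  have h1 := Bd_fej (2 ^ (l - 4)) Nat.one_le_two_pow
  have h2 := Bd_fej (2 ^ (l - 5)) Nat.one_le_two_pow
  have h3 := Bd.sep (fun _ => 2) (fun _ => 1) 2 1 (by norm_num) (by norm_num) (by simp) (by simp)
  have h4 := Bd.sep (fun _ => -1) (fun _ => 1) 1 1 (by norm_num) (by norm_num) (by simp) (by simp)
  have := (h3.mul h1).add (h4.mul h2)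
  norm_num at this
  simpa only [sub_eq_add_neg, Complex.ofReal_add, Complex.ofReal_mul, Complex.ofReal_neg, Complex.ofReal_ofNat] using this

end KP

namespace KP

/-- average over a period -/
noncomputable def av {E : Type*} [NormedAddCommGroup E] [NormedSpace ℝ E] (F : ℝ → E) : E :=
  (2 * π)⁻¹ • ∫ x in (0:ℝ)..(2 * π), F x

section
variable {E : Type*} [NormedAddCommGroup E] [NormedSpace ℝ E]

lemma av_shift (F : ℝ → E) (hF : Function.Periodic F (2 * π)) (y : ℝ) :
    av (fun x => F (x + y)) = av F := by
  unfold av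
  congr 1
  rw [intervalIntegral.integral_comp_add_right]
  have := hF.intervalIntegral_add_eq y 0
  rw [zero_add] at this ⊢
  rw [add_comm (2 * π) y, this]

lemma av_add (F G : ℝ → E) (hF : Continuous F) (hG : Continuous G) :
    av (fun x => F x + G x) = av F + av G := by
  unfold av
  rw [intervalIntegral.integral_add (hF.intervalIntegrable _ _) (hG.intervalIntegrable _ _), smul_add]

lemma av_sum {ι : Type*} (s : Finset ι) (F : ι → ℝ → E) (hF : ∀ i ∈ s, Continuous (F i)) :
    av (fun x => ∑ i ∈ s, F i x) = ∑ i ∈ s, av (F i) := by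
  unfold av
  rw [intervalIntegral.integral_finsetSum (fun i hi => (hF i hi).intervalIntegrable _ _), Finset.smul_sum]

lemma norm_av_le (F : ℝ → E) : ‖av F‖ ≤ av (fun x => ‖F x‖) := by
  unfold av
  rw [norm_smul, Real.norm_of_nonneg (by positivity), smul_eq_mul]
  gcongr
  exact intervalIntegral.norm_integral_le_integral_norm (by positivity)

end

lemma av_mul_left (c : ℂ) (F : ℝ → ℂ) : av (fun x => c * F x) = c * av F := by
  unfold av
  rw [intervalIntegral.integral_const_mul, mul_smul_comm]

lemma av_mul_left' (c : ℝ) (F : ℝ → ℝ) : av (fun x => c * F x) = c * av F := by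
  unfold av
  rw [intervalIntegral.integral_const_mul, mul_smul_comm]

lemma av_mono (F G : ℝ → ℝ) (hF : Continuous F) (hG : Continuous G) (h : ∀ x, F x ≤ G x) :
    av F ≤ av G := by
  unfold av
  rw [smul_eq_mul, smul_eq_mul]
  gcongr
  exact intervalIntegral.integral_mono (by positivity) (hF.intervalIntegrable _ _) (hG.intervalIntegrable _ _) h

lemma av_nonneg (F : ℝ → ℝ) (h : ∀ x, 0 ≤ F x) : 0 ≤ av F := by
  unfold av
  rw [smul_eq_mul]
  apply mul_nonneg (by positivity)
  exact intervalIntegral.integral_nonneg (by positivity) fun x _ => h x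

lemma av_cs (a b : ℝ → ℝ) (ha : Continuous a) (hb : Continuous b) :
    av (fun x => a x * b x) ≤ √(av fun x => a x ^ 2) * √(av fun x => b x ^ 2) := by
  have h : ∀ t : ℝ, 0 ≤ (av fun x => b x ^ 2) * (t * t) + (2 * av (fun x => a x * b x)) * t + (av fun x => a x ^ 2) := by
    intro t
    have : av (fun x => (a x + t * b x)^2) =
        (av fun x => b x ^ 2) * (t * t) + (2 * av (fun x => a x * b x)) * t + (av fun x => a x ^ 2) := by
      have e : (fun x => (a x + t * b x)^2) = fun x => ((t * t) * b x ^ 2 + (2 * t) * (a x * b x)) + a x ^ 2 := by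
        funext x; ring
      rw [e, av_add _ _ (by fun_prop) (by fun_prop), av_add _ _ (by fun_prop) (by fun_prop),
        av_mul_left', av_mul_left']
      ring
    rw [← this]
    exact av_nonneg _ fun x => sq_nonneg _
  have := discrim_le_zero h
  unfold discrim at this
  rw [← Real.sqrt_mul (av_nonneg _ fun x => sq_nonneg _)]
  apply Real.le_sqrt_of_sq_le
  nlinarith

/-- exponential -/
noncomputable def ee (n : ℤ) (x : ℝ) : ℂ := cexp ((n:ℂ) * x * I)

lemma ee_cont (n : ℤ) : Continuous (ee n) := by unfold ee; fun_prop

lemma ee_add (n : ℤ) (x y : ℝ) : ee n (x + y) = ee n x * ee n y := by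
  unfold ee; rw [← Complex.exp_add]; push_cast; ring_nf

lemma ee_mul (n m : ℤ) (x : ℝ) : ee n x * ee m x = ee (n + m) x := by
  unfold ee; rw [← Complex.exp_add]; push_cast; ring_nf

lemma ee_norm (n : ℤ) (x : ℝ) : ‖ee n x‖ = 1 := by
  unfold ee
  have := Complex.norm_exp_ofReal_mul_I (n * x)
  push_cast at this
  exact this

lemma ee_conj (n : ℤ) (x : ℝ) : (starRingEnd ℂ) (ee n x) = ee (-n) x := by
  unfold ee; rw [← Complex.exp_conj]; simp

lemma ee_two_pi (n : ℤ) : ee n (2 * π) = 1 := by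
  unfold ee
  rw [Complex.exp_eq_one_iff]
  exact ⟨n, by push_cast; ring⟩

lemma ee_per (n : ℤ) : Function.Periodic (ee n) (2 * π) := by
  intro x; rw [ee_add, ee_two_pi, mul_one]

lemma ee_neg (n : ℤ) (x : ℝ) : ee n (-x) = ee (-n) x := by unfold ee; push_cast; ring_nf

lemma ee_zero (x : ℝ) : ee 0 x = 1 := by unfold ee; simp

lemma av_ee (n : ℤ) : av (ee n) = if n = 0 then 1 else 0 := by
  split_ifs with h
  · subst h
    unfold av
    simp only [ee_zero]
    rw [intervalIntegral.integral_const]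
    simp
    rw [← mul_inv]
    rw [mul_comm (π:ℂ) 2, inv_mul_cancel₀]
    exact_mod_cast (by positivity : (2 * π) ≠ 0)
  · unfold av ee
    have hc : ((n:ℂ) * I) ≠ 0 := by simp [h]
    have : ∀ x : ℝ, cexp ((n:ℂ) * x * I) = cexp ((n:ℂ) * I * x) := fun x => by ring_nf
    simp only [this]
    rw [integral_exp_mul_complex hc]
    have h2 : cexp ((n:ℂ) * I * ((2 * π : ℝ) : ℂ)) = 1 := by
      rw [Complex.exp_eq_one_iff]; exact ⟨n, by push_cast; ring⟩
    rw [h2]; simp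

/-- trigonometric polynomial -/
noncomputable def tp (S : Finset ℤ) (G : ℤ → ℂ) (x : ℝ) : ℂ := ∑ j ∈ S, G j * ee j x

lemma tp_cont (S : Finset ℤ) (G : ℤ → ℂ) : Continuous (tp S G) := by
  unfold tp
  exact continuous_finsetSum _ fun j _ => continuous_const.mul (ee_cont j)

lemma tp_per (S : Finset ℤ) (G : ℤ → ℂ) : Function.Periodic (tp S G) (2 * π) := by
  intro x; unfold tp; simp only [ee_per _ x]

lemma tp_parseval (S : Finset ℤ) (G : ℤ → ℂ) : av (fun x => ‖tp S G x‖ ^ 2) = nrm S G ^ 2 := by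
  have h : ((av (fun x => ‖tp S G x‖ ^ 2) : ℝ) : ℂ) = av (fun x => ((‖tp S G x‖ ^ 2 : ℝ) : ℂ)) := by
    unfold av
    rw [intervalIntegral.integral_ofReal]
    simp
  have e : ∀ x, ((‖tp S G x‖ ^ 2 : ℝ) : ℂ) =
      ∑ j ∈ S, ∑ k ∈ S, (G j * (starRingEnd ℂ) (G k)) * ee (j - k) x := by
    intro x
    push_cast
    rw [← Complex.mul_conj']
    unfold tp
    rw [map_sum, Finset.sum_mul_sum]
    refine Finset.sum_congr rfl fun j _ => Finset.sum_congr rfl fun k _ => ?_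
    rw [map_mul, ee_conj, sub_eq_add_neg, ← ee_mul]; ring
  have : ((av (fun x => ‖tp S G x‖ ^ 2) : ℝ) : ℂ) = ((nrm S G ^ 2 : ℝ) : ℂ) := by
    rw [h]
    have c := ee_cont
    simp only [e]
    rw [av_sum _ _ fun j _ => continuous_finsetSum _ fun k _ => by fun_prop]
    rw [nrm_sq]
    push_cast
    refine Finset.sum_congr rfl fun j hj => ?_
    rw [av_sum _ _ fun k _ => by fun_prop]
    simp only [av_mul_left, av_ee, sub_eq_zero]
    rw [← Complex.mul_conj']
    simp [hj]
  exact_mod_cast this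

/-- Fourier coefficient -/
noncomputable def cf (u : ℝ → ℂ) (n : ℤ) : ℂ := av (fun x => ee (-n) x * u x)

lemma frm_cf (u : ℝ → ℂ) (hu : Continuous u) (S : Finset ℤ) (G h : ℤ → ℂ) :
    frm S (fun m j => cf u (m - j)) G h =
      av (fun x => u x * tp S G x * (starRingEnd ℂ) (tp S (fun m => (starRingEnd ℂ) (h m)) x)) := by
  have e : ∀ x, u x * tp S G x * (starRingEnd ℂ) (tp S (fun m => (starRingEnd ℂ) (h m)) x) =
      ∑ m ∈ S, ∑ j ∈ S, (G j * h m) * (ee (-(m - j)) x * u x) := by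
    intro x
    unfold tp
    rw [map_sum, mul_assoc, Finset.sum_mul_sum, Finset.sum_comm, Finset.mul_sum]
    refine Finset.sum_congr rfl fun m _ => ?_
    rw [Finset.mul_sum]
    refine Finset.sum_congr rfl fun j _ => ?_
    rw [map_mul, ee_conj, Complex.conj_conj, show -(m-j) = j + -m by ring, ← ee_mul]; ring
  have := ee_cont
  simp only [e]
  rw [av_sum _ _ fun j _ => continuous_finsetSum _ fun k _ => by fun_prop]
  unfold frm
  refine Finset.sum_congr rfl fun m _ => ?_
  rw [av_sum _ _ fun j _ => by fun_prop]
  refine Finset.sum_congr rfl fun j _ => ?_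
  rw [av_mul_left]; unfold cf; ring

lemma nrm_conj (S : Finset ℤ) (h : ℤ → ℂ) : nrm S (fun m => (starRingEnd ℂ) (h m)) = nrm S h := by
  unfold nrm; simp

lemma OB_cf (u : ℝ → ℂ) (hu : Continuous u) (M : ℝ) (hM : ∀ x, ‖u x‖ ≤ M) :
    OB (fun m j => cf u (m - j)) M := by
  intro S G h
  have hM0 : 0 ≤ M := (norm_nonneg _).trans (hM 0)
  have c1 := tp_cont S G
  have c2 := tp_cont S (fun m => (starRingEnd ℂ) (h m))
  rw [frm_cf u hu]
  refine (norm_av_le _).trans ?_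
  calc av (fun x => ‖u x * tp S G x * (starRingEnd ℂ) (tp S (fun m => (starRingEnd ℂ) (h m)) x)‖)
      ≤ av (fun x => M * (‖tp S G x‖ * ‖tp S (fun m => (starRingEnd ℂ) (h m)) x‖)) := by
        apply av_mono
        · simp only [norm_mul, RCLike.norm_conj]; fun_prop
        · fun_prop
        · intro x
          rw [norm_mul, norm_mul, RCLike.norm_conj, mul_assoc]
          exact mul_le_mul_of_nonneg_right (hM x) (by positivity)
    _ ≤ M * (nrm S G * nrm S h) := by
        rw [av_mul_left']
        gcongr
        refine (av_cs _ _ c1.norm c2.norm).trans (le_of_eq ?_)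
        rw [tp_parseval, tp_parseval, nrm_conj, Real.sqrt_sq (nrm_nonneg _ _), Real.sqrt_sq (nrm_nonneg _ _)]
    _ = _ := by ring

/-! ### translations -/

noncomputable def mid (r : ℝ) (u : ℝ → ℂ) : ℝ → ℂ := fun x => (u (x + r) + u (x - r)) / 2
noncomputable def dif (r : ℝ) (u : ℝ → ℂ) : ℝ → ℂ := fun x => (u (x + r) - u (x - r)) / 2

lemma mid_cont {u} (r : ℝ) (hu : Continuous u) : Continuous (mid r u) := by unfold mid; fun_prop
lemma dif_cont {u} (r : ℝ) (hu : Continuous u) : Continuous (dif r u) := by unfold dif; fun_prop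
lemma mid_per {u} (r : ℝ) (hu : Function.Periodic u (2 * π)) : Function.Periodic (mid r u) (2 * π) := by
  intro x; unfold mid
  rw [show x + 2 * π + r = (x + r) + 2 * π by ring, show x + 2 * π - r = (x - r) + 2 * π by ring, hu, hu]

lemma cf_shift (u : ℝ → ℂ) (hp : Function.Periodic u (2 * π)) (r : ℝ) (n : ℤ) :
    cf (fun x => u (x + r)) n = ee n r * cf u n := by
  have h1 : Function.Periodic (fun x => ee (-n) x * u x) (2 * π) := by
    intro x; simp only [ee_per _ x, hp x]
  unfold cf
  rw [← av_shift _ h1 r, ← av_mul_left]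
  congr 1; funext x
  have : ee n r * ee (-n) r = 1 := by rw [ee_mul]; simp [ee_zero]
  rw [ee_add]
  linear_combination (- ee (-n) x * u (x + r)) * this

lemma ee_cos (n : ℤ) (r : ℝ) : (ee n r + ee n (-r)) / 2 = (Real.cos (n * r) : ℂ) := by
  rw [Complex.ofReal_cos, Complex.cos]; unfold ee; push_cast; ring_nf

lemma ee_sin (n : ℤ) (r : ℝ) : (ee n r - ee n (-r)) / 2 = I * (Real.sin (n * r) : ℂ) := by
  rw [Complex.ofReal_sin, Complex.sin]; unfold ee; push_cast; ring_nf; rw [Complex.I_sq]; ring_nf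

lemma cf_mid (u : ℝ → ℂ) (hu : Continuous u) (hp : Function.Periodic u (2 * π)) (r : ℝ) (n : ℤ) :
    cf (mid r u) n = (Real.cos (n * r) : ℂ) * cf u n := by
  have h1 := cf_shift u hp r n
  have h2 := cf_shift u hp (-r) n
  have c := ee_cont
  have : cf (mid r u) n = 2⁻¹ * (cf (fun x => u (x + r)) n + cf (fun x => u (x + -r)) n) := by
    unfold cf mid
    rw [← av_add _ _ (by fun_prop) (by fun_prop), ← av_mul_left]
    congr 1; funext x; simp only [← sub_eq_add_neg]; ring
  rw [this, h1, h2, ← ee_cos]; ring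

lemma cf_dif (u : ℝ → ℂ) (hu : Continuous u) (hp : Function.Periodic u (2 * π)) (r : ℝ) (n : ℤ) :
    cf (dif r u) n = (I * (Real.sin (n * r) : ℂ)) * cf u n := by
  have h1 := cf_shift u hp r n
  have h2 := cf_shift u hp (-r) n
  have c := ee_cont
  have : cf (dif r u) n = 2⁻¹ * (cf (fun x => u (x + r)) n + -1 * cf (fun x => u (x + -r)) n) := by
    unfold cf dif
    rw [← av_mul_left, ← av_add _ _ (by fun_prop) (by fun_prop), ← av_mul_left]
    congr 1; funext x; simp only [← sub_eq_add_neg]; ring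
  rw [this, h1, h2, ← ee_sin]; ring

lemma mid_tp (S : Finset ℤ) (G : ℤ → ℂ) (r : ℝ) :
    mid r (tp S G) = tp S (fun j => (Real.cos (j * r) : ℂ) * G j) := by
  funext x
  unfold mid tp
  rw [← Finset.sum_add_distrib, Finset.sum_div]
  refine Finset.sum_congr rfl fun j _ => ?_
  simp only []
  rw [← ee_cos, sub_eq_add_neg, ee_add, ee_add]; ring

/-! ### Carleson -/

noncomputable def itr (r : ℕ → ℝ) : ℕ → (ℝ → ℂ) → (ℝ → ℂ)
  | 0, u => u
  | p + 1, u => mid (r p) (itr r p u)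

lemma itr_cont {u} (r : ℕ → ℝ) (hu : Continuous u) (p : ℕ) : Continuous (itr r p u) := by
  induction p with
  | zero => exact hu
  | succ p ih => exact mid_cont _ ih

lemma itr_per {u} (r : ℕ → ℝ) (hu : Function.Periodic u (2 * π)) (p : ℕ) :
    Function.Periodic (itr r p u) (2 * π) := by
  induction p with
  | zero => exact hu
  | succ p ih => exact mid_per _ ih

lemma itr_le {u : ℝ → ℂ} (r : ℕ → ℝ) (M : ℝ) (hu : ∀ x, ‖u x‖ ≤ M) (p : ℕ) : ∀ x, ‖itr r p u x‖ ≤ M := by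
  induction p with
  | zero => exact hu
  | succ p ih =>
    intro x
    simp only [itr, mid]
    rw [norm_div]
    have := norm_add_le (itr r p u (x + r p)) (itr r p u (x - r p))
    have := ih (x + r p)
    have := ih (x - r p)
    norm_num
    linarith

lemma ptwise (p q a b : ℂ) (M : ℝ) (hp : ‖p‖ ≤ M) :
    2 * (‖p * a‖^2 + 8 * M^2 * ‖a‖^2) + ‖q * a‖^2 ≤
      (‖(p + q) * (a + b)‖^2 + 8 * M^2 * ‖a+b‖^2) + (‖(p - q) * (a - b)‖^2 + 8 * M^2 * ‖a-b‖^2) := by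
  have e : ∀ z w : ℂ, ‖z + w‖^2 = ‖z‖^2 + ‖w‖^2 + 2 * (z * (starRingEnd ℂ) w).re := by
    intro z w
    rw [← Complex.normSq_eq_norm_sq, ← Complex.normSq_eq_norm_sq, ← Complex.normSq_eq_norm_sq, Complex.normSq_add]
  have e' : ∀ z w : ℂ, ‖z - w‖^2 = ‖z‖^2 + ‖w‖^2 - 2 * (z * (starRingEnd ℂ) w).re := by
    intro z w
    rw [← Complex.normSq_eq_norm_sq, ← Complex.normSq_eq_norm_sq, ← Complex.normSq_eq_norm_sq, Complex.normSq_sub]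
  have b1 : |(p * (starRingEnd ℂ) q).re| ≤ ‖p‖ * ‖q‖ := by
    refine (Complex.abs_re_le_norm _).trans ?_; simp
  have b2 : |(a * (starRingEnd ℂ) b).re| ≤ ‖a‖ * ‖b‖ := by
    refine (Complex.abs_re_le_norm _).trans ?_; simp
  simp only [norm_mul, mul_pow, e, e']
  have b3 : |(p * (starRingEnd ℂ) q).re * (a * (starRingEnd ℂ) b).re| ≤ (‖p‖ * ‖q‖) * (‖a‖ * ‖b‖) := by
    rw [abs_mul]; gcongr
  have b4 := (abs_le.1 b3).1
  set x := (p * (starRingEnd ℂ) q).re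
  set y := (a * (starRingEnd ℂ) b).re
  have hM : ‖p‖^2 ≤ M^2 := pow_le_pow_left₀ (norm_nonneg _) hp 2
  have b5 : 0 ≤ (M^2 - ‖p‖^2) * ‖b‖^2 := mul_nonneg (by linarith) (by positivity)
  have b6 : 0 ≤ ‖p‖^2 * ‖b‖^2 := by positivity
  have b7 : 0 ≤ ‖q‖^2 * ‖b‖^2 := by positivity
  nlinarith [sq_nonneg (‖q‖ * ‖a‖ - 4 * (‖p‖ * ‖b‖))]

lemma carleson_step (U H : ℝ → ℂ) (hU : Continuous U) (hH : Continuous H)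
    (pU : Function.Periodic U (2 * π)) (pH : Function.Periodic H (2 * π)) (M r : ℝ) (hM : ∀ x, ‖U x‖ ≤ M) :
    av (fun x => ‖mid r U x * mid r H x‖^2 + 8 * M^2 * ‖mid r H x‖^2) + 2⁻¹ * av (fun x => ‖dif r U x * mid r H x‖^2)
      ≤ av (fun x => ‖U x * H x‖^2 + 8 * M^2 * ‖H x‖^2) := by
  set F : ℝ → ℝ := fun x => ‖U x * H x‖^2 + 8 * M^2 * ‖H x‖^2 with hF
  have cF : Continuous F := by fun_prop
  have pF : Function.Periodic F (2 * π) := by intro x; simp only [hF, pU x, pH x]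
  have e1 := av_shift F pF r
  have e2 := av_shift F pF (-r)
  have c1 := mid_cont r hU
  have c2 := mid_cont r hH
  have c3 := dif_cont r hU
  have c4 := dif_cont r hH
  have : av F = 2⁻¹ * av (fun x => F (x + r) + F (x + -r)) := by
    rw [av_add (fun x => F (x + r)) (fun x => F (x + -r)) (by fun_prop) (by fun_prop), e1, e2]; ring
  rw [this, ← av_mul_left', ← av_mul_left', ← av_add _ _ (by fun_prop) (by fun_prop)]
  apply av_mono _ _ (by fun_prop) (by fun_prop)
  intro x
  have hm : ‖mid r U x‖ ≤ M := itr_le (fun _ => r) M hM 1 x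
  have := ptwise (mid r U x) (dif r U x) (mid r H x) (dif r H x) M hm
  have a1 : ∀ u : ℝ → ℂ, mid r u x + dif r u x = u (x + r) := by intro u; unfold mid dif; ring
  have a2 : ∀ u : ℝ → ℂ, mid r u x - dif r u x = u (x + -r) := by
    intro u; unfold mid dif; rw [← sub_eq_add_neg]; ring
  rw [a1, a1, a2, a2] at this
  simp only [hF]
  linarith

lemma carleson (U H : ℝ → ℂ) (hU : Continuous U) (hH : Continuous H)
    (pU : Function.Periodic U (2 * π)) (pH : Function.Periodic H (2 * π)) (M : ℝ) (hM : ∀ x, ‖U x‖ ≤ M)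
    (r : ℕ → ℝ) (P : ℕ) :
    ∑ p ∈ Finset.range P, av (fun x => ‖dif (r p) (itr r p U) x * itr r (p+1) H x‖^2)
      ≤ 18 * M^2 * av (fun x => ‖H x‖^2) := by
  have ind : ∀ P : ℕ, av (fun x => ‖itr r P U x * itr r P H x‖^2 + 8 * M^2 * ‖itr r P H x‖^2) +
      2⁻¹ * ∑ p ∈ Finset.range P, av (fun x => ‖dif (r p) (itr r p U) x * itr r (p+1) H x‖^2)
      ≤ av (fun x => ‖U x * H x‖^2 + 8 * M^2 * ‖H x‖^2) := by
    intro P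
    induction P with
    | zero => simp [itr]
    | succ P ih =>
      rw [Finset.sum_range_succ]
      have := carleson_step (itr r P U) (itr r P H) (itr_cont r hU P) (itr_cont r hH P) (itr_per r pU P)
        (itr_per r pH P) M (r P) (itr_le r M hM P)
      change av (fun x => ‖itr r (P+1) U x * itr r (P+1) H x‖^2 + 8 * M^2 * ‖itr r (P+1) H x‖^2) + 2⁻¹ * av (fun x => ‖dif (r P) (itr r P U) x * itr r (P+1) H x‖^2) ≤ _ at this
      linarith
  have h1 := ind P
  have h2 : 0 ≤ av (fun x => ‖itr r P U x * itr r P H x‖^2 + 8 * M^2 * ‖itr r P H x‖^2) :=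
    av_nonneg _ fun x => by positivity
  have h3 : av (fun x => ‖U x * H x‖^2 + 8 * M^2 * ‖H x‖^2) ≤ av (fun x => 9 * M^2 * ‖H x‖^2) := by
    apply av_mono _ _ (by fun_prop) (by fun_prop)
    intro x
    have : ‖U x * H x‖^2 ≤ M^2 * ‖H x‖^2 := by
      rw [norm_mul, mul_pow]
      have := hM x
      gcongr
    linarith
  rw [av_mul_left'] at h3
  linarith

end KP

namespace KP

lemma Bd.of_eq {K K' : ℤ → ℤ → ℂ} {c : ℝ} (h : Bd K c) (e : ∀ m j, K' m j = K m j) : Bd K' c := by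
  have : K' = K := by funext m j; exact e m j
  rw [this]; exact h

/-- products of cosines -/
noncomputable def wp (r : ℕ → ℝ) (p : ℕ) (x : ℝ) : ℝ := ∏ i ∈ Finset.range p, Real.cos (x * r i)
noncomputable def sg (r : ℕ → ℝ) (p : ℕ) (x : ℝ) : ℝ := Real.sin (x * r p) * wp r p x

lemma wp_succ (r : ℕ → ℝ) (p : ℕ) (x : ℝ) : wp r (p+1) x = wp r p x * Real.cos (x * r p) :=
  Finset.prod_range_succ _ _

lemma wp_abs (r : ℕ → ℝ) (p : ℕ) (x : ℝ) : |wp r p x| ≤ 1 := by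
  unfold wp
  rw [Finset.abs_prod]
  exact Finset.prod_le_one (fun _ _ => abs_nonneg _) fun _ _ => Real.abs_cos_le_one _

lemma cf_itr (u : ℝ → ℂ) (hu : Continuous u) (hp : Function.Periodic u (2 * π)) (r : ℕ → ℝ) (p : ℕ) (n : ℤ) :
    cf (itr r p u) n = (wp r p n : ℂ) * cf u n := by
  induction p with
  | zero => simp [itr, wp]
  | succ p ih =>
    change cf (mid (r p) (itr r p u)) n = _
    rw [cf_mid _ (itr_cont r hu p) (itr_per r hp p), ih, wp_succ]
    push_cast; ring

lemma cf_dif_itr (u : ℝ → ℂ) (hu : Continuous u) (hp : Function.Periodic u (2 * π)) (r : ℕ → ℝ) (p : ℕ) (n : ℤ) :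
    cf (dif (r p) (itr r p u)) n = I * (sg r p n : ℂ) * cf u n := by
  rw [cf_dif _ (itr_cont r hu p) (itr_per r hp p), cf_itr u hu hp]
  unfold sg; push_cast; ring

lemma itr_tp (S : Finset ℤ) (G : ℤ → ℂ) (r : ℕ → ℝ) (p : ℕ) :
    itr r p (tp S G) = tp S (fun j => (wp r p j : ℂ) * G j) := by
  induction p with
  | zero => simp [itr, wp]
  | succ p ih =>
    change mid (r p) (itr r p _) = _
    rw [ih, mid_tp]
    congr 1; funext j; rw [wp_succ]; push_cast; ring

lemma Bd_cos (y : ℝ) : Bd (fun m j => (Real.cos (((m - j : ℤ) : ℝ) * y) : ℂ)) 1 := by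
  have h1 := Bd.sep (fun m => ee m y / 2) (fun j => ee (-j) y) (1/2) 1 (by norm_num) (by norm_num)
    (by intro m; rw [norm_div, ee_norm]; norm_num) (by intro m; rw [ee_norm])
  have h2 := Bd.sep (fun m => ee m (-y) / 2) (fun j => ee (-j) (-y)) (1/2) 1 (by norm_num) (by norm_num)
    (by intro m; rw [norm_div, ee_norm]; norm_num) (by intro m; rw [ee_norm])
  refine ((h1.add h2).mono (by norm_num)).of_eq fun m j => ?_
  rw [← ee_cos, sub_eq_add_neg, ← ee_mul, ← ee_mul]; ring

lemma cs_norm (x : ℝ) : ‖((Real.cos x : ℝ) : ℂ)‖ ≤ 1 := by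
  rw [Complex.norm_real]; exact Real.abs_cos_le_one _
lemma sn_norm (x : ℝ) : ‖((Real.sin x : ℝ) : ℂ)‖ ≤ 1 := by
  rw [Complex.norm_real]; exact Real.abs_sin_le_one _

lemma Bd_sin (y : ℝ) : Bd (fun m j => (Real.sin (((m - j : ℤ) : ℝ) * y) : ℂ)) 2 := by
  have h1 := Bd.sep (fun m => (Real.sin (m * y) : ℂ)) (fun j => (Real.cos (j * y) : ℂ)) 1 1 (by norm_num) (by norm_num)
    (fun m => sn_norm _) (fun m => cs_norm _)
  have h2 := Bd.sep (fun m => -(Real.cos (m * y) : ℂ)) (fun j => (Real.sin (j * y) : ℂ)) 1 1 (by norm_num) (by norm_num)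
    (fun m => by rw [norm_neg]; exact cs_norm _) (fun m => sn_norm _)
  refine ((h1.add h2).mono (by norm_num)).of_eq fun m j => ?_
  push_cast
  rw [sub_mul, Complex.sin_sub]; ring

/-- block indicator -/
noncomputable def ind (l : ℕ) (m : ℤ) : ℂ := if bl m = l then 1 else 0

lemma ind_norm (l : ℕ) (m : ℤ) : ‖ind l m‖ ≤ 1 := by unfold ind; split_ifs <;> simp

lemma ind_small (l : ℕ) (y : ℝ) (hy : 0 ≤ y) (z : ℝ → ℝ) (hz : ∀ x, |z x| ≤ |x|) (m : ℤ) :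
    ‖ind l m * (z (m * y) : ℂ)‖ ≤ 2 ^ l * y := by
  unfold ind
  split_ifs with h
  · rw [one_mul, Complex.norm_real, Real.norm_eq_abs]
    refine (hz _).trans ?_
    rw [abs_mul, abs_of_nonneg hy]
    have := abs_lt_bl m
    rw [h] at this
    gcongr
  · simp; positivity

lemma z1 (x : ℝ) : |Real.cos x - 1| ≤ |x| := by
  rw [abs_sub_comm, abs_of_nonneg (by linarith [Real.cos_le_one x])]
  rcases le_total |x| 1 with h | h
  · have := Real.one_sub_sq_div_two_le_cos (x := x)
    rw [← sq_abs] at this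
    nlinarith [abs_nonneg x]
  · rcases le_total |x| 2 with h2 | h2
    · have := Real.one_sub_sq_div_two_le_cos (x := x)
      rw [← sq_abs] at this
      nlinarith [abs_nonneg x]
    · linarith [Real.neg_one_le_cos x]

lemma Bd_cosdiff (l : ℕ) (y : ℝ) (hy : 0 ≤ y) :
    Bd (fun m j => ind l m * ((Real.cos (((m - j : ℤ) : ℝ) * y) : ℂ) - Real.cos (j * y))) (2 * 2^l * y) := by
  have h1 := Bd.sep (fun m => ind l m * ((Real.cos (m * y) - 1 : ℝ) : ℂ)) (fun j => (Real.cos (j * y) : ℂ)) (2^l*y) 1 (by positivity) (by norm_num)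
    (fun m => ind_small l y hy (fun x => Real.cos x - 1) z1 m) (fun m => cs_norm _)
  have h2 := Bd.sep (fun m => ind l m * (Real.sin (m * y) : ℂ)) (fun j => (Real.sin (j * y) : ℂ)) (2^l*y) 1 (by positivity) (by norm_num)
    (fun m => ind_small l y hy Real.sin (fun x => Real.abs_sin_le_abs) m) (fun m => sn_norm _)
  refine ((h1.add h2).mono (by linarith)).of_eq fun m j => ?_
  push_cast
  rw [sub_mul, Complex.cos_sub]; ring

lemma Bd_sindiff (l : ℕ) (y : ℝ) (hy : 0 ≤ y) :
    Bd (fun m j => ind l m * ((Real.sin (((m - j : ℤ) : ℝ) * y) : ℂ) + Real.sin (j * y))) (2 * 2^l * y) := by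
  have h1 := Bd.sep (fun m => ind l m * ((Real.cos (m * y) - 1 : ℝ) : ℂ)) (fun j => -(Real.sin (j * y) : ℂ)) (2^l*y) 1 (by positivity) (by norm_num)
    (fun m => ind_small l y hy (fun x => Real.cos x - 1) z1 m) (fun m => by rw [norm_neg]; exact sn_norm _)
  have h2 := Bd.sep (fun m => ind l m * (Real.sin (m * y) : ℂ)) (fun j => (Real.cos (j * y) : ℂ)) (2^l*y) 1 (by positivity) (by norm_num)
    (fun m => ind_small l y hy Real.sin (fun x => Real.abs_sin_le_abs) m) (fun m => cs_norm _)
  refine ((h1.add h2).mono (by linarith)).of_eq fun m j => ?_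
  push_cast
  rw [sub_mul, Complex.sin_sub]; ring

lemma Bd_wp (r : ℕ → ℝ) (p : ℕ) : Bd (fun m j => (wp r p ((m - j : ℤ) : ℝ) : ℂ)) 1 := by
  induction p with
  | zero =>
    refine (Bd.sep (fun _ => 1) (fun _ => 1) 1 1 (by norm_num) (by norm_num) (by simp) (by simp)).mono (by norm_num) |>.of_eq ?_
    intro m j; simp [wp]
  | succ p ih =>
    refine ((ih.mul (Bd_cos (r p))).mono (by norm_num)).of_eq fun m j => ?_
    rw [wp_succ]; push_cast; ring

lemma Bd_one_j (b : ℤ → ℂ) (β : ℝ) (hβ : 0 ≤ β) (hb : ∀ j, ‖b j‖ ≤ β) : Bd (fun _ j => b j) β := by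
  refine ((Bd.sep (fun _ => 1) b 1 β (by norm_num) hβ (by simp) hb).mono (by norm_num)).of_eq ?_
  intro m j; simp

lemma Bd_one_m (b : ℤ → ℂ) (β : ℝ) (hβ : 0 ≤ β) (hb : ∀ j, ‖b j‖ ≤ β) : Bd (fun m _ => b m) β := by
  refine ((Bd.sep b (fun _ => 1) β 1 hβ (by norm_num) hb (by simp)).mono (by norm_num)).of_eq ?_
  intro m j; simp

lemma wp_norm (r : ℕ → ℝ) (p : ℕ) (x : ℝ) : ‖(wp r p x : ℂ)‖ ≤ 1 := by
  rw [Complex.norm_real]; exact wp_abs _ _ _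

lemma Bd_wpdiff (r : ℕ → ℝ) (hr : ∀ i, 0 ≤ r i) (l p : ℕ) :
    Bd (fun m j => ind l m * ((wp r p ((m - j : ℤ) : ℝ) : ℂ) - wp r p j))
      (2 * 2^l * ∑ i ∈ Finset.range p, r i) := by
  induction p with
  | zero =>
    refine (Bd.zero.mono (by simp)).of_eq ?_
    intro m j; simp [wp]
  | succ p ih =>
    have h1 := ih.mul (Bd_cos (r p))
    have h2 := (Bd_one_j (fun j => (wp r p j : ℂ)) 1 (by norm_num) (fun j => wp_norm _ _ _)).mul (Bd_cosdiff l (r p) (hr p))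
    refine ((h1.add h2).mono ?_).of_eq fun m j => ?_
    · rw [Finset.sum_range_succ]; linarith
    · rw [wp_succ, wp_succ]; push_cast; ring

lemma Bd_sgdiff (r : ℕ → ℝ) (hr : ∀ i, 0 ≤ r i) (l p : ℕ) (hs : ∑ i ∈ Finset.range p, r i ≤ r p) :
    Bd (fun m j => ind l m * ((sg r p ((m - j : ℤ) : ℝ) : ℂ) - sg r p (-j))) (6 * 2^l * r p) := by
  have h1 := (Bd_sin (r p)).mul (Bd_wpdiff r hr l p)
  have h2 := (Bd_sindiff l (r p) (hr p)).mul (Bd_one_j (fun j => (wp r p j : ℂ)) 1 (by norm_num) (fun j => wp_norm _ _ _))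
  refine ((h1.add h2).mono ?_).of_eq fun m j => ?_
  · have : (2:ℝ)^l * ∑ i ∈ Finset.range p, r i ≤ 2^l * r p := by gcongr
    linarith
  · have : wp r p (-(j:ℝ)) = wp r p j := by unfold wp; simp
    unfold sg
    rw [this, neg_mul, Real.sin_neg]
    push_cast; ring

lemma Bd_sg (r : ℕ → ℝ) (p : ℕ) : Bd (fun m j => (sg r p ((m - j : ℤ) : ℝ) : ℂ)) 2 := by
  refine (((Bd_sin (r p)).mul (Bd_wp r p)).mono (by norm_num)).of_eq fun m j => ?_
  unfold sg; push_cast; ring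

/-! ### dyadic steps -/

noncomputable def dr (L i : ℕ) : ℝ := 2 ^ i / 2 ^ L

lemma dr_pos (L i : ℕ) : 0 < dr L i := by unfold dr; positivity
lemma dr_succ (L i : ℕ) : dr L (i+1) = 2 * dr L i := by unfold dr; rw [pow_succ]; ring

lemma dr_sum (L p : ℕ) : ∑ i ∈ Finset.range p, dr L i ≤ dr L p := by
  induction p with
  | zero => simpa using (dr_pos L 0).le
  | succ p ih => rw [Finset.sum_range_succ, dr_succ]; linarith

lemma dr_sum_sq (L p : ℕ) : ∑ i ∈ Finset.range p, dr L i ^ 2 ≤ dr L p ^ 2 / 3 := by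
  induction p with
  | zero => simp; positivity
  | succ p ih => rw [Finset.sum_range_succ, dr_succ]; linarith

lemma one_sub_wp (r : ℕ → ℝ) (p : ℕ) (x : ℝ) : |1 - wp r p x| ≤ x^2 / 2 * ∑ i ∈ Finset.range p, r i ^ 2 := by
  induction p with
  | zero => simp [wp]
  | succ p ih =>
    rw [wp_succ, Finset.sum_range_succ, mul_add]
    have e : 1 - wp r p x * Real.cos (x * r p) = (1 - wp r p x) + wp r p x * (1 - Real.cos (x * r p)) := by ring
    rw [e]
    refine (abs_add_le _ _).trans (add_le_add ih ?_)
    rw [abs_mul]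
    have h1 := wp_abs r p x
    have h2 := Real.one_sub_sq_div_two_le_cos (x := x * r p)
    have h3 := Real.cos_le_one (x * r p)
    rw [abs_of_nonneg (by linarith : 0 ≤ 1 - Real.cos (x * r p))]
    nlinarith [abs_nonneg (wp r p x)]

lemma abs_sin_ge (x : ℝ) (hx : |x| ≤ 1) : |x| / 2 ≤ |Real.sin x| := by
  have h1 : Real.sin |x| = |Real.sin x| := by
    rcases le_total 0 x with h | h
    · rw [abs_of_nonneg h] at *
      rw [abs_of_nonneg (Real.sin_nonneg_of_nonneg_of_le_pi h (by linarith [Real.pi_gt_three]))]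
    · rw [abs_of_nonpos h] at *
      rw [Real.sin_neg, abs_of_nonpos (Real.sin_nonpos_of_nonpos_of_neg_pi_le h (by linarith [Real.pi_gt_three]))]
  rw [← h1]
  have := Real.mul_le_sin (abs_nonneg x) (by linarith [Real.pi_gt_three])
  refine le_trans ?_ this
  have h4 := Real.pi_le_four
  have : (1:ℝ) / 2 ≤ 2 / π := by
    rw [div_le_div_iff₀ (by norm_num) Real.pi_pos]; linarith
  nlinarith [abs_nonneg x]

lemma sg_lower (L k : ℕ) (hk : 1 ≤ k) (hkL : k ≤ L) (j : ℤ) (hj : bl j = k) :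
    1 / 5 ≤ |sg (dr L) (L - k) (-j)| := by
  have hd : dr L (L - k) = 1 / 2 ^ k := by
    unfold dr
    rw [div_eq_div_iff (by positivity) (by positivity), ← pow_add, Nat.sub_add_cancel hkL, one_mul]
  have h1 := abs_lt_bl j
  have h2 := le_abs_bl j (by omega)
  rw [hj] at h1 h2
  have hθ : |(-(j:ℝ)) * dr L (L - k)| = |(j:ℝ)| / 2 ^ k := by
    rw [abs_mul, abs_neg, hd, abs_of_pos (by positivity : (0:ℝ) < 1 / 2 ^ k)]; ring
  have h3 : |(j:ℝ)| / 2 ^ k ≤ 1 := by rw [div_le_one (by positivity)]; exact h1.le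
  have h4 : 1/2 ≤ |(j:ℝ)| / 2 ^ k := by rw [le_div_iff₀ (by positivity)]; linarith
  have hs := abs_sin_ge _ (hθ.trans_le h3)
  rw [hθ] at hs
  have hw := one_sub_wp (dr L) (L - k) (-(j:ℝ))
  have hq := dr_sum_sq L (L - k)
  have h5 : (-(j:ℝ))^2 / 2 * ∑ i ∈ Finset.range (L - k), dr L i ^ 2 ≤ 1 / 6 := by
    calc _ ≤ (-(j:ℝ))^2 / 2 * (dr L (L - k) ^ 2 / 3) := by gcongr
      _ = |(-(j:ℝ)) * dr L (L - k)|^2 / 6 := by rw [sq_abs]; ring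
      _ ≤ 1^2 / 6 := by rw [hθ]; gcongr
      _ = _ := by norm_num
  have h6 : 5 / 6 ≤ wp (dr L) (L - k) (-(j:ℝ)) := by
    have := (abs_le.1 (hw.trans h5)).2; linarith
  unfold sg
  rw [abs_mul, abs_of_nonneg (by linarith : 0 ≤ wp (dr L) (L - k) (-(j:ℝ)))]
  nlinarith [abs_nonneg (Real.sin (-(j:ℝ) * dr L (L - k)))]

lemma wp_sin (L p : ℕ) (x : ℝ) : wp (dr L) p x * (2 ^ p * Real.sin (x * dr L 0)) = Real.sin (x * dr L p) := by
  induction p with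
  | zero => simp [wp]
  | succ p ih =>
    rw [wp_succ, dr_succ, show x * (2 * dr L p) = 2 * (x * dr L p) by ring, Real.sin_two_mul, ← ih]; ring

lemma wp_close (L k l : ℕ) (hk : 1 ≤ k) (hkL : k ≤ L) (hl : l ≤ L) (m : ℤ) (hm : bl m = l) :
    |(if l + 2 ≤ k then 1 else 0) - wp (dr L) (L - k + 1) m| ≤ 2 * (1/2) ^ Nat.dist l k := by
  have hd : dr L (L - k) = 1 / 2 ^ k := by
    unfold dr
    rw [div_eq_div_iff (by positivity) (by positivity), ← pow_add, Nat.sub_add_cancel hkL, one_mul]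
  have h1 := abs_lt_bl m
  rw [hm] at h1
  split_ifs with h
  · have hw := one_sub_wp (dr L) (L - k + 1) m
    refine hw.trans ?_
    have hq := dr_sum_sq L (L - k + 1)
    rw [dr_succ, hd] at hq
    rw [Nat.dist_eq_sub_of_le (by omega)]
    obtain ⟨d, rfl⟩ := Nat.exists_eq_add_of_le (show l ≤ k by omega)
    rw [Nat.add_sub_cancel_left]
    calc _ ≤ (m:ℝ)^2 / 2 * ((2 * (1 / 2^(l+d)))^2/3) := by gcongr
      _ = (|(m:ℝ)| / 2^l)^2 * (2/3) * ((1/2)^d * (1/2)^d) := by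
          rw [div_pow, sq_abs, pow_add, one_div_pow]; field_simp
      _ ≤ 1^2 * (2/3) * ((1/2)^d * 1) := by
          gcongr
          · rw [div_le_one (by positivity)]; exact h1.le
          · exact pow_le_one₀ (by norm_num) (by norm_num)
      _ ≤ _ := by
          have : (0:ℝ) < (1/2)^d := by positivity
          linarith
  · rw [zero_sub, abs_neg]
    rcases Nat.lt_or_ge l k with hlk | hlk
    · have : l + 1 = k := by omega
      subst this
      rw [Nat.dist_eq_sub_of_le (by omega)]
      have := wp_abs (dr L) (L - (l+1) + 1) m
      simpa using this
    · rw [Nat.dist_comm, Nat.dist_eq_sub_of_le hlk]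
      have h2 := le_abs_bl m (by omega)
      rw [hm] at h2
      have hm0 : 0 < |(m:ℝ)| := lt_of_lt_of_le (by positivity) h2
      have e0 : |(m:ℝ) * dr L 0| = |(m:ℝ)| / 2 ^ L := by
        rw [abs_mul, abs_of_pos (dr_pos L 0)]; unfold dr; ring
      have hle : |(m:ℝ) * dr L 0| ≤ 1 := by
        rw [e0, div_le_one (by positivity)]
        exact h1.le.trans (pow_le_pow_right₀ (by norm_num) hl)
      have hs := abs_sin_ge _ hle
      have hw := congrArg abs (wp_sin L (L - k + 1) m)
      rw [abs_mul, abs_mul, abs_of_pos (by positivity : (0:ℝ) < 2 ^ (L-k+1))] at hw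
      have hs1 := Real.abs_sin_le_one ((m:ℝ) * dr L (L - k + 1))
      rw [← hw] at hs1
      rw [e0] at hs
      set w := |wp (dr L) (L - k + 1) m|
      have hw0 : 0 ≤ w := abs_nonneg _
      have h5 : w * (2 ^ (L - k + 1) * (|(m:ℝ)| / 2 ^ L / 2)) ≤ 1 :=
        le_trans (by gcongr) hs1
      have h6 : (2:ℝ) ^ (L - k + 1) * (|(m:ℝ)| / 2 ^ L / 2) = |(m:ℝ)| / 2^k := by
        have : (2:ℝ) ^ L = 2 ^ (L - k) * 2 ^ k := by rw [← pow_add, Nat.sub_add_cancel hkL]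
        rw [this, pow_succ]; field_simp
      rw [h6] at h5
      have h7 : (2:ℝ) ^ l / 2 / 2 ^ k ≤ |(m:ℝ)| / 2^k := by gcongr
      have h8 : (2:ℝ) ^ l / 2 / 2 ^ k = 2 ^ (l - k) / 2 := by
        have : (2:ℝ) ^ l = 2 ^ (l - k) * 2 ^ k := by rw [← pow_add, Nat.sub_add_cancel hlk]
        rw [this]; field_simp
      rw [h8] at h7
      have h9 : w * (2 ^ (l - k) / 2) ≤ 1 := le_trans (by gcongr) h5
      rw [one_div_pow]
      rw [mul_one_div, le_div_iff₀ (by positivity)]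
      linarith

end KP

namespace KP

/-- error kernel of the paraproduct -/
noncomputable def EE (L : ℕ) (m j : ℤ) : ℂ :=
  if 1 ≤ bl j ∧ bl j ≤ L ∧ bl m ≤ L then
    (if bl m + 2 ≤ bl j then 1 else 0) -
      (sg (dr L) (L - bl j) ((m - j : ℤ) : ℝ) : ℂ) / (sg (dr L) (L - bl j) (-j) : ℂ) *
        (wp (dr L) (L - bl j + 1) m : ℂ)
  else 0

lemma Bd_EE (L : ℕ) : Bd (EE L) (50 * (2 / (1 - 1/2))) := by
  apply Bd.blocks _ _ _ (by norm_num) (by norm_num) (by norm_num)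
  intro l k
  by_cases hv : 1 ≤ k ∧ k ≤ L ∧ l ≤ L
  swap
  · refine (Bd.zero.mono (by positivity)).of_eq fun m j => ?_
    split_ifs with h
    · unfold EE; rw [h.1, h.2, if_neg hv]
    · rfl
  obtain ⟨hk, hkL, hlL⟩ := hv
  have hd : dr L (L - k) = 1 / 2 ^ k := by
    unfold dr
    rw [div_eq_div_iff (by positivity) (by positivity), ← pow_add, Nat.sub_add_cancel hkL, one_mul]
  have hb : ∀ j, ‖ind k j / (sg (dr L) (L - k) (-j) : ℂ)‖ ≤ 5 := by
    intro j
    unfold ind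
    split_ifs with h
    · rw [norm_div, Complex.norm_real, norm_one, Real.norm_eq_abs]
      have := sg_lower L k hk hkL j h
      rw [div_le_iff₀ (by linarith)]; linarith
    · simp
  have B := Bd_one_j _ 5 (by norm_num) hb
  have B' := Bd_one_j _ 5 (by norm_num) (fun j => (norm_neg (ind k j / (sg (dr L) (L - k) (-j) : ℂ))).trans_le (hb j))
  have h2 : Bd (fun m j => (sg (dr L) (L - k) ((m - j : ℤ) : ℝ) : ℂ) *
      (ind l m * ((if l + 2 ≤ k then 1 else 0) - (wp (dr L) (L - k + 1) m : ℂ))) *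
        (ind k j / (sg (dr L) (L - k) (-j) : ℂ))) (20 * (1/2) ^ Nat.dist l k) := by
    have := Bd_one_m (fun m => ind l m * ((if l + 2 ≤ k then 1 else 0) - (wp (dr L) (L - k + 1) m : ℂ)))
      (2 * (1/2) ^ Nat.dist l k) (by positivity) (by
        intro m
        unfold ind
        split_ifs with h h' h'
        · have := wp_close L k l hk hkL hlL m h
          rw [if_pos h', ← Real.norm_eq_abs, ← Complex.norm_real] at this
          push_cast at this
          simpa using this
        · have := wp_close L k l hk hkL hlL m h
          rw [if_neg h', ← Real.norm_eq_abs, ← Complex.norm_real] at this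
          push_cast at this
          simpa using this
        · simp
        · simp)
    refine (((Bd_sg (dr L) (L - k)).mul this).mul B).mono ?_
    exact le_of_eq (by ring)
  have h1 : Bd (fun m j => if l + 2 ≤ k then ind l m *
      ((sg (dr L) (L - k) ((m - j : ℤ) : ℝ) : ℂ) - sg (dr L) (L - k) (-j)) *
        -(ind k j / (sg (dr L) (L - k) (-j) : ℂ)) else 0) (30 * (1/2) ^ Nat.dist l k) := by
    by_cases h : l + 2 ≤ k
    · simp only [if_pos h]
      refine ((Bd_sgdiff (dr L) (fun i => (dr_pos L i).le) l (L - k) (dr_sum L _)).mul B').mono ?_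
      rw [hd, Nat.dist_eq_sub_of_le (by omega), one_div_pow]
      have : (2:ℝ) ^ k = 2 ^ (k - l) * 2 ^ l := by rw [← pow_add, Nat.sub_add_cancel (by omega)]
      rw [this]
      exact le_of_eq (by field_simp; norm_num)
    · simp only [if_neg h]
      exact Bd.zero.mono (by positivity)
  refine ((h1.add h2).mono (le_of_eq (by ring))).of_eq fun m j => ?_
  by_cases hm : bl m = l
  swap
  · have : ind l m = 0 := by unfold ind; rw [if_neg hm]
    simp [hm, this]
  by_cases hj : bl j = k
  swap
  · have : ind k j = 0 := by unfold ind; rw [if_neg hj]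
    simp [hj, this]
  have i1 : ind l m = 1 := by unfold ind; rw [if_pos hm]
  have i2 : ind k j = 1 := by unfold ind; rw [if_pos hj]
  have hne : (sg (dr L) (L - k) (-j) : ℂ) ≠ 0 := by
    have := sg_lower L k hk hkL j hj
    rw [Complex.ofReal_ne_zero, ← abs_pos]; linarith
  rw [if_pos ⟨hm, hj⟩]
  unfold EE
  rw [hm, hj, if_pos ⟨hk, hkL, hlL⟩, i1, i2]
  split_ifs with h
  · field_simp; ring
  · field_simp; ring

lemma para (u : ℝ → ℂ) (hu : Continuous u) (pu : Function.Periodic u (2 * π)) (M : ℝ) (hM : ∀ x, ‖u x‖ ≤ M) :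
    OB (fun m j => if bl m + 2 ≤ bl j then cf u (m - j) else 0) (225 * M) := by
  intro S G h
  obtain ⟨L, hL⟩ := exists_range S
  have hM0 : 0 ≤ M := (norm_nonneg _).trans (hM 0)
  have hE := Bd_EE L _ _ (OB_cf u hu M hM) S G h
  set r := dr L with hr
  set hc : ℤ → ℂ := fun m => (starRingEnd ℂ) (h m) with hhc
  set Gt : ℕ → ℤ → ℂ := fun p j => rs (L - p) G j / (I * (sg r p (-j) : ℂ)) with hGt
  have split : frm S (fun m j => if bl m + 2 ≤ bl j then cf u (m - j) else 0) G h =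
      frm S (fun m j => cf u (m - j) * EE L m j) G h +
      ∑ p ∈ Finset.range L, frm S (fun m j => cf (dif (r p) (itr r p u)) (m - j)) (Gt p)
        (fun m => (wp r (p+1) m : ℂ) * h m) := by
    unfold frm
    rw [Finset.sum_comm (s := Finset.range L), ← Finset.sum_add_distrib]
    refine Finset.sum_congr rfl fun m hm => ?_
    rw [Finset.sum_comm (s := Finset.range L), ← Finset.sum_add_distrib]
    refine Finset.sum_congr rfl fun j hj => ?_
    have hLj := hL j hj
    have hLm := hL m hm
    by_cases h1 : 1 ≤ bl j
    · rw [Finset.sum_eq_single (L - bl j)]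
      · have hne : (sg r (L - bl j) (-j) : ℂ) ≠ 0 := by
          have := sg_lower L (bl j) h1 hLj.le j rfl
          rw [Complex.ofReal_ne_zero, ← abs_pos]; linarith
        have : L - (L - bl j) = bl j := by omega
        simp only []
        rw [cf_dif_itr u hu pu]
        unfold EE
        have hcond : 1 ≤ bl j ∧ bl j ≤ L ∧ bl m ≤ L := ⟨h1, hLj.le, hLm.le⟩
        simp only [hGt, rs, if_pos hcond, ← hr]
        rw [this, if_pos rfl]
        split_ifs with h
        · field_simp; ring
        · field_simp; ring
      · intro p hp hne
        have : bl j ≠ L - p := by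
          have := Finset.mem_range.1 hp; omega
        simp [hGt, rs, this]
      · intro hh
        exact absurd (Finset.mem_range.2 (by omega)) hh
    · have h0 : bl j = 0 := by omega
      rw [Finset.sum_eq_zero]
      · unfold EE; simp [h0]
      · intro p hp
        have : (0:ℕ) ≠ L - p := by
          have := Finset.mem_range.1 hp; omega
        simp [hGt, rs, h0, this]
  rw [split]
  have Gtn : ∀ p ∈ Finset.range L, nrm S (Gt p) ≤ 5 * nrm S (rs (L - p) G) := by
    intro p hp
    have hp := Finset.mem_range.1 hp
    apply nrm_le _ _ _ _ (by norm_num)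
    intro j hj
    simp only [hGt, rs]
    split_ifs with h
    · have := sg_lower L (L - p) (by omega) (by omega) j h
      rw [show L - (L - p) = p by omega] at this
      rw [norm_div, norm_mul, Complex.norm_real, Complex.norm_I, one_mul, Real.norm_eq_abs, div_le_iff₀ (by linarith)]
      have h0 := norm_nonneg (G j)
      nlinarith
    · simp
  have each : ∀ p ∈ Finset.range L, ‖frm S (fun m j => cf (dif (r p) (itr r p u)) (m - j)) (Gt p)
        (fun m => (wp r (p+1) m : ℂ) * h m)‖ ≤
        (5 * nrm S (rs (L - p) G)) * √(av (fun x => ‖dif (r p) (itr r p u) x * itr r (p+1) (tp S hc) x‖^2)) := by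
    intro p hp
    have c1 := dif_cont (r p) (itr_cont r hu p)
    have c2 := itr_cont r (tp_cont S hc) (p+1)
    have c3 := tp_cont S (Gt p)
    rw [frm_cf _ c1]
    have e : (fun m : ℤ => (starRingEnd ℂ) ((wp r (p+1) m : ℂ) * h m)) = fun m : ℤ => (wp r (p+1) m : ℂ) * hc m := by
      funext m; simp [hhc]
    rw [e, ← itr_tp]
    refine (norm_av_le _).trans ?_
    have e2 : (fun x => ‖dif (r p) (itr r p u) x * tp S (Gt p) x * (starRingEnd ℂ) (itr r (p+1) (tp S hc) x)‖) =
        fun x => ‖tp S (Gt p) x‖ * ‖dif (r p) (itr r p u) x * itr r (p+1) (tp S hc) x‖ := by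
      funext x; simp only [norm_mul, RCLike.norm_conj]; ring
    rw [e2]
    refine (av_cs _ _ (by fun_prop) (by fun_prop)).trans ?_
    rw [tp_parseval, Real.sqrt_sq (nrm_nonneg _ _)]
    gcongr
    exact Gtn p hp
  have main : ‖∑ p ∈ Finset.range L, frm S (fun m j => cf (dif (r p) (itr r p u)) (m - j)) (Gt p)
        (fun m => (wp r (p+1) m : ℂ) * h m)‖ ≤ 25 * M * nrm S G * nrm S h := by
    refine (norm_sum_le_of_le _ each).trans ?_
    refine (Real.sum_mul_le_sqrt_mul_sqrt _ _ _).trans ?_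
    have a1 : √(∑ p ∈ Finset.range L, (5 * nrm S (rs (L - p) G))^2) ≤ 5 * nrm S G := by
      apply Real.sqrt_le_iff.mpr
      refine ⟨mul_nonneg (by norm_num) (nrm_nonneg _ _), ?_⟩
      have h1 := sum_rs S G (L+1)
      rw [Finset.sum_range_succ', ← Finset.sum_range_reflect] at h1
      have h2 : ∑ p ∈ Finset.range L, (5 * nrm S (rs (L - p) G))^2 =
          25 * ∑ p ∈ Finset.range L, nrm S (rs (L - 1 - p + 1) G)^2 := by
        rw [Finset.mul_sum]
        refine Finset.sum_congr rfl fun p hp => ?_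
        have := Finset.mem_range.1 hp
        rw [show L - 1 - p + 1 = L - p by omega]; ring
      rw [h2]
      nlinarith [sq_nonneg (nrm S (rs 0 G))]
    have a2 : √(∑ p ∈ Finset.range L, √(av (fun x => ‖dif (r p) (itr r p u) x * itr r (p+1) (tp S hc) x‖^2))^2) ≤ 5 * M * nrm S h := by
      apply Real.sqrt_le_iff.mpr
      refine ⟨mul_nonneg (by positivity) (nrm_nonneg _ _), ?_⟩
      have := carleson u (tp S hc) hu (tp_cont _ _) pu (tp_per _ _) M hM r L
      rw [tp_parseval, hhc, nrm_conj] at this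
      have e : ∀ p, √(av (fun x => ‖dif (r p) (itr r p u) x * itr r (p+1) (tp S hc) x‖^2))^2 =
          av (fun x => ‖dif (r p) (itr r p u) x * itr r (p+1) (tp S hc) x‖^2) := fun p =>
        Real.sq_sqrt (av_nonneg _ fun x => sq_nonneg _)
      simp only [e]
      refine this.trans ?_
      have : 0 ≤ M^2 * nrm S h ^2 := by positivity
      nlinarith
    calc _ ≤ (5 * nrm S G) * (5 * M * nrm S h) := by
          gcongr
          exact mul_nonneg (by norm_num) (nrm_nonneg _ _)
      _ = _ := by ring
  refine (norm_add_le _ _).trans ((add_le_add hE main).trans (le_of_eq ?_))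
  ring

end KP

namespace KP

lemma near_of_vv (m n : ℤ) (h : vv (bl m) (m - n) ≠ 0) : bl m ≤ bl n + 1 ∧ bl n ≤ bl m + 1 := by
  have h1 : bl (m - n) + 4 ≤ bl m := by
    by_contra hh
    exact h (vv_zero _ _ (by omega))
  have h2 := bl_lt (m - n)
  have h3 := le_bl m
  have h4 := bl_lt m
  obtain ⟨q, hq⟩ := Nat.exists_eq_add_of_le' (show 4 ≤ bl m by omega)
  have h5 : 2 ^ bl (m - n) ≤ 2 ^ q := Nat.pow_le_pow_right (by norm_num) (by omega)
  rw [hq] at h3 h4 ⊢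
  constructor
  · have : q + 2 < bl n := by
      unfold bl
      rw [Nat.lt_size]
      rw [pow_add] at *
      omega
    omega
  · unfold bl
    rw [Nat.size_le]
    have e : 2 ^ (q + 4 + 1) = 2 ^ q * 32 := by rw [pow_add, pow_add]; ring
    rw [e]
    rw [pow_add] at *
    omega

lemma near_count (x R : ℕ) (c : ℝ) (hc : 0 ≤ c) :
    ∑ l ∈ Finset.range R, (if l ≤ x + 1 ∧ x ≤ l + 1 then c else 0) ≤ 3 * c := by
  rw [← Finset.sum_filter, Finset.sum_const, nsmul_eq_mul]
  gcongr
  have : (Finset.range R).filter (fun l => l ≤ x + 1 ∧ x ≤ l + 1) ⊆ Finset.Icc (x - 1) (x + 1) := by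
    intro l hl
    simp only [Finset.mem_filter, Finset.mem_Icc] at *
    omega
  have := Finset.card_le_card this
  rw [Nat.card_Icc] at this
  have : ((Finset.range R).filter (fun l => l ≤ x + 1 ∧ x ≤ l + 1)).card ≤ 3 := by omega
  exact_mod_cast this

lemma C1 (s : ℝ) (hs : 0 < s) : ∃ C, 0 ≤ C ∧ ∀ (a g : ℤ → ℂ) (Mg Nf : ℝ),
    OB (fun m j => g (m - j)) Mg → (∀ T, nrm T (fun n => (jb s n : ℂ) * a n) ≤ Nf) →
    ∀ (S : Finset ℤ) (h : ℤ → ℂ), (∀ j ∉ S, g j = 0) →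
    ‖∑ m ∈ S, ∑ j ∈ S, (vv (bl m) j : ℂ) * (jb s m : ℂ) * a (m - j) * g j * h m‖ ≤ C * (Nf * Mg * nrm S h) := by
  have hs2 : (0:ℝ) < 2 ^ s := by positivity
  refine ⟨3 * (√3 * (2 ^ s * 2 ^ s)) * 2 ^ s, by positivity, ?_⟩
  intro a g Mg Nf hg hN S h hS
  classical
  have hMg := hg.nonneg
  have hNf : 0 ≤ Nf := (nrm_nonneg _ _).trans (hN ∅)
  set T : Finset ℤ := S ∪ Finset.image₂ (fun m j => m - j) S S with hT
  set h1 : ℤ → ℂ := fun m => if m ∈ S then h m else 0 with hh1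
  obtain ⟨R, hR⟩ := exists_range T
  set A : ℕ → ℤ → ℂ := fun l n => if l ≤ bl n + 1 ∧ bl n ≤ l + 1 then (((2:ℝ) ^ (s * l) : ℝ) : ℂ) * a n else 0 with hA
  set H : ℕ → ℤ → ℂ := fun l m => ((jb s m / (2:ℝ) ^ (s * l) : ℝ) : ℂ) * rs l h1 m with hH
  have ST : S ⊆ T := Finset.subset_union_left
  have split : ∑ m ∈ S, ∑ j ∈ S, (vv (bl m) j : ℂ) * (jb s m : ℂ) * a (m - j) * g j * h m =
      ∑ l ∈ Finset.range R, frm T (fun m n => g (m - n) * (vv l (m - n) : ℂ)) (A l) (H l) := by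
    have e1 : ∀ m ∈ S, ∑ j ∈ S, (vv (bl m) j : ℂ) * (jb s m : ℂ) * a (m - j) * g j * h m =
        ∑ n ∈ T, (vv (bl m) (m - n) : ℂ) * (jb s m : ℂ) * a n * g (m - n) * h m := by
      intro m hm
      symm
      rw [← Finset.sum_subset (s₁ := S.image (fun j => m - j))]
      · rw [Finset.sum_image (by intro x _ y _ hxy; simpa using hxy)]
        refine Finset.sum_congr rfl fun j hj => ?_
        rw [show m - (m - j) = j by ring]
      · intro n hn
        obtain ⟨j, hj, rfl⟩ := Finset.mem_image.1 hn
        exact Finset.mem_union_right _ (Finset.mem_image₂_of_mem hm hj)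
      · intro n _ hn
        have : m - n ∉ S := fun hh => hn (Finset.mem_image.2 ⟨m - n, hh, by ring⟩)
        rw [hS _ this]; ring
    rw [Finset.sum_congr rfl e1]
    unfold frm
    rw [Finset.sum_comm (s := Finset.range R)]
    rw [← Finset.sum_subset ST]
    · refine Finset.sum_congr rfl fun m hm => ?_
      rw [Finset.sum_comm (s := Finset.range R)]
      refine Finset.sum_congr rfl fun n hn => ?_
      rw [Finset.sum_eq_single (bl m)]
      · simp only [hA, hH, hh1, rs, if_pos hm, if_true]
        have hp : (((2:ℝ) ^ (s * (bl m : ℝ)) : ℝ) : ℂ) ≠ 0 := by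
          rw [Complex.ofReal_ne_zero]; positivity
        split_ifs with hc
        · push_cast at *
          field_simp
        · have : vv (bl m) (m - n) = 0 := by
            by_contra hh
            exact hc (near_of_vv m n hh)
          rw [this]; simp
      · intro l _ hl
        simp [hH, rs, Ne.symm hl]
      · intro hh
        exact absurd (Finset.mem_range.2 (hR m (ST hm))) hh
    · intro m _ hm
      simp [hH, hh1, rs, hm]
  rw [split]
  have nA : ∑ l ∈ Finset.range R, nrm T (A l) ^ 2 ≤ (√3 * (2 ^ s * 2 ^ s) * Nf)^2 := by
    have : ∀ l n, ‖A l n‖^2 ≤ if l ≤ bl n + 1 ∧ bl n ≤ l + 1 then (2 ^ s * 2 ^ s)^2 * ‖(jb s n : ℂ) * a n‖^2 else 0 := by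
      intro l n
      simp only [hA]
      split_ifs with hc
      · rw [← mul_pow]
        refine pow_le_pow_left₀ (norm_nonneg _) ?_ 2
        rw [norm_mul, norm_mul, Complex.norm_real, Complex.norm_real, Real.norm_eq_abs, Real.norm_eq_abs,
          abs_of_pos (by positivity), abs_of_pos (jb_pos s n), ← mul_assoc]
        gcongr
        have j1 := jb_le (-s) n (bl n) rfl
        rw [abs_of_pos (jb_pos _ _), abs_neg, abs_of_pos hs] at j1
        have j2 : jb s n * jb (-s) n = 1 := by
          unfold jb
          rw [← Real.rpow_add (by positivity)]
          ring_nf; simp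
        have j3 : (2:ℝ) ^ (s * l) ≤ 2 ^ s * 2 ^ (s * (bl n : ℝ)) := by
          rw [← Real.rpow_add (by norm_num)]
          apply Real.rpow_le_rpow_of_exponent_le (by norm_num)
          have : (l:ℝ) ≤ bl n + 1 := by exact_mod_cast hc.1
          nlinarith
        have j4 : (2:ℝ) ^ (s * (bl n : ℝ)) * 2 ^ (-s * (bl n : ℝ)) = 1 := by
          rw [← Real.rpow_add (by norm_num)]; ring_nf; simp
        have j5 : (2:ℝ) ^ (s * (bl n : ℝ)) ≤ 2 ^ s * jb s n := by
          have p1 : (0:ℝ) < 2 ^ (s * (bl n : ℝ)) := by positivity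
          have p2 := jb_pos s n
          calc (2:ℝ) ^ (s * (bl n : ℝ)) = 2 ^ (s * (bl n : ℝ)) * (jb s n * jb (-s) n) := by rw [j2, mul_one]
            _ ≤ 2 ^ (s * (bl n : ℝ)) * (jb s n * (2 ^ s * 2 ^ (-s * (bl n : ℝ)))) := by gcongr
            _ = (2 ^ (s * (bl n : ℝ)) * 2 ^ (-s * (bl n : ℝ))) * (2 ^ s * jb s n) := by ring
            _ = _ := by rw [j4, one_mul]
        calc _ ≤ _ := j3
          _ ≤ 2 ^ s * (2 ^ s * jb s n) := by gcongr
          _ = _ := by ring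
      · simp
    calc ∑ l ∈ Finset.range R, nrm T (A l) ^ 2
        ≤ ∑ l ∈ Finset.range R, ∑ n ∈ T, (if l ≤ bl n + 1 ∧ bl n ≤ l + 1 then (2 ^ s * 2 ^ s)^2 * ‖(jb s n : ℂ) * a n‖^2 else 0) := by
          refine Finset.sum_le_sum fun l _ => ?_
          rw [nrm_sq]
          exact Finset.sum_le_sum fun n _ => this l n
      _ ≤ ∑ n ∈ T, 3 * ((2 ^ s * 2 ^ s)^2 * ‖(jb s n : ℂ) * a n‖^2) := by
          rw [Finset.sum_comm]
          exact Finset.sum_le_sum fun n _ => near_count _ _ _ (by positivity)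
      _ = 3 * (2 ^ s * 2 ^ s)^2 * nrm T (fun n => (jb s n : ℂ) * a n) ^ 2 := by
          rw [nrm_sq, Finset.mul_sum]; simp only [mul_assoc]
      _ ≤ 3 * (2 ^ s * 2 ^ s)^2 * Nf ^ 2 := by
          have := hN T
          have := nrm_nonneg T (fun n => (jb s n : ℂ) * a n)
          gcongr
      _ = _ := by
          have : √3 ^ 2 = (3:ℝ) := Real.sq_sqrt (by norm_num)
          linear_combination (-(2 ^ s * 2 ^ s)^2 * Nf ^ 2) * this
  have nH : ∑ l ∈ Finset.range R, nrm T (H l) ^ 2 ≤ (2 ^ s * nrm S h)^2 := by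
    have k1 : ∀ l, nrm T (H l) ≤ 2 ^ s * nrm T (rs l h1) := by
      intro l
      apply nrm_le _ _ _ _ hs2.le
      intro m _
      simp only [hH]
      rw [norm_mul, Complex.norm_real, Real.norm_eq_abs]
      by_cases hm : bl m = l
      · gcongr
        have := jb_le s m l hm
        rw [abs_of_pos hs] at this
        rw [abs_div, abs_of_pos (by positivity : (0:ℝ) < 2 ^ (s * (l:ℝ))), div_le_iff₀ (by positivity)]
        exact this
      · simp [rs, hm]
    have k2 : nrm T h1 = nrm S h := by
      unfold nrm
      congr 1
      rw [← Finset.sum_subset ST]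
      · refine Finset.sum_congr rfl fun m hm => ?_
        simp [hh1, hm]
      · intro m _ hm; simp [hh1, hm]
    calc _ ≤ ∑ l ∈ Finset.range R, (2 ^ s * nrm T (rs l h1))^2 :=
          Finset.sum_le_sum fun l _ => pow_le_pow_left₀ (nrm_nonneg _ _) (k1 l) 2
      _ = (2 ^ s)^2 * ∑ l ∈ Finset.range R, nrm T (rs l h1)^2 := by
          rw [Finset.mul_sum]; simp only [mul_pow]
      _ ≤ (2 ^ s)^2 * nrm T h1 ^2 := by gcongr; exact sum_rs _ _ _
      _ = _ := by rw [k2, mul_pow]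
  have each : ∀ l ∈ Finset.range R, ‖frm T (fun m n => g (m - n) * (vv l (m - n) : ℂ)) (A l) (H l)‖ ≤
      3 * Mg * (nrm T (A l) * nrm T (H l)) := by
    intro l _
    have := Bd_vv l _ _ hg T (A l) (H l)
    rw [mul_assoc] at this
    exact this
  refine (norm_sum_le_of_le _ each).trans ?_
  rw [← Finset.mul_sum]
  have cs := Real.sum_mul_le_sqrt_mul_sqrt (Finset.range R) (fun l => nrm T (A l)) (fun l => nrm T (H l))
  have cs2 : √(∑ l ∈ Finset.range R, nrm T (A l) ^ 2) * √(∑ l ∈ Finset.range R, nrm T (H l) ^ 2) ≤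
      (√3 * (2 ^ s * 2 ^ s) * Nf) * (2 ^ s * nrm S h) := by
    have := nrm_nonneg S h
    gcongr
    · exact Real.sqrt_le_iff.mpr ⟨by positivity, nA⟩
    · exact Real.sqrt_le_iff.mpr ⟨by positivity, nH⟩
  calc _ ≤ 3 * Mg * ((√3 * (2 ^ s * 2 ^ s) * Nf) * (2 ^ s * nrm S h)) := by
        gcongr; exact cs.trans cs2
    _ = _ := by ring

end KP

namespace KP

lemma jb_div (j : ℤ) : ‖((jb 1 j / j : ℝ) : ℂ)‖ ≤ 2 := by
  rw [Complex.norm_real, Real.norm_eq_abs, abs_div, abs_of_pos (jb_pos _ _)]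
  by_cases h : j = 0
  · subst h; simp
  have h1 : (1:ℝ) ≤ |(j:ℝ)| := by
    rw [← Int.cast_abs]; exact_mod_cast Int.one_le_abs h
  rw [div_le_iff₀ (by linarith)]
  unfold jb
  rw [← Real.sqrt_eq_rpow]
  apply Real.sqrt_le_iff.mpr
  refine ⟨by positivity, ?_⟩
  nlinarith [sq_abs (j:ℝ)]

lemma core (s : ℝ) (hs : 0 < s) : ∃ C, 0 ≤ C ∧ ∀ (u : ℝ → ℂ) (a g : ℤ → ℂ) (M Mg Nf : ℝ),
    Continuous u → Function.Periodic u (2 * π) → (∀ x, ‖u x‖ ≤ M) → (∀ n : ℤ, cf u n = I * n * a n) →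
    OB (fun m j => g (m - j)) Mg → (∀ T, nrm T (fun n => (jb s n : ℂ) * a n) ≤ Nf) →
    ∀ (S : Finset ℤ) (h : ℤ → ℂ), (∀ j ∉ S, g j = 0) →
    ‖∑ m ∈ S, ∑ j ∈ S, a (m - j) * ((jb s m : ℂ) - jb s j) * g j * h m‖ ≤
      C * (Nf * Mg + M * nrm S (fun j => (jb (s-1) j : ℂ) * g j)) * nrm S h := by
  obtain ⟨C1, hC1, h1⟩ := C1 s hs
  obtain ⟨C2, hC2, h2⟩ := Bd_Ksym s hs
  refine ⟨C1 + C2 + 450, by positivity, ?_⟩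
  intro u a g M Mg Nf hu pu hM hua hg hN S h hS
  have hM0 : 0 ≤ M := (norm_nonneg _).trans (hM 0)
  have hMg := hg.nonneg
  have hNf : 0 ≤ Nf := (nrm_nonneg _ _).trans (hN ∅)
  set G : ℤ → ℂ := fun j => (jb (s-1) j : ℂ) * g j with hG
  have b1 := h1 a g Mg Nf hg hN S h hS
  have b2 := h2 _ _ (OB_cf u hu M hM) S G h
  have b3 := para u hu pu M hM S (fun j => ((jb 1 j / j : ℝ) : ℂ) * G j) h
  have n3 : nrm S (fun j => ((jb 1 j / j : ℝ) : ℂ) * G j) ≤ 2 * nrm S G := by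
    apply nrm_le _ _ _ _ (by norm_num)
    intro j _
    rw [norm_mul]
    have := jb_div j
    gcongr
  have hn := nrm_nonneg S h
  have hnG := nrm_nonneg S G
  have b3' : ‖frm S (fun m j => if bl m + 2 ≤ bl j then cf u (m - j) else 0) (fun j => ((jb 1 j / j : ℝ) : ℂ) * G j) h‖
      ≤ 450 * M * nrm S G * nrm S h := by
    refine b3.trans ?_
    calc _ ≤ 225 * M * (2 * nrm S G) * nrm S h := by gcongr
      _ = _ := by ring
  have e : ∑ m ∈ S, ∑ j ∈ S, a (m - j) * ((jb s m : ℂ) - jb s j) * g j * h m =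
      (∑ m ∈ S, ∑ j ∈ S, (vv (bl m) j : ℂ) * (jb s m : ℂ) * a (m - j) * g j * h m) +
      -I * (frm S (fun m j => cf u (m - j) * (Ksym s m j : ℂ)) G h +
        frm S (fun m j => if bl m + 2 ≤ bl j then cf u (m - j) else 0) (fun j => ((jb 1 j / j : ℝ) : ℂ) * G j) h) := by
    unfold frm
    rw [← Finset.sum_add_distrib, Finset.mul_sum, ← Finset.sum_add_distrib]
    refine Finset.sum_congr rfl fun m _ => ?_
    rw [← Finset.sum_add_distrib, Finset.mul_sum, ← Finset.sum_add_distrib]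
    refine Finset.sum_congr rfl fun j _ => ?_
    have id := congrArg (fun x : ℝ => (x:ℂ)) (sym_identity s m j)
    have jj : (jb (1 - s) j : ℂ) * (jb (s - 1) j : ℂ) = 1 := by
      rw [← Complex.ofReal_mul, jb_add]; unfold jb; simp
    have hP : (if bl m + 2 ≤ bl j then cf u (m - j) else 0) * ((jb 1 j / j : ℝ) : ℂ) = cf u (m - j) * (Psym m j : ℂ) := by
      unfold Psym; split_ifs <;> simp
    have hP' : (if bl m + 2 ≤ bl j then cf u (m - j) else 0) * (((jb 1 j / j : ℝ) : ℂ) * G j) * h m =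
        cf u (m - j) * (Psym m j : ℂ) * G j * h m := by rw [← hP]; ring
    simp only []
    rw [hP', hua]
    push_cast at id ⊢
    simp only [hG]
    have I2 := Complex.I_mul_I
    linear_combination (-(a (m-j) * g j * h m * (((1 - vv (bl m) j) * jb s m - jb s j)))) * jj
      - (a (m - j) * g j * h m * jb (s-1) j) * id
      + (((m - j) * a (m - j) * g j * h m * jb (s-1) j * (Ksym s m j + Psym m j))) * I2
  rw [e]
  refine (norm_add_le _ _).trans ?_
  rw [norm_mul, norm_neg, Complex.norm_I, one_mul]
  have b4 := norm_add_le (frm S (fun m j => cf u (m - j) * (Ksym s m j : ℂ)) G h)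
    (frm S (fun m j => if bl m + 2 ≤ bl j then cf u (m - j) else 0) (fun j => ((jb 1 j / j : ℝ) : ℂ) * G j) h)
  have p1 : 0 ≤ Nf * Mg * nrm S h := by positivity
  have p2 : 0 ≤ M * nrm S G * nrm S h := by positivity
  nlinarith [mul_nonneg hC1 p2, mul_nonneg hC2 p1]

end KP

namespace KP

lemma cf_deriv (f : ℝ → ℂ) (hf : ContDiff ℝ 1 f) (hp : Function.Periodic f (2 * π)) (n : ℤ) :
    cf (deriv f) n = I * n * cf f n := by
  have hd : ∀ x, HasDerivAt f (deriv f x) x := fun x =>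
    (hf.differentiable one_ne_zero x).hasDerivAt
  have he : ∀ x : ℝ, HasDerivAt (ee (-n)) (-(I * n) * ee (-n) x) x := by
    intro x
    have h1 : HasDerivAt (fun y : ℝ => ((-n : ℤ) : ℂ) * (y : ℂ) * I) (((-n : ℤ) : ℂ) * 1 * I) x :=
      ((Complex.ofRealCLM.hasDerivAt (x := x)).const_mul _).mul_const _
    have h2 := h1.cexp
    unfold ee
    convert h2 using 1
    push_cast; ring
  have hc : Continuous (deriv f) := hf.continuous_deriv le_rfl
  have e1 := ee_cont (-n)
  have cf' := hf.continuous
  have key := intervalIntegral.integral_eq_sub_of_hasDerivAt (a := 0) (b := 2 * π)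
    (f := fun x => ee (-n) x * f x) (f' := fun x => -(I * n) * ee (-n) x * f x + ee (-n) x * deriv f x)
    (fun x _ => (he x).mul (hd x)) (by apply Continuous.intervalIntegrable; fun_prop)
  have h0 : f (2 * π) = f 0 := by simpa using hp 0
  rw [h0, ee_two_pi, show ee (-n) 0 = 1 by simp [ee], sub_self] at key
  have : av (fun x => -(I * n) * (ee (-n) x * f x) + ee (-n) x * deriv f x) = 0 := by
    unfold av
    simp only [mul_assoc] at key ⊢
    rw [key, smul_zero]
  rw [av_add _ _ (by fun_prop) (by fun_prop), av_mul_left] at this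
  unfold cf
  linear_combination this

lemma bessel (a : ℤ → ℂ) (M : ℝ) (h : OB (fun m j => a (m - j)) M) (T : Finset ℤ) :
    nrm T a ≤ M := by
  classical
  have hM := h.nonneg
  set S := insert 0 T
  have h1 := h S (fun j => if j = 0 then 1 else 0) (fun m => (starRingEnd ℂ) (a m))
  have e : frm S (fun m j => a (m - j)) (fun j => if j = 0 then 1 else 0)
      (fun m => (starRingEnd ℂ) (a m)) = ((nrm S a ^ 2 : ℝ) : ℂ) := by
    rw [nrm_sq]
    unfold frm
    push_cast
    refine Finset.sum_congr rfl fun m _ => ?_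
    rw [Finset.sum_eq_single 0]
    · simp [Complex.mul_conj, Complex.normSq_eq_norm_sq]
    · intro b _ hb; simp [hb]
    · intro h; simp [S] at h
  have e2 : nrm S (fun j => if j = 0 then (1:ℂ) else 0) = 1 := by
    unfold nrm
    rw [Finset.sum_eq_single 0]
    · simp
    · intro b _ hb; simp [hb]
    · intro h; simp [S] at h
  rw [e, e2, nrm_conj, Complex.norm_real, Real.norm_of_nonneg (sq_nonneg _)] at h1
  have h2 : nrm S a ≤ M := by
    by_contra hcon
    push Not at hcon
    nlinarith [nrm_nonneg S a]
  refine le_trans ?_ h2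
  unfold nrm
  apply Real.sqrt_le_sqrt
  exact Finset.sum_le_sum_of_subset_of_nonneg (Finset.subset_insert _ _) fun _ _ _ => by positivity

lemma summable_of_nrm (a : ℤ → ℂ) (M : ℝ) (h : ∀ T, nrm T a ≤ M) :
    Summable (fun n => ‖a n‖ ^ 2) := by
  apply summable_of_sum_le (c := M ^ 2) (fun _ => by positivity)
  intro u
  rw [← nrm_sq]
  exact pow_le_pow_left₀ (nrm_nonneg _ _) (h u) 2

lemma bridge (h : (0:ℝ) < 2 * π) (f : ℝ → ℂ) (n : ℤ) : fourierCoeffOn h f n = cf f n := by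
  rw [fourierCoeffOn_eq_integral]
  unfold cf av
  simp only [sub_zero, one_div]
  congr 1
  apply intervalIntegral.integral_congr
  intro x _
  simp only [smul_eq_mul]
  congr 1
  rw [fourier_coe_apply]
  unfold ee
  congr 1
  push_cast
  have : (π : ℂ) ≠ 0 := by exact_mod_cast Real.pi_ne_zero
  simp only [sub_zero]
  field_simp

lemma summable_cf (f : ℝ → ℂ) (hf : ContDiff ℝ 1 f) (hp : Function.Periodic f (2 * π)) (M : ℝ)
    (hM : ∀ x, ‖deriv f x‖ ≤ M) :
    Summable (fun n => ‖cf f n‖) ∧ Summable (fun n : ℤ => (1 + (n:ℝ)^2) * ‖cf f n‖^2) := by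
  have hb := summable_of_nrm _ M
    (bessel _ M (OB_cf (deriv f) (hf.continuous_deriv le_rfl) M hM))
  have hn : ∀ n : ℤ, ‖cf (deriv f) n‖ ^ 2 = (n:ℝ)^2 * ‖cf f n‖^2 := by
    intro n
    rw [cf_deriv f hf hp, norm_mul, norm_mul, mul_pow, mul_pow]
    simp
  simp only [hn] at hb
  have h2 : Summable (fun n : ℤ => 1 / ((n:ℝ)^2)) := by
    have := (Real.summable_one_div_int_pow (p := 2)).mpr (by norm_num)
    simpa using this
  have hs0 : Summable (fun n : ℤ => if n = 0 then ‖cf f 0‖ + ‖cf f 0‖^2 else 0) :=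
    summable_of_ne_finset_zero (s := {0}) (by intro b hb; simp at hb; simp [hb])
  have key : ∀ n : ℤ, n ≠ 0 → (1:ℝ) ≤ (n:ℝ)^2 := by
    intro n hn
    have : (1:ℤ) ≤ n^2 := by have := sq_pos_of_ne_zero hn; omega
    exact_mod_cast this
  constructor
  · refine Summable.of_nonneg_of_le (fun _ => norm_nonneg _) ?_ ((h2.add hb).add hs0)
    intro n
    by_cases h : n = 0
    · subst h; simp
    · simp only [h, if_false, add_zero]
      have hn0 : (n:ℝ) ≠ 0 := by exact_mod_cast h
      have e : 1 / (n:ℝ)^2 + (n:ℝ)^2 * ‖cf f n‖^2 - ‖cf f n‖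
          = (1/(n:ℝ) - n * ‖cf f n‖)^2 + ‖cf f n‖ := by
        field_simp; ring
      nlinarith [sq_nonneg (1/(n:ℝ) - n * ‖cf f n‖), norm_nonneg (cf f n)]
  · refine Summable.of_nonneg_of_le (fun _ => by positivity) ?_ ((hb.mul_left 2).add hs0)
    intro n
    by_cases h : n = 0
    · subst h; simp
    · simp only [h, if_false, add_zero]
      nlinarith [key n h, sq_nonneg ‖cf f n‖]

lemma pointwise (f : ℝ → ℂ) (hf : Continuous f) (hp : Function.Periodic f (2 * π))
    (hs : Summable (fun n => ‖cf f n‖)) (x : ℝ) : HasSum (fun n => cf f n * ee n x) (f x) := by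
  have h2 : (0:ℝ) < 2 * π := by positivity
  have : Fact ((0:ℝ) < 2 * π) := ⟨h2⟩
  let F : C(AddCircle (2 * π), ℂ) := ⟨hp.lift, continuous_coinduced_dom.mpr hf⟩
  have hF : ∀ y : ℝ, F (y : AddCircle (2 * π)) = f y := fun y => hp.lift_coe y
  have hc : ∀ n, fourierCoeff F n = cf f n := by
    intro n
    rw [fourierCoeff_eq_intervalIntegral _ n 0]
    unfold cf av
    simp only [zero_add, one_div]
    congr 1
    apply intervalIntegral.integral_congr
    intro y _
    simp only [smul_eq_mul, hF]
    congr 1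
    rw [fourier_coe_apply]
    unfold ee
    congr 1
    push_cast
    have : (π : ℂ) ≠ 0 := by exact_mod_cast Real.pi_ne_zero
    field_simp
  have := has_pointwise_sum_fourier_series_of_summable (f := F)
    (by rw [show fourierCoeff F = cf f from funext hc]; exact hs.of_norm) (x : AddCircle (2 * π))
  rw [hF] at this
  convert this using 2 with n
  rw [hc, smul_eq_mul, fourier_coe_apply]
  unfold ee
  congr 2
  push_cast
  have : (π : ℂ) ≠ 0 := by exact_mod_cast Real.pi_ne_zero
  field_simp

lemma conv (f g : ℝ → ℂ) (hf : Continuous f) (hp : Function.Periodic f (2 * π))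
    (hs : Summable (fun n => ‖cf f n‖)) (hg : Continuous g) (Mg : ℝ) (hMg : ∀ x, ‖g x‖ ≤ Mg) (m : ℤ) :
    HasSum (fun j => cf f (m - j) * cf g j) (cf (fun x => f x * g x) m) := by
  have h := intervalIntegral.hasSum_integral_of_dominated_convergence (μ := MeasureTheory.volume)
    (a := 0) (b := 2 * π)
    (F := fun (n : ℤ) x => ee (-m) x * (cf f n * ee n x * g x))
    (f := fun x => ee (-m) x * (f x * g x))
    (fun n _ => ‖cf f n‖ * Mg)
    (fun n => by
      have e1 := ee_cont n
      have e2 := ee_cont (-m)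
      exact Continuous.aestronglyMeasurable (by fun_prop))
    (fun n => Filter.Eventually.of_forall fun x _ => by
      rw [norm_mul, norm_mul, norm_mul, ee_norm, ee_norm, one_mul, mul_one]
      gcongr
      exact hMg x)
    (Filter.Eventually.of_forall fun x _ => hs.mul_right _)
    (by simp)
    (Filter.Eventually.of_forall fun x _ =>
      ((pointwise f hf hp hs x).mul_right (g x)).mul_left _)
  have h' := h.const_smul ((2 * π)⁻¹ : ℝ)
  have e : ∀ n : ℤ, (2 * π)⁻¹ • ∫ x in (0:ℝ)..(2 * π), ee (-m) x * (cf f n * ee n x * g x)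
      = cf f n * cf g (m - n) := by
    intro n
    have : (fun x => ee (-m) x * (cf f n * ee n x * g x)) = fun x => cf f n * (ee (-(m-n)) x * g x) := by
      funext x
      have := ee_mul (-m) n x
      rw [show -(m-n) = -m + n by ring, ← this]; ring
    rw [this]
    exact av_mul_left _ _
  have h3 : HasSum (fun n => cf f n * cf g (m - n)) (cf (fun x => f x * g x) m) := by
    have e3 : (fun n => cf f n * cf g (m - n)) = _ := funext fun n => (e n).symm
    rw [e3]
    exact h'
  have := (Equiv.subLeft m).hasSum_iff.mpr h3
  convert this using 2 with j
  simp

end KP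

namespace KP

lemma fej_tendsto (j : ℤ) : Filter.Tendsto (fun N : ℕ => fej N j) Filter.atTop (nhds 1) := by
  have h : Filter.Tendsto (fun N : ℕ => |(j:ℝ)| / (N:ℝ)) Filter.atTop (nhds 0) :=
    tendsto_const_div_atTop_nhds_zero_nat _
  have h2 : Filter.Tendsto (fun N : ℕ => max 0 (1 - |(j:ℝ)| / (N:ℝ))) Filter.atTop
      (nhds (max 0 (1 - 0))) :=
    tendsto_const_nhds.max (tendsto_const_nhds.sub h)
  simpa [fej] using h2

lemma fej_off (N : ℕ) (hN : 1 ≤ N) (j : ℤ) (hj : j ∉ Finset.Icc (-(N:ℤ)) N) : fej N j = 0 := by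
  have hN' : (0:ℝ) < N := by exact_mod_cast hN
  have h1 : (N:ℤ) ≤ |j| := by
    by_contra hcon
    push Not at hcon
    rw [abs_lt] at hcon
    exact hj (Finset.mem_Icc.mpr ⟨hcon.1.le, hcon.2.le⟩)
  have h2 : (N:ℝ) ≤ |(j:ℝ)| := by exact_mod_cast h1
  unfold fej
  apply max_eq_left
  have : 1 ≤ |(j:ℝ)| / N := by rw [le_div_iff₀ hN']; linarith
  linarith

lemma lim_bound (k : ℤ → ℤ → ℂ) (c : ℤ → ℂ) (K : ℝ) (hc : ∀ m, c m = ∑' j, k m j)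
    (hk : ∀ m, Summable (fun j => ‖k m j‖))
    (hb : ∀ N : ℕ, 1 ≤ N → ∀ (S : Finset ℤ) (h : ℤ → ℂ), (∀ j ∉ S, fej N j = 0) →
      ‖∑ m ∈ S, ∑ j ∈ S, (fej N j : ℂ) * k m j * h m‖ ≤ K * nrm S h) (F : Finset ℤ) :
    nrm F c ≤ K := by
  classical
  set d : ℕ → ℤ → ℂ := fun N m => ∑' j, (fej N j : ℂ) * k m j
  have hd : ∀ m, Filter.Tendsto (fun N => d N m) Filter.atTop (nhds (c m)) := by
    intro m
    rw [hc m]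
    apply tendsto_tsum_of_dominated_convergence (hk m)
    · intro j
      have := (Complex.continuous_ofReal.tendsto 1).comp (fej_tendsto j)
      simpa using this.mul_const (k m j)
    · refine Filter.Eventually.of_forall fun N j => ?_
      rw [norm_mul, Complex.norm_real, Real.norm_of_nonneg (fej_nonneg N j)]
      exact mul_le_of_le_one_left (norm_nonneg _) (fej_le N j)
  have hN : ∀ N : ℕ, 1 ≤ N → ‖∑ m ∈ F, d N m * (starRingEnd ℂ) (c m)‖ ≤ K * nrm F c := by
    intro N hN
    have := hb N hN (Finset.Icc (-(N:ℤ)) N ∪ F) (fun m => if m ∈ F then (starRingEnd ℂ) (c m) else 0)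
      (fun j hj => fej_off N hN j (fun h => hj (Finset.mem_union_left _ h)))
    have e1 : nrm (Finset.Icc (-(N:ℤ)) N ∪ F) (fun m => if m ∈ F then (starRingEnd ℂ) (c m) else 0)
        = nrm F c := by
      unfold nrm
      congr 1
      rw [← Finset.sum_subset (Finset.subset_union_right (s₁ := Finset.Icc (-(N:ℤ)) N))]
      · exact Finset.sum_congr rfl fun m hm => by simp [hm]
      · intro m _ hm; simp [hm]
    have e2 : ∑ m ∈ Finset.Icc (-(N:ℤ)) N ∪ F, ∑ j ∈ Finset.Icc (-(N:ℤ)) N ∪ F,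
        (fej N j : ℂ) * k m j * (if m ∈ F then (starRingEnd ℂ) (c m) else 0)
        = ∑ m ∈ F, d N m * (starRingEnd ℂ) (c m) := by
      rw [← Finset.sum_subset (Finset.subset_union_right (s₁ := Finset.Icc (-(N:ℤ)) N))]
      · refine Finset.sum_congr rfl fun m hm => ?_
        rw [← Finset.sum_mul, if_pos hm]
        congr 1
        symm
        apply tsum_eq_sum
        intro j hj
        rw [fej_off N hN j (fun h => hj (Finset.mem_union_left _ h))]
        simp
      · intro m _ hm; simp [hm]
    rw [e1, e2] at this
    exact this
  have ht : Filter.Tendsto (fun N => ‖∑ m ∈ F, d N m * (starRingEnd ℂ) (c m)‖) Filter.atTop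
      (nhds ‖∑ m ∈ F, c m * (starRingEnd ℂ) (c m)‖) :=
    (tendsto_finsetSum _ fun m _ => (hd m).mul_const _).norm
  have hl := le_of_tendsto ht (Filter.eventually_atTop.mpr ⟨1, hN⟩)
  have e : ∑ m ∈ F, c m * (starRingEnd ℂ) (c m) = ((nrm F c ^ 2 : ℝ) : ℂ) := by
    rw [nrm_sq]
    push_cast
    exact Finset.sum_congr rfl fun m _ => by simp [Complex.mul_conj, Complex.normSq_eq_norm_sq]
  rw [e, Complex.norm_real, Real.norm_of_nonneg (sq_nonneg _)] at hl
  have h0 := nrm_nonneg F c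
  rcases h0.eq_or_lt with h | h
  · have h1 := hb 1 le_rfl (Finset.Icc (-1) 1) (fun m => if m = 0 then 1 else 0)
      (fun j hj => fej_off 1 le_rfl j (by simpa using hj))
    have e2 : nrm (Finset.Icc (-1) 1) (fun j => if j = 0 then (1:ℂ) else 0) = 1 := by
      unfold nrm
      rw [Finset.sum_eq_single 0]
      · simp
      · intro b _ hb; simp [hb]
      · intro h; simp at h
    rw [e2, mul_one] at h1
    rw [← h]
    exact (norm_nonneg _).trans h1
  · nlinarith

lemma jb_sq (σ : ℝ) (j : ℤ) : jb σ j ^ 2 = ((1:ℝ) + (j:ℝ)^2) ^ σ := by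
  rw [pow_two, jb_add]
  unfold jb
  congr 1; ring

lemma summ_k (s : ℝ) (hs : 0 < s) (a b : ℤ → ℂ)
    (ha : Summable (fun n : ℤ => (1 + (n:ℝ)^2) * ‖a n‖^2))
    (hb : Summable (fun n : ℤ => ((1:ℝ) + (n:ℝ)^2) ^ (s-1) * ‖b n‖^2)) (m : ℤ) :
    Summable (fun j => a (m - j) * (jb s j : ℂ) * b j) ∧
    Summable (fun j => ‖a (m-j) * ((jb s m : ℂ) - jb s j) * b j‖) := by
  have ha' : Summable (fun j : ℤ => (1 + ((m - j : ℤ):ℝ)^2) * ‖a (m - j)‖^2) :=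
    (Equiv.subLeft m).summable_iff.mpr ha
  have h1 : Summable (fun j => ‖a (m - j)‖ * jb s j * ‖b j‖) := by
    refine Summable.of_nonneg_of_le (fun j => by have := jb_pos s j; positivity) ?_
      ((ha'.mul_left (1 + (m:ℝ)^2)).add hb)
    intro j
    have e : jb s j = jb 1 j * jb (s-1) j := by rw [jb_add]; congr 1; ring
    have e1 : jb 1 j ^ 2 = 1 + (j:ℝ)^2 := by rw [jb_sq, Real.rpow_one]
    have e2 := jb_sq (s-1) j
    rw [← e2, e]
    have h3 : 1 + (j:ℝ)^2 ≤ 2 * ((1 + (m:ℝ)^2) * (1 + ((m - j : ℤ):ℝ)^2)) := by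
      push_cast
      nlinarith [sq_nonneg ((j:ℝ) - 2 * m), sq_nonneg ((m:ℝ) * (m - j)), sq_nonneg ((m:ℝ) ), sq_nonneg ((m:ℝ)-j)]
    have h4 : 0 ≤ (jb 1 j * ‖a (m - j)‖ - jb (s-1) j * ‖b j‖)^2 := sq_nonneg _
    have h5 : (jb 1 j * ‖a (m - j)‖)^2 ≤ 2 * ((1 + (m:ℝ)^2) * ((1 + ((m - j : ℤ):ℝ)^2) * ‖a (m - j)‖^2)) := by
      rw [mul_pow, e1]
      nlinarith [mul_le_mul_of_nonneg_right h3 (sq_nonneg ‖a (m - j)‖)]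
    nlinarith [sq_nonneg (jb (s-1) j * ‖b j‖)]
  have n1 : ∀ j, ‖a (m - j) * (jb s j : ℂ) * b j‖ = ‖a (m - j)‖ * jb s j * ‖b j‖ := by
    intro j
    rw [norm_mul, norm_mul, Complex.norm_real, Real.norm_of_nonneg (jb_pos s j).le]
  refine ⟨Summable.of_norm (by simpa only [n1] using h1), ?_⟩
  refine Summable.of_nonneg_of_le (fun j => norm_nonneg _) ?_ (h1.mul_left (jb s m + 1))
  intro j
  rw [norm_mul, norm_mul]
  have p : 1 ≤ jb s j := by
    unfold jb
    exact Real.one_le_rpow (by nlinarith [sq_nonneg (j:ℝ)]) (by positivity)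
  have pm := jb_pos s m
  have q : ‖(jb s m : ℂ) - jb s j‖ ≤ (jb s m + 1) * jb s j := by
    refine (norm_sub_le _ _).trans ?_
    rw [Complex.norm_real, Complex.norm_real, Real.norm_of_nonneg (jb_pos s m).le,
      Real.norm_of_nonneg (jb_pos s j).le]
    nlinarith
  calc ‖a (m-j)‖ * ‖(jb s m : ℂ) - jb s j‖ * ‖b j‖ ≤ ‖a (m-j)‖ * ((jb s m + 1) * jb s j) * ‖b j‖ := by
        gcongr
    _ = _ := by ring

lemma nrm_le_sqrt (σ : ℝ) (a : ℤ → ℂ)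
    (ha : Summable (fun n : ℤ => ((1:ℝ) + (n:ℝ)^2) ^ σ * ‖a n‖^2)) (T : Finset ℤ) :
    nrm T (fun n => (jb σ n : ℂ) * a n) ≤ √(∑' n : ℤ, ((1:ℝ) + (n:ℝ)^2) ^ σ * ‖a n‖^2) := by
  unfold nrm
  apply Real.sqrt_le_sqrt
  refine le_trans (le_of_eq ?_) (ha.sum_le_tsum T fun n _ => by positivity)
  refine Finset.sum_congr rfl fun n _ => ?_
  rw [norm_mul, Complex.norm_real, Real.norm_of_nonneg (jb_pos σ n).le, mul_pow, jb_sq]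

lemma le_sup (g : ℝ → ℂ) (hg : Continuous g) (hp : Function.Periodic g (2 * π)) (x : ℝ) :
    ‖g x‖ ≤ ⨆ x : ℝ, ‖g x‖ := by
  have hb := hp.isBounded_of_continuous (by positivity) hg
  obtain ⟨R, hR⟩ := hb.exists_norm_le
  exact le_ciSup (f := fun x => ‖g x‖) ⟨R, by rintro _ ⟨y, rfl⟩; exact hR _ ⟨y, rfl⟩⟩ x

lemma final (s : ℝ) (hs : 0 < s) : ∃ C : ℝ, 0 < C ∧ ∀ f g : ℝ → ℂ,
      ContDiff ℝ 1 f → Function.Periodic f (2 * π) →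
      Continuous g → Function.Periodic g (2 * π) →
      Summable (fun m : ℤ => ((1:ℝ) + (m:ℝ)^2) ^ s * ‖cf f m‖^2) →
      Summable (fun m : ℤ => ((1:ℝ) + (m:ℝ)^2) ^ (s - 1) * ‖cf g m‖^2) →
      ∀ F : Finset ℤ,
      nrm F (fun m => (jb s m : ℂ) * cf (fun x => f x * g x) m
        - ∑' j : ℤ, cf f (m - j) * (jb s j : ℂ) * cf g j) ≤
        C * (√(∑' m : ℤ, ((1:ℝ) + (m:ℝ)^2) ^ s * ‖cf f m‖^2) * (⨆ x : ℝ, ‖g x‖)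
          + (⨆ x : ℝ, ‖deriv f x‖) *
            √(∑' m : ℤ, ((1:ℝ) + (m:ℝ)^2) ^ (s - 1) * ‖cf g m‖^2)) := by
  obtain ⟨C, hC, hcore⟩ := core s hs
  refine ⟨C + 1, by linarith, ?_⟩
  intro f g hf hfp hg hgp hsf hsg F
  have hd : Continuous (deriv f) := hf.continuous_deriv le_rfl
  have hdp : Function.Periodic (deriv f) (2 * π) := by
    intro x
    rw [← deriv_comp_add_const]
    congr 1
    exact funext hfp
  have hM := le_sup _ hd hdp
  have hMg := le_sup _ hg hgp
  have hM0 := (norm_nonneg _).trans (hM 0)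
  have hMg0 := (norm_nonneg _).trans (hMg 0)
  set M := ⨆ x : ℝ, ‖deriv f x‖
  set Mg := ⨆ x : ℝ, ‖g x‖
  set Nf := √(∑' m : ℤ, ((1:ℝ) + (m:ℝ)^2) ^ s * ‖cf f m‖^2) with hNf
  set Ng := √(∑' m : ℤ, ((1:ℝ) + (m:ℝ)^2) ^ (s-1) * ‖cf g m‖^2) with hNg
  have hNf0 : 0 ≤ Nf := Real.sqrt_nonneg _
  have hNg0 : 0 ≤ Ng := Real.sqrt_nonneg _
  obtain ⟨sa, sa2⟩ := summable_cf f hf hfp M hM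
  have main : nrm F (fun m => (jb s m : ℂ) * cf (fun x => f x * g x) m
        - ∑' j : ℤ, cf f (m - j) * (jb s j : ℂ) * cf g j) ≤ C * (Nf * Mg + M * Ng) := by
    apply lim_bound (fun m j => cf f (m-j) * ((jb s m : ℂ) - jb s j) * cf g j)
    · intro m
      have h1 := (conv f g hf.continuous hfp sa hg Mg hMg m).mul_left (jb s m : ℂ)
      have h2 := (summ_k s hs _ _ sa2 hsg m).1.hasSum
      rw [← (h1.sub h2).tsum_eq]
      congr 1
      funext j; ring
    · intro m
      exact (summ_k s hs _ _ sa2 hsg m).2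
    · intro N hN S h hS
      have hob := Bd_fej N hN _ Mg (OB_cf g hg Mg hMg)
      rw [one_mul] at hob
      have := hcore (deriv f) (cf f) (fun j => cf g j * fej N j) M Mg Nf hd hdp hM
        (cf_deriv f hf hfp) hob (nrm_le_sqrt s _ hsf) S h (fun j hj => by simp [hS j hj])
      have e : ∑ m ∈ S, ∑ j ∈ S, (fej N j : ℂ) * (cf f (m-j) * ((jb s m : ℂ) - jb s j) * cf g j) * h m
          = ∑ m ∈ S, ∑ j ∈ S, cf f (m-j) * ((jb s m : ℂ) - jb s j) * (cf g j * fej N j) * h m :=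
        Finset.sum_congr rfl fun m _ => Finset.sum_congr rfl fun j _ => by ring
      rw [e]
      refine this.trans ?_
      have hn : nrm S (fun j => (jb (s-1) j : ℂ) * (cf g j * fej N j)) ≤ Ng := by
        refine le_trans ?_ (nrm_le_sqrt (s-1) _ hsg S)
        refine (nrm_le S _ (fun j => (jb (s-1) j : ℂ) * cf g j) 1 zero_le_one ?_).trans (by rw [one_mul])
        intro j _
        rw [← mul_assoc, norm_mul, one_mul, Complex.norm_real, Real.norm_of_nonneg (fej_nonneg N j)]
        exact mul_le_of_le_one_right (norm_nonneg _) (fej_le N j)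
      have := nrm_nonneg S h
      gcongr
  refine main.trans ?_
  gcongr
  linarith

end KP

theorem kato_ponce_commutator (s : ℝ) (hs : 0 < s) :
    ∃ C : ℝ, 0 < C ∧ ∀ f g : ℝ → ℂ,
      ContDiff ℝ 1 f → Function.Periodic f (2 * π) →
      Continuous g → Function.Periodic g (2 * π) →
      Summable (fun m : ℤ =>
        ((1:ℝ) + (m:ℝ)^2) ^ s * ‖fourierCoeffOn twoPiPos f m‖^2) →
      Summable (fun m : ℤ =>
        ((1:ℝ) + (m:ℝ)^2) ^ (s - 1) * ‖fourierCoeffOn twoPiPos g m‖^2) →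
      seqHs 0 (commCoeff s f g) ≤
        C * (seqHs s (fun m => fourierCoeffOn twoPiPos f m) * (⨆ x : ℝ, ‖g x‖)
          + (⨆ x : ℝ, ‖deriv f x‖) *
            seqHs (s - 1) (fun m => fourierCoeffOn twoPiPos g m)) := by
  obtain ⟨C, hC, h⟩ := KP.final s hs
  refine ⟨C, hC, ?_⟩
  intro f g hf hfp hg hgp hsf hsg
  simp only [KP.bridge] at hsf hsg ⊢
  have h1 := h f g hf hfp hg hgp hsf hsg
  have h0 := (KP.nrm_nonneg ∅ _).trans (h1 ∅)
  unfold seqHs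
  refine Real.sqrt_le_iff.mpr ⟨h0, ?_⟩
  refine Real.tsum_le_of_sum_le (fun m => by positivity) fun F => ?_
  refine le_trans (le_of_eq ?_) (pow_le_pow_left₀ (KP.nrm_nonneg F _) (h1 F) 2)
  rw [KP.nrm_sq]
  refine Finset.sum_congr rfl fun m _ => ?_
  rw [Real.rpow_zero, one_mul]
  unfold commCoeff
  simp only [KP.bridge]
  rfl
end

section
/- Let s > 3/2, k ≥ 2, δ ∈ (1/2, min{s-1, 3/2}), l ∈ {-1,1} if k odd, l ∈ {0,1} if k even, and u^{l,n}(t,x) = l n^{-1/k} + n^{-s} cos(nx - lt). With F₁, F₂, F₃ as in the generalized Camassa–Holm equation, for n ≫ 1 one has ‖F₁(u^{l,n})‖_{H^δ} ≤ C n^{-s+δ-1}, ‖F₂(u^{l,n})‖_{H^δ} ≤ C n^{-2s+δ+1+1/k}, and ‖F₃(u^{l,n})‖_{H^δ} ≤ C n^{-3s+δ+2+2/k}, with C independent of n; consequently ‖F(u^{l,n})‖_{H^δ} ≤ C n^{-r_s} where r_s = 2s - δ - (k+1)/k if 3/2 < s ≤ (2k+1)/k and r_s = s - δ + 1 if s >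 (2k+1)/k, and r_s > 0. -/
open Real Complex

/-- Fourier coefficients of `F₁(u) = (1-∂²ₓₓ)⁻¹∂ₓ(u^{k+1})`. -/
noncomputable def F1coeff (k : ℕ) (u : ℝ → ℂ) (m : ℤ) : ℂ :=
  Complex.I * (m : ℂ) / (1 + (m : ℂ)^2) *
    fourierCoeffOn twoPiPos (fun x => (u x) ^ (k + 1)) m

/-- Fourier coefficients of `F₂(u) = ((2k-1)/2)(1-∂²ₓₓ)⁻¹∂ₓ(u^{k-1}u_x²)`. -/
noncomputable def F2coeff (k : ℕ) (u : ℝ → ℂ) (m : ℤ) : ℂ :=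
  (2 * (k : ℂ) - 1) / 2 * (Complex.I * (m : ℂ) / (1 + (m : ℂ)^2)) *
    fourierCoeffOn twoPiPos (fun x => (u x) ^ (k - 1) * (deriv u x)^2) m

/-- Fourier coefficients of `F₃(u) = ((k-1)/2)(1-∂²ₓₓ)⁻¹(u^{k-2}u_x³)`. -/
noncomputable def F3coeff (k : ℕ) (u : ℝ → ℂ) (m : ℤ) : ℂ :=
  ((k : ℂ) - 1) / 2 * (1 / (1 + (m : ℂ)^2)) *
    fourierCoeffOn twoPiPos (fun x => (u x) ^ (k - 2) * (deriv u x)^3) m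

/-- The approximate solution `u^{l,n}(t,x) = l n^{-1/k} + n^{-s} cos(nx - lt)`,
complexified. -/
noncomputable def approxSolC (s l : ℝ) (k n : ℕ) (t x : ℝ) : ℂ :=
  ((l * (n : ℝ) ^ (-(1:ℝ)/(k:ℝ)) + (n : ℝ) ^ (-s) * Real.cos (n * x - l * t) : ℝ) : ℂ)

/-- The decay rate `r_s`. -/
noncomputable def rs (s δ : ℝ) (k : ℕ) : ℝ :=
  if s ≤ (2*(k:ℝ) + 1)/(k:ℝ) then 2*s - δ - ((k:ℝ) + 1)/(k:ℝ) else s - δ + 1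

lemma fc_eq (f : ℝ → ℂ) (m : ℤ) : fourierCoeffOn twoPiPos f m =
    (1 / (2 * π)) • ∫ x in (0:ℝ)..(2 * π), Complex.exp (-(m * x * Complex.I)) * f x := by
  rw [fourierCoeffOn_eq_integral]
  rw [sub_zero]
  congr 1
  apply intervalIntegral.integral_congr
  intro x _
  simp only [smul_eq_mul]
  rw [fourier_coe_apply]
  congr 2
  have : (π : ℂ) ≠ 0 := by exact_mod_cast Real.pi_ne_zero
  push_cast
  field_simp

lemma fc_norm_le (f : ℝ → ℂ) (M : ℝ) (h : ∀ x, ‖f x‖ ≤ M) (m : ℤ) :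
    ‖fourierCoeffOn twoPiPos f m‖ ≤ M := by
  have hp := twoPiPos
  rw [fc_eq, norm_smul]
  have h1 : ‖∫ x in (0:ℝ)..(2 * π), Complex.exp (-(m * x * Complex.I)) * f x‖
      ≤ M * |2 * π - 0| := by
    apply intervalIntegral.norm_integral_le_of_norm_le_const
    intro x _
    rw [norm_mul]
    have : ‖Complex.exp (-(m * x * Complex.I))‖ = 1 := by
      have := Complex.norm_exp_ofReal_mul_I (-(m * x))
      rw [← this]; congr 2; push_cast; ring
    rw [this, one_mul]; exact h x
  rw [sub_zero, abs_of_pos hp] at h1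
  rw [Real.norm_of_nonneg (by positivity)]
  calc 1 / (2 * π) * _ ≤ 1 / (2 * π) * (M * (2 * π)) := by gcongr
    _ = M := by field_simp

lemma exp_int_integral (j : ℤ) (hj : j ≠ 0) :
    ∫ x in (0:ℝ)..(2 * π), Complex.exp ((j * Complex.I) * x) = 0 := by
  rw [integral_exp_mul_complex (by simp [hj])]
  have : Complex.exp (j * Complex.I * ((2 * π : ℝ) : ℂ)) = 1 := by
    rw [Complex.exp_eq_one_iff]
    exact ⟨j, by push_cast; ring⟩
  rw [this]; simp

/-- Trigonometric polynomials of degree at most `d` in `n x`. -/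
def TrigP (n d : ℕ) (f : ℝ → ℂ) : Prop :=
  ∃ p : Polynomial ℂ, p.natDegree ≤ 2 * d ∧
    ∀ x : ℝ, f x = Complex.exp (-(d * n * x * Complex.I)) * p.eval (Complex.exp (n * x * Complex.I))

lemma TrigP.mul {n d e : ℕ} {f g : ℝ → ℂ} (hf : TrigP n d f) (hg : TrigP n e g) :
    TrigP n (d + e) (fun x => f x * g x) := by
  obtain ⟨p, hp, hf⟩ := hf
  obtain ⟨q, hq, hg⟩ := hg
  refine ⟨p * q, Polynomial.natDegree_mul_le.trans (by omega), fun x => ?_⟩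
  simp only [hf, hg, Polynomial.eval_mul]
  have : Complex.exp (-(((d + e : ℕ) : ℂ) * n * x * Complex.I)) =
      Complex.exp (-(d * n * x * Complex.I)) * Complex.exp (-(e * n * x * Complex.I)) := by
    rw [← Complex.exp_add]; congr 1; push_cast; ring
  rw [this]; ring

lemma TrigP.pow {n d : ℕ} {f : ℝ → ℂ} (hf : TrigP n d f) (j : ℕ) :
    TrigP n (j * d) (fun x => f x ^ j) := by
  induction j with
  | zero => exact ⟨1, by simp, by simp⟩
  | succ j ih =>
    have := ih.mul hf
    simpa only [pow_succ, Nat.succ_mul] using this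

lemma TrigP.fc_zero {n d : ℕ} {f : ℝ → ℂ} (hf : TrigP n d f) (m : ℤ)
    (hm : ∀ i : ℕ, i ≤ 2 * d → m ≠ ((i : ℤ) - d) * n) :
    fourierCoeffOn twoPiPos f m = 0 := by
  obtain ⟨p, hp, hf⟩ := hf
  rw [fc_eq]
  have h1 : ∀ x : ℝ, Complex.exp (-(m * x * Complex.I)) * f x =
      ∑ i ∈ Finset.range (2 * d + 1), p.coeff i *
        Complex.exp ((((((i : ℤ) - d) * n - m : ℤ) : ℂ) * Complex.I) * x) := by
    intro x
    rw [hf, Polynomial.eval_eq_sum_range' (Nat.lt_succ_of_le hp), Finset.mul_sum, Finset.mul_sum]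
    apply Finset.sum_congr rfl
    intro i _
    rw [← Complex.exp_nat_mul]
    have : Complex.exp ((((((i : ℤ) - d) * n - m : ℤ) : ℂ) * Complex.I) * x) =
      Complex.exp (-(m * x * Complex.I)) * (Complex.exp (-(d * n * x * Complex.I)) *
        Complex.exp (i * (n * x * Complex.I))) := by
      rw [← Complex.exp_add, ← Complex.exp_add]; congr 1; push_cast; ring
    rw [this]; ring
  simp_rw [h1]
  rw [intervalIntegral.integral_finsetSum]
  · rw [Finset.sum_eq_zero, smul_zero]
    intro i hi
    rw [intervalIntegral.integral_const_mul, exp_int_integral, mul_zero]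
    have := hm i (by simp at hi; omega)
    intro h; exact this (by linarith)
  · intro i _
    apply Continuous.intervalIntegrable
    fun_prop

lemma exp_conv (n : ℕ) (x φ : ℝ) :
    Complex.exp (((n * x - φ : ℝ) : ℂ) * Complex.I) =
      Complex.exp (-(φ * Complex.I)) * Complex.exp (n * x * Complex.I) := by
  rw [← Complex.exp_add]; congr 1; push_cast; ring

lemma exp_conv2 (n : ℕ) (x φ : ℝ) :
    Complex.exp (-((n * x - φ : ℝ) : ℂ) * Complex.I) =
      Complex.exp (φ * Complex.I) * Complex.exp (-(n * x * Complex.I)) := by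
  rw [← Complex.exp_add]; congr 1; push_cast; ring

lemma trigP_one (n : ℕ) (f : ℝ → ℂ) (a b c : ℂ)
    (h : ∀ x : ℝ, f x = a + b * Complex.exp (n * x * Complex.I)
      + c * Complex.exp (-(n * x * Complex.I))) : TrigP n 1 f := by
  refine ⟨Polynomial.C b * Polynomial.X ^ 2 + Polynomial.C a * Polynomial.X + Polynomial.C c,
    Polynomial.natDegree_quadratic_le, fun x => ?_⟩
  rw [h]
  simp only [Polynomial.eval_add, Polynomial.eval_mul, Polynomial.eval_C, Polynomial.eval_pow,
    Polynomial.eval_X, Nat.cast_one, one_mul]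
  have : Complex.exp (-(n * x * Complex.I)) * Complex.exp (n * x * Complex.I) = 1 := by
    rw [← Complex.exp_add]; simp
  linear_combination (-b * Complex.exp (n * x * Complex.I) - a) * this

lemma trigP_cos (n : ℕ) (A B φ : ℝ) :
    TrigP n 1 (fun x => ((A + B * Real.cos (n * x - φ) : ℝ) : ℂ)) := by
  apply trigP_one n _ A (B / 2 * Complex.exp (-(φ * Complex.I))) (B / 2 * Complex.exp (φ * Complex.I))
  intro x
  rw [Complex.ofReal_add, Complex.ofReal_mul, Complex.ofReal_cos, Complex.cos,
    exp_conv, exp_conv2]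
  ring

lemma trigP_sin (n : ℕ) (B φ : ℝ) :
    TrigP n 1 (fun x => ((B * Real.sin (n * x - φ) : ℝ) : ℂ)) := by
  apply trigP_one n _ 0 (-(B * Complex.I) / 2 * Complex.exp (-(φ * Complex.I)))
    (B * Complex.I / 2 * Complex.exp (φ * Complex.I))
  intro x
  rw [Complex.ofReal_mul, Complex.ofReal_sin, Complex.sin, exp_conv, exp_conv2]
  ring

lemma deriv_u (n : ℕ) (A B φ : ℝ) :
    deriv (fun x : ℝ => ((A + B * Real.cos (n * x - φ) : ℝ) : ℂ)) =
      fun x => ((-(B * n) * Real.sin (n * x - φ) : ℝ) : ℂ) := by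
  funext x
  apply HasDerivAt.deriv
  apply HasDerivAt.ofReal_comp
  have h1 : HasDerivAt (fun x : ℝ => (n : ℝ) * x - φ) n x := by
    simpa using ((hasDerivAt_id x).const_mul (n : ℝ)).sub_const φ
  have := (h1.cos.const_mul B).const_add A
  have e : -(B * n) * Real.sin (n * x - φ) = B * (-Real.sin (n * x - φ) * n) := by ring
  rw [e]
  exact this

lemma seqHs_bound (δ : ℝ) (hδ : 0 ≤ δ) (d : ℕ) : ∃ K : ℝ, 0 < K ∧ ∀ n : ℕ, 1 ≤ n →
    ∀ (b : ℤ → ℂ) (B : ℝ), 0 ≤ B → (∀ m, ‖b m‖ ≤ B) →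
    (∀ m : ℤ, (∀ i : ℕ, i ≤ 2 * d → m ≠ ((i : ℤ) - d) * n) → b m = 0) →
    seqHs δ b ≤ K * (n : ℝ) ^ δ * B := by
  refine ⟨Real.sqrt ((2 * d + 1) * (1 + (d : ℝ) ^ 2) ^ δ), by positivity, ?_⟩
  intro n hn b B hB hbB hb0
  have hn' : (1 : ℝ) ≤ n := by exact_mod_cast hn
  unfold seqHs
  apply Real.sqrt_le_iff.2 ⟨by positivity, ?_⟩
  set S : Finset ℤ := (Finset.range (2 * d + 1)).image (fun i : ℕ => ((i : ℤ) - d) * n) with hS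
  rw [tsum_eq_sum (s := S)]
  · have hcard : (S.card : ℝ) ≤ 2 * d + 1 := by
      have : S.card ≤ 2 * d + 1 := by
        simpa using (Finset.card_image_le (s := Finset.range (2 * d + 1))
          (f := fun i : ℕ => ((i : ℤ) - d) * (n : ℤ)))
      exact_mod_cast this
    have hterm : ∀ m ∈ S, ((1:ℝ) + (m:ℝ)^2) ^ δ * ‖b m‖^2 ≤
        (1 + (d : ℝ) ^ 2) ^ δ * ((n : ℝ) ^ δ) ^ 2 * B ^ 2 := by
      intro m hm
      obtain ⟨i, hi, rfl⟩ := Finset.mem_image.1 hm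
      have hi' : i ≤ 2 * d := by simp at hi; omega
      have hi2 : (i : ℝ) ≤ 2 * d := by exact_mod_cast hi'
      have hi0 : (0 : ℝ) ≤ i := by positivity
      have h1 : ((1:ℝ) + (((((i : ℤ) - d) * n : ℤ)) :ℝ)^2) ^ δ ≤
          (1 + (d : ℝ) ^ 2) ^ δ * ((n : ℝ) ^ δ) ^ 2 := by
        rw [sq ((n : ℝ) ^ δ), ← Real.mul_rpow (by positivity) (by positivity),
          ← Real.mul_rpow (by positivity) (by positivity)]
        apply Real.rpow_le_rpow (by positivity) _ hδ
        push_cast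
        have h2 : ((i : ℝ) - d) ^ 2 ≤ (d : ℝ) ^ 2 := by nlinarith
        have h3 : (1 : ℝ) ≤ n * n := by nlinarith
        nlinarith [mul_le_mul_of_nonneg_right h2 (by positivity : (0:ℝ) ≤ n * n)]
      gcongr
      exact hbB _
    calc _ ≤ ∑ m ∈ S, (1 + (d : ℝ) ^ 2) ^ δ * ((n : ℝ) ^ δ) ^ 2 * B ^ 2 := Finset.sum_le_sum hterm
      _ = S.card * ((1 + (d : ℝ) ^ 2) ^ δ * ((n : ℝ) ^ δ) ^ 2 * B ^ 2) := by simp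
      _ ≤ (2 * d + 1) * ((1 + (d : ℝ) ^ 2) ^ δ * ((n : ℝ) ^ δ) ^ 2 * B ^ 2) := by gcongr
      _ = _ := by
        rw [mul_pow, mul_pow, Real.sq_sqrt (by positivity)]; ring
  · intro m hm
    have : b m = 0 := by
      apply hb0
      intro i hi h
      exact hm (Finset.mem_image.2 ⟨i, by simp; omega, h.symm⟩)
    simp [this]

lemma norm_one_add_sq (m : ℤ) : ‖(1 + (m : ℂ) ^ 2)‖ = 1 + (m : ℝ) ^ 2 := by
  have : (1 + (m : ℂ) ^ 2) = ((1 + (m : ℝ) ^ 2 : ℝ) : ℂ) := by push_cast; rfl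
  rw [this, Complex.norm_of_nonneg (by positivity)]

lemma mult1 (m : ℤ) : ‖Complex.I * (m : ℂ) / (1 + (m : ℂ)^2)‖ ≤ 1 := by
  rw [norm_div, norm_one_add_sq, norm_mul, Complex.norm_I, one_mul, Complex.norm_intCast]
  rw [div_le_one (by positivity)]
  nlinarith [sq_nonneg (|(m : ℝ)| - 1), sq_abs (m : ℝ), abs_nonneg (m : ℝ)]

lemma mult2 (m : ℤ) : ‖1 / (1 + (m : ℂ)^2)‖ ≤ 1 := by
  rw [norm_div, norm_one_add_sq, norm_one]
  rw [div_le_one (by positivity)]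
  nlinarith [sq_nonneg (m : ℝ)]

section
variable (k n : ℕ) (A B φ q : ℝ)

lemma u_bound (hA : |A| ≤ q) (hB : 0 ≤ B) (hBq : B ≤ q) (x : ℝ) :
    |A + B * Real.cos (n * x - φ)| ≤ 2 * q := by
  have h1 : |B * Real.cos (n * x - φ)| ≤ B := by
    rw [abs_mul, abs_of_nonneg hB]
    exact mul_le_of_le_one_right hB (Real.abs_cos_le_one _)
  have := abs_add_le A (B * Real.cos (n * x - φ))
  linarith

lemma ux_bound (hB : 0 ≤ B) (x : ℝ) :
    |-(B * n) * Real.sin (n * x - φ)| ≤ B * n := by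
  rw [abs_mul, abs_neg, abs_of_nonneg (by positivity)]
  exact mul_le_of_le_one_right (by positivity) (Real.abs_sin_le_one _)

lemma F1_bound (hA : |A| ≤ q) (hB : 0 ≤ B) (hBq : B ≤ q) (m : ℤ) :
    ‖F1coeff k (fun x => ((A + B * Real.cos (n * x - φ) : ℝ) : ℂ)) m‖ ≤
      (k + 1) * 2 ^ k * (q ^ k * B) := by
  unfold F1coeff
  have hq : 0 ≤ q := hB.trans hBq
  by_cases hm : m = 0
  · subst hm; simp; positivity
  have key : fourierCoeffOn twoPiPos
      (fun x : ℝ => (((A + B * Real.cos (n * x - φ) : ℝ) : ℂ)) ^ (k + 1)) m =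
      fourierCoeffOn twoPiPos
      (fun x : ℝ => (((A + B * Real.cos (n * x - φ)) ^ (k + 1) - A ^ (k + 1) : ℝ) : ℂ)) m := by
    rw [fc_eq, fc_eq]
    congr 1
    have : ∀ x : ℝ, Complex.exp (-(m * x * Complex.I)) *
        (((A + B * Real.cos (n * x - φ)) ^ (k + 1) - A ^ (k + 1) : ℝ) : ℂ) =
        Complex.exp (-(m * x * Complex.I)) *
          (((A + B * Real.cos (n * x - φ) : ℝ) : ℂ)) ^ (k + 1) -
        Complex.exp (((-m : ℤ) * Complex.I) * x) * (A : ℂ) ^ (k + 1) := by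
      intro x
      have : Complex.exp (((-m : ℤ) * Complex.I) * x) = Complex.exp (-(m * x * Complex.I)) := by
        congr 1; push_cast; ring
      rw [this]; push_cast; ring
    simp_rw [this]
    rw [intervalIntegral.integral_sub, intervalIntegral.integral_mul_const,
      exp_int_integral (-m) (by simpa using hm)]
    · simp
    · apply Continuous.intervalIntegrable; fun_prop
    · apply Continuous.intervalIntegrable; fun_prop
  rw [key, norm_mul]
  have h2 : ‖fourierCoeffOn twoPiPos
      (fun x : ℝ => (((A + B * Real.cos (n * x - φ)) ^ (k + 1) - A ^ (k + 1) : ℝ) : ℂ)) m‖ ≤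
      (k + 1) * 2 ^ k * (q ^ k * B) := by
    apply fc_norm_le
    intro x
    rw [Complex.norm_real, Real.norm_eq_abs]
    have h1 : |B * Real.cos (n * x - φ)| ≤ B := by
      rw [abs_mul, abs_of_nonneg hB]
      exact mul_le_of_le_one_right hB (Real.abs_cos_le_one _)
    have h3 : max |A + B * Real.cos (n * x - φ)| |A| ≤ 2 * q :=
      max_le (u_bound n A B φ q hA hB hBq x) (by linarith)
    calc _ ≤ |A + B * Real.cos (n * x - φ) - A| * ((k + 1 : ℕ) : ℝ) *
          max |A + B * Real.cos (n * x - φ)| |A| ^ (k + 1 - 1) := abs_pow_sub_pow_le _ _ _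
      _ ≤ B * ((k + 1 : ℕ) : ℝ) * (2 * q) ^ k := by
        rw [add_sub_cancel_left, Nat.add_sub_cancel]
        gcongr
      _ = _ := by rw [mul_pow]; push_cast; ring
  calc _ ≤ 1 * ((k + 1) * 2 ^ k * (q ^ k * B)) :=
        mul_le_mul (mult1 m) h2 (norm_nonneg _) zero_le_one
    _ = _ := one_mul _

lemma prod_bound (i j : ℕ) (hA : |A| ≤ q) (hB : 0 ≤ B) (hBq : B ≤ q) (m : ℤ) :
    ‖fourierCoeffOn twoPiPos (fun x : ℝ => (((A + B * Real.cos (n * x - φ) : ℝ) : ℂ)) ^ i *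
      ((-(B * n) * Real.sin (n * x - φ) : ℝ) : ℂ) ^ j) m‖ ≤ 2 ^ i * (q ^ i * (B * n) ^ j) := by
  apply fc_norm_le
  intro x
  rw [norm_mul, norm_pow, norm_pow, Complex.norm_real, Complex.norm_real, Real.norm_eq_abs,
    Real.norm_eq_abs, ← mul_assoc, ← mul_pow]
  have h1 := u_bound n A B φ q hA hB hBq x
  have h2 := ux_bound n B φ hB x
  have hq : 0 ≤ q := hB.trans hBq
  gcongr

lemma F2_bound (hk : 2 ≤ k) (hA : |A| ≤ q) (hB : 0 ≤ B) (hBq : B ≤ q) (m : ℤ) :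
    ‖F2coeff k (fun x => ((A + B * Real.cos (n * x - φ) : ℝ) : ℂ)) m‖ ≤
      (k + 1) * 2 ^ k * (q ^ (k - 1) * (B * n) ^ 2) := by
  unfold F2coeff
  rw [deriv_u]
  have hq : 0 ≤ q := hB.trans hBq
  have hk' : (2 : ℝ) ≤ k := by exact_mod_cast hk
  have h := prod_bound n A B φ q (k - 1) 2 hA hB hBq m
  have hc : ‖(2 * (k : ℂ) - 1) / 2‖ ≤ k + 1 := by
    have : (2 * (k : ℂ) - 1) / 2 = (((2 * (k : ℝ) - 1) / 2 : ℝ) : ℂ) := by push_cast; rfl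
    rw [this, Complex.norm_of_nonneg (by linarith)]; linarith
  rw [norm_mul, norm_mul]
  calc _ ≤ ((k : ℝ) + 1) * 1 * (2 ^ (k - 1) * (q ^ (k - 1) * (B * n) ^ 2)) := by
        gcongr
        exact mult1 m
    _ ≤ ((k : ℝ) + 1) * 1 * (2 ^ k * (q ^ (k - 1) * (B * n) ^ 2)) := by
        gcongr
        · norm_num
        · omega
    _ = _ := by ring

lemma F3_bound (hk : 2 ≤ k) (hA : |A| ≤ q) (hB : 0 ≤ B) (hBq : B ≤ q) (m : ℤ) :
    ‖F3coeff k (fun x => ((A + B * Real.cos (n * x - φ) : ℝ) : ℂ)) m‖ ≤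
      (k + 1) * 2 ^ k * (q ^ (k - 2) * (B * n) ^ 3) := by
  unfold F3coeff
  rw [deriv_u]
  have hq : 0 ≤ q := hB.trans hBq
  have hk' : (2 : ℝ) ≤ k := by exact_mod_cast hk
  have h := prod_bound n A B φ q (k - 2) 3 hA hB hBq m
  have hc : ‖((k : ℂ) - 1) / 2‖ ≤ k + 1 := by
    have : ((k : ℂ) - 1) / 2 = ((((k : ℝ) - 1) / 2 : ℝ) : ℂ) := by push_cast; rfl
    rw [this, Complex.norm_of_nonneg (by linarith)]; linarith
  rw [norm_mul, norm_mul]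
  calc _ ≤ ((k : ℝ) + 1) * 1 * (2 ^ (k - 2) * (q ^ (k - 2) * (B * n) ^ 3)) := by
        gcongr
        exact mult2 m
    _ ≤ ((k : ℝ) + 1) * 1 * (2 ^ k * (q ^ (k - 2) * (B * n) ^ 3)) := by
        gcongr
        · norm_num
        · omega
    _ = _ := by ring

lemma F1_supp (m : ℤ) (hm : ∀ i : ℕ, i ≤ 2 * (k + 1) → m ≠ ((i : ℤ) - (k + 1 : ℕ)) * n) :
    F1coeff k (fun x => ((A + B * Real.cos (n * x - φ) : ℝ) : ℂ)) m = 0 := by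
  unfold F1coeff
  have := (trigP_cos n A B φ).pow (k + 1)
  rw [mul_one] at this
  rw [this.fc_zero m hm, mul_zero]

lemma prod_supp (i j d : ℕ) (hd : i + j = d) (m : ℤ)
    (hm : ∀ i : ℕ, i ≤ 2 * d → m ≠ ((i : ℤ) - (d : ℕ)) * n) :
    fourierCoeffOn twoPiPos (fun x : ℝ => (((A + B * Real.cos (n * x - φ) : ℝ) : ℂ)) ^ i *
      ((-(B * n) * Real.sin (n * x - φ) : ℝ) : ℂ) ^ j) m = 0 := by
  have := ((trigP_cos n A B φ).pow i).mul ((trigP_sin n (-(B * n)) φ).pow j)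
  rw [mul_one, mul_one, hd] at this
  exact this.fc_zero m hm

lemma F2_supp (hk : 2 ≤ k) (m : ℤ)
    (hm : ∀ i : ℕ, i ≤ 2 * (k + 1) → m ≠ ((i : ℤ) - (k + 1 : ℕ)) * n) :
    F2coeff k (fun x => ((A + B * Real.cos (n * x - φ) : ℝ) : ℂ)) m = 0 := by
  unfold F2coeff
  rw [deriv_u, prod_supp n A B φ (k - 1) 2 (k + 1) (by omega) m hm, mul_zero]

lemma F3_supp (hk : 2 ≤ k) (m : ℤ)
    (hm : ∀ i : ℕ, i ≤ 2 * (k + 1) → m ≠ ((i : ℤ) - (k + 1 : ℕ)) * n) :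
    F3coeff k (fun x => ((A + B * Real.cos (n * x - φ) : ℝ) : ℂ)) m = 0 := by
  unfold F3coeff
  rw [deriv_u, prod_supp n A B φ (k - 2) 3 (k + 1) (by omega) m hm, mul_zero]

end

set_option maxHeartbeats 1000000 in
theorem F_approxSol_estimates (s : ℝ) (hs : 3/2 < s) (k : ℕ) (hk : 2 ≤ k)
    (δ : ℝ) (hδ : δ ∈ Set.Ioo (1/2 : ℝ) (min (s - 1) (3/2)))
    (l : ℝ) (hl : (Odd k ∧ (l = -1 ∨ l = 1)) ∨ (Even k ∧ (l = 0 ∨ l = 1))) :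
    0 < rs s δ k ∧
    ∃ C : ℝ, 0 < C ∧ ∃ N : ℕ, ∀ n : ℕ, N ≤ n → ∀ t : ℝ, 0 ≤ t →
      seqHs δ (F1coeff k (approxSolC s l k n t)) ≤ C * (n : ℝ) ^ (-s + δ - 1) ∧
      seqHs δ (F2coeff k (approxSolC s l k n t)) ≤
        C * (n : ℝ) ^ (-2*s + δ + 1 + 1/(k:ℝ)) ∧
      seqHs δ (F3coeff k (approxSolC s l k n t)) ≤
        C * (n : ℝ) ^ (-3*s + δ + 2 + 2/(k:ℝ)) ∧
      seqHs δ (fun m => F1coeff k (approxSolC s l k n t) m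
        + F2coeff k (approxSolC s l k n t) m
        + F3coeff k (approxSolC s l k n t) m) ≤ C * (n : ℝ) ^ (-(rs s δ k)) := by
  obtain ⟨hδ1, hδ2⟩ := hδ
  have hδ3 : δ < s - 1 := lt_of_lt_of_le hδ2 (min_le_left _ _)
  have hk' : (2 : ℝ) ≤ k := by exact_mod_cast hk
  have hk0 : (0 : ℝ) < k := by linarith
  have hkk : (k : ℝ) * (1 / k) = 1 := by field_simp
  have hki : 1 / (k : ℝ) ≤ 1 / 2 := by gcongr
  have hki0 : 0 < 1 / (k : ℝ) := by positivity
  have e1 : (2*(k:ℝ) + 1)/(k:ℝ) = 2 + 1 / k := by field_simp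
  have e2 : ((k:ℝ) + 1)/(k:ℝ) = 1 + 1 / k := by field_simp
  have hl1 : |l| ≤ 1 := by
    rcases hl with ⟨_, h | h⟩ | ⟨_, h | h⟩ <;> subst h <;> simp
  refine ⟨?_, ?_⟩
  · unfold rs
    rw [e1, e2]
    split_ifs <;> linarith
  obtain ⟨K, hK, hKb⟩ := seqHs_bound δ (by linarith) (k + 1)
  have hDpos : (0 : ℝ) < (k + 1) * 2 ^ k := by positivity
  set D : ℝ := (k + 1) * 2 ^ k with hD
  refine ⟨3 * K * D, by positivity, 1, ?_⟩
  intro n hn t _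
  have hn1 : (1 : ℝ) ≤ n := by exact_mod_cast hn
  have hn0 : (0 : ℝ) < n := by linarith
  set q : ℝ := (n : ℝ) ^ (-(1:ℝ)/(k:ℝ)) with hq
  set B : ℝ := (n : ℝ) ^ (-s) with hB
  have hu : approxSolC s l k n t =
      fun x => ((l * q + B * Real.cos (n * x - l * t) : ℝ) : ℂ) := rfl
  have hq0 : 0 < q := by positivity
  have hB0 : 0 ≤ B := by positivity
  have hBq : B ≤ q := by
    apply Real.rpow_le_rpow_of_exponent_le hn1
    rw [neg_div]; linarith
  have hA : |l * q| ≤ q := by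
    rw [abs_mul, abs_of_pos hq0]
    exact mul_le_of_le_one_left hq0.le hl1
  have hqp : ∀ j : ℕ, q ^ j = (n : ℝ) ^ (-(1 / (k : ℝ)) * j) := by
    intro j
    rw [hq, ← Real.rpow_natCast, ← Real.rpow_mul hn0.le, neg_div]
  have hBn : B * n = (n : ℝ) ^ (-s + 1) := by
    rw [Real.rpow_add hn0, Real.rpow_one]
  have hBp : ∀ j : ℕ, (B * n) ^ j = (n : ℝ) ^ ((-s + 1) * j) := by
    intro j
    rw [hBn, ← Real.rpow_natCast, ← Real.rpow_mul hn0.le]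
  have v1 : (n : ℝ) ^ δ * (q ^ k * B) = (n : ℝ) ^ (-s + δ - 1) := by
    rw [hqp, hB, ← Real.rpow_add hn0, ← Real.rpow_add hn0]
    congr 1
    linarith
  have v2 : (n : ℝ) ^ δ * (q ^ (k - 1) * (B * n) ^ 2) =
      (n : ℝ) ^ (-2*s + δ + 1 + 1/(k:ℝ)) := by
    rw [hqp, hBp, ← Real.rpow_add hn0, ← Real.rpow_add hn0]
    congr 1
    rw [Nat.cast_sub (by omega)]
    push_cast
    linarith
  have v3 : (n : ℝ) ^ δ * (q ^ (k - 2) * (B * n) ^ 3) =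
      (n : ℝ) ^ (-3*s + δ + 2 + 2/(k:ℝ)) := by
    rw [hqp, hBp, ← Real.rpow_add hn0, ← Real.rpow_add hn0]
    congr 1
    rw [Nat.cast_sub (by omega)]
    have : 2 / (k : ℝ) = 2 * (1 / k) := by ring
    rw [this]
    push_cast
    linarith
  have b1 := F1_bound k n (l * q) B (l * t) q hA hB0 hBq
  have b2 := F2_bound k n (l * q) B (l * t) q hk hA hB0 hBq
  have b3 := F3_bound k n (l * q) B (l * t) q hk hA hB0 hBq
  have s1 := F1_supp k n (l * q) B (l * t)
  have s2 := F2_supp k n (l * q) B (l * t) hk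
  have s3 := F3_supp k n (l * q) B (l * t) hk
  rw [← hu] at b1 b2 b3 s1 s2 s3
  rw [← hD] at b1 b2 b3
  have p1 : 0 < (n : ℝ) ^ (-s + δ - 1) := by positivity
  have p2 : 0 < (n : ℝ) ^ (-2*s + δ + 1 + 1/(k:ℝ)) := by positivity
  have p3 : 0 < (n : ℝ) ^ (-3*s + δ + 2 + 2/(k:ℝ)) := by positivity
  have hKD : 0 < K * D := by positivity
  refine ⟨?_, ?_, ?_, ?_⟩
  · have h := hKb n hn _ _ (by positivity) b1 s1
    have : K * (n : ℝ) ^ δ * (D * (q ^ k * B)) = K * D * ((n : ℝ) ^ (-s + δ - 1)) := by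
      rw [← v1]; ring
    rw [this] at h
    linarith [mul_pos hKD p1]
  · have h := hKb n hn _ _ (by positivity) b2 s2
    have : K * (n : ℝ) ^ δ * (D * (q ^ (k - 1) * (B * n) ^ 2)) =
        K * D * ((n : ℝ) ^ (-2*s + δ + 1 + 1/(k:ℝ))) := by
      rw [← v2]; ring
    rw [this] at h
    linarith [mul_pos hKD p2]
  · have h := hKb n hn _ _ (by positivity) b3 s3
    have : K * (n : ℝ) ^ δ * (D * (q ^ (k - 2) * (B * n) ^ 3)) =
        K * D * ((n : ℝ) ^ (-3*s + δ + 2 + 2/(k:ℝ))) := by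
      rw [← v3]; ring
    rw [this] at h
    linarith [mul_pos hKD p3]
  · have h := hKb n hn (fun m => F1coeff k (approxSolC s l k n t) m
        + F2coeff k (approxSolC s l k n t) m
        + F3coeff k (approxSolC s l k n t) m)
        (D * (q ^ k * B) + D * (q ^ (k - 1) * (B * n) ^ 2) + D * (q ^ (k - 2) * (B * n) ^ 3))
        (by positivity)
        (fun m => (norm_add₃_le).trans (add_le_add (add_le_add (b1 m) (b2 m)) (b3 m)))
        (fun m hm => by simp only [s1 m hm, s2 m hm, s3 m hm, add_zero])
    have : K * (n : ℝ) ^ δ * (D * (q ^ k * B) + D * (q ^ (k - 1) * (B * n) ^ 2)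
        + D * (q ^ (k - 2) * (B * n) ^ 3)) =
        K * D * ((n : ℝ) ^ (-s + δ - 1) + (n : ℝ) ^ (-2*s + δ + 1 + 1/(k:ℝ))
          + (n : ℝ) ^ (-3*s + δ + 2 + 2/(k:ℝ))) := by
      rw [← v1, ← v2, ← v3]; ring
    rw [this] at h
    have e3 : 2 / (k : ℝ) = 2 * (1 / k) := by ring
    have c1 : (n : ℝ) ^ (-s + δ - 1) ≤ (n : ℝ) ^ (-(rs s δ k)) := by
      apply Real.rpow_le_rpow_of_exponent_le hn1
      unfold rs
      rw [e1, e2]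
      split_ifs <;> linarith
    have c2 : (n : ℝ) ^ (-2*s + δ + 1 + 1/(k:ℝ)) ≤ (n : ℝ) ^ (-(rs s δ k)) := by
      apply Real.rpow_le_rpow_of_exponent_le hn1
      unfold rs
      rw [e1, e2]
      split_ifs <;> linarith
    have c3 : (n : ℝ) ^ (-3*s + δ + 2 + 2/(k:ℝ)) ≤ (n : ℝ) ^ (-(rs s δ k)) := by
      apply Real.rpow_le_rpow_of_exponent_le hn1
      unfold rs
      rw [e1, e2, e3]
      split_ifs <;> linarith
    calc _ ≤ _ := h
      _ ≤ K * D * ((n : ℝ) ^ (-(rs s δ k)) + (n : ℝ) ^ (-(rs s δ k))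
          + (n : ℝ) ^ (-(rs s δ k))) := by gcongr
      _ = _ := by ring
end
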